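/- arXiv:2206.02463 — 7 statements merged into one kernel-verified Lean document; each statement's English description precedes it below -/
import Mathlib

section
/- Let μ_n, μ, ν_n, ν be Borel probability measures on ℝ^m with finite second moments such that μ_n → μ and ν_n → ν in the topology T₂ (weak* convergence together with convergence of second moments), and let γ_n ∈ K(μ_n, ν_n) for each n. Then there is a subsequence (γ_{n_k}) converging in T₂ to some γ₀ ∈ K(μ,ν). In particular, the set { (μ,ν,γ) : μ,ν ∈ M₂(m), γ ∈ K(μ,ν) } is sequentially closed in M₂(m) × M₂(m) × M₂(2m) for the product of the T₂ topologies. -/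
open MeasureTheory ProbabilityTheory Filter Set
open scoped ENNReal

noncomputable section

/-- A random variable `Z` is independent of a sub-σ-algebra `𝒜` (w.r.t. the probability `P`)
if the σ-algebra generated by `Z` (the comap of the Borel σ-algebra of the target)
is independent of `𝒜`. -/
def IndepOfSigma {Ω : Type*} {E : Type*} [MeasurableSpace E]
    (𝒜 : MeasurableSpace Ω) [MeasurableSpace Ω] (Z : Ω → E) (P : Measure Ω) : Prop :=
  ProbabilityTheory.Indep (MeasurableSpace.comap Z inferInstance) 𝒜 P

/-- `γ` is a coupling of the probability measures `μ` and `ν`: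
a probability measure on the product with marginals `μ` and `ν`. -/
def IsCoupling {E : Type*} [MeasurableSpace E] (μ ν : MeasureTheory.Measure E)
    (γ : MeasureTheory.Measure (E × E)) : Prop :=
  MeasureTheory.IsProbabilityMeasure γ ∧ γ.map Prod.fst = μ ∧ γ.map Prod.snd = ν

/-- The squared Wasserstein distance `W²(μ,ν)`: the infimum of `∫ |x−y|² dγ`
over all couplings `γ` of `μ` and `ν`. -/
noncomputable def sqWasserstein {E : Type*} [MeasurableSpace E] [NormedAddCommGroup E]
    (μ ν : MeasureTheory.Measure E) : ℝ≥0∞ :=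
  sInf {c | ∃ γ : MeasureTheory.Measure (E × E), IsCoupling μ ν γ ∧
    c = ∫⁻ p, edist p.1 p.2 ^ 2 ∂γ}

/-- `γ` is an optimal coupling of `μ` and `ν`: a coupling realising the
squared Wasserstein distance, i.e. an element of `K(μ,ν)`. -/
def IsOptimalCoupling {E : Type*} [MeasurableSpace E] [NormedAddCommGroup E]
    (μ ν : MeasureTheory.Measure E) (γ : MeasureTheory.Measure (E × E)) : Prop :=
  IsCoupling μ ν γ ∧ (∫⁻ p, edist p.1 p.2 ^ 2 ∂γ) = sqWasserstein μ ν

/-- Convergence of a sequence of measures in the topology `T₂`: weak convergence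
(convergence of the integrals of all bounded continuous functions) together with
convergence of second moments. -/
def T2Tendsto {F : Type*} [MeasurableSpace F] [NormedAddCommGroup F]
    (γ : ℕ → MeasureTheory.Measure F) (γ₀ : MeasureTheory.Measure F) : Prop :=
  (∀ f : BoundedContinuousFunction F ℝ,
      Filter.Tendsto (fun n => ∫ x, f x ∂(γ n)) Filter.atTop (nhds (∫ x, f x ∂γ₀)))
    ∧ Filter.Tendsto (fun n => ∫⁻ x, (‖x‖₊ : ℝ≥0∞) ^ 2 ∂(γ n)) Filter.atTop
        (nhds (∫⁻ x, (‖x‖₊ : ℝ≥0∞) ^ 2 ∂γ₀))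

/-- Weak convergence of probability measures upgrades to convergence of the integral of any
continuous function dominated by a continuous function whose integrals converge. -/
lemma tendsto_integral_of_abs_le_of_tendsto {X : Type*} [TopologicalSpace X] [MeasurableSpace X]
    [OpensMeasurableSpace X] [HasOuterApproxClosed X]
    {Ps : ℕ → ProbabilityMeasure X} {P : ProbabilityMeasure X} (hP : Tendsto Ps atTop (nhds P))
    {f h : X → ℝ} (hf : Continuous f) (hh : Continuous h) (hfh : ∀ x, |f x| ≤ h x)
    (hPs_int : ∀ n, Integrable h (Ps n : Measure X)) (hP_int : Integrable h (P : Measure X))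
    (hlim : Tendsto (fun n => ∫ x, h x ∂(Ps n : Measure X)) atTop
      (nhds (∫ x, h x ∂(P : Measure X)))) :
    Tendsto (fun n => ∫ x, f x ∂(Ps n : Measure X)) atTop (nhds (∫ x, f x ∂(P : Measure X))) := by
  have lower : ∀ g : X → ℝ, Continuous g → 0 ≤ g → (∀ n, Integrable g (Ps n : Measure X)) →
      Integrable g (P : Measure X) → ∀ a < ∫ x, g x ∂(P : Measure X),
      ∀ᶠ n in atTop, a < ∫ x, g x ∂(Ps n : Measure X) := by
    intro g hg hg0 hgi hgi0 a ha
    rcases lt_or_ge a 0 with ha0 | ha0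
    · exact .of_forall fun n => ha0.trans_le (integral_nonneg hg0)
    have key := lintegral_le_liminf_lintegral_of_forall_isOpen_measure_le_liminf_measure
      (μ := (P : Measure X)) (μs := fun n => (Ps n : Measure X)) hg hg0
      (fun G hG => ProbabilityMeasure.le_liminf_measure_open_of_tendsto hP hG)
    rw [← ofReal_integral_eq_lintegral_ofReal hgi0 (.of_forall hg0)] at key
    have hlt := ((ENNReal.ofReal_lt_ofReal_iff (ha0.trans_lt ha)).2 ha).trans_le key
    filter_upwards [eventually_lt_of_lt_liminf hlt] with n hn
    rw [← ofReal_integral_eq_lintegral_ofReal (hgi n) (.of_forall hg0)] at hn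
    exact ENNReal.ofReal_lt_ofReal_iff'.1 hn |>.1
  have int_f : ∀ Q : Measure X, Integrable h Q → Integrable f Q := fun Q hQ =>
    hQ.mono' hf.aestronglyMeasurable (.of_forall hfh)
  rw [tendsto_order]
  constructor
  · intro a ha
    have h1 := lower (fun x => h x + f x) (hh.add hf) (fun x => by
      have := abs_le.1 (hfh x); simp only [Pi.zero_apply]; linarith)
      (fun n => (hPs_int n).add (int_f _ (hPs_int n))) (hP_int.add (int_f _ hP_int))
      (∫ x, h x ∂(P : Measure X) + (∫ x, f x ∂(P : Measure X) + a) / 2) (by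
        rw [integral_add hP_int (int_f _ hP_int)]; linarith)
    have h2 := (tendsto_order.1 hlim).2
      (∫ x, h x ∂(P : Measure X) + (∫ x, f x ∂(P : Measure X) - a) / 2) (by linarith)
    filter_upwards [h1, h2] with n h1 h2
    rw [integral_add (hPs_int n) (int_f _ (hPs_int n))] at h1
    linarith
  · intro a ha
    have h1 := lower (fun x => h x - f x) (hh.sub hf) (fun x => by
      have := abs_le.1 (hfh x); simp only [Pi.zero_apply]; linarith)
      (fun n => (hPs_int n).sub (int_f _ (hPs_int n))) (hP_int.sub (int_f _ hP_int))
      (∫ x, h x ∂(P : Measure X) - (∫ x, f x ∂(P : Measure X) + a) / 2) (by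
        rw [integral_sub hP_int (int_f _ hP_int)]; linarith)
    have h2 := (tendsto_order.1 hlim).2
      (∫ x, h x ∂(P : Measure X) + (a - ∫ x, f x ∂(P : Measure X)) / 2) (by linarith)
    filter_upwards [h1, h2] with n h1 h2
    rw [integral_sub (hPs_int n) (int_f _ (hPs_int n))] at h1
    linarith

/-- The dominating weight `1 + ‖x‖² + ‖y‖²` on a product space. -/
def sqWeight {E : Type*} [NormedAddCommGroup E] (p : E × E) : ℝ := 1 + ‖p.1‖ ^ 2 + ‖p.2‖ ^ 2

lemma continuous_sqWeight {E : Type*} [NormedAddCommGroup E] :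
    Continuous (sqWeight : E × E → ℝ) := by
  unfold sqWeight; fun_prop

lemma dist_sq_le_sqWeight {E : Type*} [NormedAddCommGroup E] (p : E × E) :
    dist p.1 p.2 ^ 2 ≤ 2 * sqWeight p := by
  have h := norm_sub_le p.1 p.2
  rw [dist_eq_norm, sqWeight]
  nlinarith [norm_nonneg (p.1 - p.2), sq_nonneg (‖p.1‖ - ‖p.2‖)]

lemma norm_sq_le_sqWeight {E : Type*} [NormedAddCommGroup E] (p : E × E) :
    ‖p‖ ^ 2 ≤ 1 * sqWeight p := by
  rw [one_mul, sqWeight, Prod.norm_def]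
  rcases max_choice ‖p.1‖ ‖p.2‖ with h | h <;> rw [h] <;>
    nlinarith [sq_nonneg ‖p.1‖, sq_nonneg ‖p.2‖]

namespace IsCoupling

lemma prod {E : Type*} [MeasurableSpace E] (μ ν : Measure E) [IsProbabilityMeasure μ]
    [IsProbabilityMeasure ν] : IsCoupling μ ν (μ.prod ν) :=
  ⟨inferInstance, by simp, by simp⟩

variable {E : Type*} [MeasurableSpace E] {μ ν : Measure E} {γ : Measure (E × E)}

lemma integrable_fst (hγ : IsCoupling μ ν γ) {f : E → ℝ} (hf : Integrable f μ) :
    Integrable (fun p : E × E => f p.1) γ := by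
  rw [← hγ.2.1] at hf; exact hf.comp_measurable measurable_fst

lemma integrable_snd (hγ : IsCoupling μ ν γ) {f : E → ℝ} (hf : Integrable f ν) :
    Integrable (fun p : E × E => f p.2) γ := by
  rw [← hγ.2.2] at hf; exact hf.comp_measurable measurable_snd

variable [NormedAddCommGroup E]

lemma integrable_sqWeight (hγ : IsCoupling μ ν γ) (hμ : Integrable (fun x => ‖x‖ ^ 2) μ)
    (hν : Integrable (fun x => ‖x‖ ^ 2) ν) : Integrable sqWeight γ := by
  have := hγ.1
  exact ((integrable_const 1).add (hγ.integrable_fst hμ)).add (hγ.integrable_snd hν)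

variable [BorelSpace E]

lemma integral_fst (hγ : IsCoupling μ ν γ) {f : E → ℝ} (hf : Continuous f) :
    ∫ p, f p.1 ∂γ = ∫ x, f x ∂μ := by
  rw [← hγ.2.1, integral_map measurable_fst.aemeasurable hf.aestronglyMeasurable]

lemma integral_snd (hγ : IsCoupling μ ν γ) {f : E → ℝ} (hf : Continuous f) :
    ∫ p, f p.2 ∂γ = ∫ x, f x ∂ν := by
  rw [← hγ.2.2, integral_map measurable_snd.aemeasurable hf.aestronglyMeasurable]

lemma integral_sqWeight (hγ : IsCoupling μ ν γ) (hμ : Integrable (fun x => ‖x‖ ^ 2) μ)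
    (hν : Integrable (fun x => ‖x‖ ^ 2) ν) :
    ∫ p, sqWeight p ∂γ = 1 + ∫ x, ‖x‖ ^ 2 ∂μ + ∫ x, ‖x‖ ^ 2 ∂ν := by
  have := hγ.1
  have h1 := hγ.integrable_fst hμ
  have h2 : Integrable (fun p : E × E => 1 + ‖p.1‖ ^ 2) γ := (integrable_const 1).add h1
  simp only [sqWeight]
  rw [integral_add h2 (hγ.integrable_snd hν),
    integral_add (integrable_const 1) h1, hγ.integral_fst (f := fun x => ‖x‖ ^ 2) (by fun_prop),
    hγ.integral_snd (f := fun x => ‖x‖ ^ 2) (by fun_prop)]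
  simp

variable [SecondCountableTopology E]

lemma integrable_of_abs_le (hγ : IsCoupling μ ν γ) (hμ : Integrable (fun x => ‖x‖ ^ 2) μ)
    (hν : Integrable (fun x => ‖x‖ ^ 2) ν) {f : E × E → ℝ} (hf : Continuous f) {C : ℝ}
    (hfC : ∀ p, |f p| ≤ C * sqWeight p) : Integrable f γ :=
  ((hγ.integrable_sqWeight hμ hν).const_mul C).mono' hf.aestronglyMeasurable (.of_forall hfC)

lemma lintegral_edist_sq (hγ : IsCoupling μ ν γ) (hμ : Integrable (fun x => ‖x‖ ^ 2) μ)
    (hν : Integrable (fun x => ‖x‖ ^ 2) ν) :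
    ∫⁻ p, edist p.1 p.2 ^ 2 ∂γ = ENNReal.ofReal (∫ p, dist p.1 p.2 ^ 2 ∂γ) := by
  rw [ofReal_integral_eq_lintegral_ofReal
    (hγ.integrable_of_abs_le hμ hν (f := fun p => dist p.1 p.2 ^ 2) (by fun_prop)
      (fun p => by rw [abs_of_nonneg (by positivity)]; exact dist_sq_le_sqWeight p))
    (.of_forall fun p => by positivity)]
  simp_rw [edist_dist, ENNReal.ofReal_pow dist_nonneg]

lemma tendsto_integral {μs νs : ℕ → Measure E} {γs : ℕ → ProbabilityMeasure (E × E)}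
    {γ : ProbabilityMeasure (E × E)} (hlim : Tendsto γs atTop (nhds γ))
    (hγs : ∀ n, IsCoupling (μs n) (νs n) (γs n)) (hγ : IsCoupling μ ν γ)
    (hμs : ∀ n, Integrable (fun x => ‖x‖ ^ 2) (μs n))
    (hνs : ∀ n, Integrable (fun x => ‖x‖ ^ 2) (νs n))
    (hμ : Integrable (fun x => ‖x‖ ^ 2) μ) (hν : Integrable (fun x => ‖x‖ ^ 2) ν)
    (hμlim : Tendsto (fun n => ∫ x, ‖x‖ ^ 2 ∂(μs n)) atTop (nhds (∫ x, ‖x‖ ^ 2 ∂μ)))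
    (hνlim : Tendsto (fun n => ∫ x, ‖x‖ ^ 2 ∂(νs n)) atTop (nhds (∫ x, ‖x‖ ^ 2 ∂ν)))
    {f : E × E → ℝ} (hf : Continuous f) {C : ℝ} (hfC : ∀ p, |f p| ≤ C * sqWeight p) :
    Tendsto (fun n => ∫ p, f p ∂(γs n : Measure (E × E))) atTop
      (nhds (∫ p, f p ∂(γ : Measure (E × E)))) := by
  refine tendsto_integral_of_abs_le_of_tendsto hlim hf (continuous_sqWeight.const_mul C) hfC
    (fun n => ((hγs n).integrable_sqWeight (hμs n) (hνs n)).const_mul C)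
    ((hγ.integrable_sqWeight hμ hν).const_mul C) ?_
  simp only [integral_const_mul]
  simp only [fun n => (hγs n).integral_sqWeight (hμs n) (hνs n), hγ.integral_sqWeight hμ hν]
  exact ((hμlim.const_add 1).add hνlim).const_mul C

end IsCoupling

lemma integrable_dist_sq {E : Type*} [NormedAddCommGroup E] [MeasurableSpace E] [BorelSpace E]
    {μ : Measure E} [IsFiniteMeasure μ] (hμ : Integrable (fun x => ‖x‖ ^ 2) μ) (z : E) :
    Integrable (fun x => dist x z ^ 2) μ := by
  refine ((hμ.const_mul 2).add (integrable_const (2 * ‖z‖ ^ 2))).mono'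
    (by fun_prop : Continuous fun x => dist x z ^ 2).aestronglyMeasurable (.of_forall fun x => ?_)
  rw [Real.norm_of_nonneg (sq_nonneg _), dist_eq_norm]
  have := norm_sub_le x z
  simp only [Pi.add_apply]
  nlinarith [norm_nonneg (x - z), sq_nonneg (‖x‖ - ‖z‖)]

/-- A finite partition of unity by continuous, everywhere positive functions. -/
structure IsPositivePartition {ι E : Type*} [Fintype ι] [TopologicalSpace E]
    (φ : ι → E → ℝ) : Prop where
  continuous : ∀ i, Continuous (φ i)
  pos : ∀ i x, 0 < φ i x
  sum_eq_one : ∀ x, ∑ i, φ i x = 1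

namespace IsPositivePartition

section

variable {ι E : Type*} [Fintype ι] [TopologicalSpace E] {φ : ι → E → ℝ}

lemma le_one (hφ : IsPositivePartition φ) (i : ι) (x : E) : φ i x ≤ 1 := by
  rw [← hφ.sum_eq_one x]
  exact Finset.single_le_sum (f := fun i => φ i x) (fun j _ => (hφ.pos j x).le)
    (Finset.mem_univ i)

lemma abs_le_one (hφ : IsPositivePartition φ) (i : ι) (x : E) : |φ i x| ≤ 1 := by
  rw [abs_of_pos (hφ.pos i x)]; exact hφ.le_one i x

lemma apply_mul_apply_pos (hφ : IsPositivePartition φ) (i j : ι) (x y : E) : 0 < φ i x * φ j y :=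
  mul_pos (hφ.pos i x) (hφ.pos j y)

lemma abs_mul_le_one (hφ : IsPositivePartition φ) (i j : ι) (x y : E) :
    |φ i x * φ j y| ≤ 1 := by
  rw [abs_mul]
  exact mul_le_one₀ (hφ.abs_le_one i x) (abs_nonneg _) (hφ.abs_le_one j y)

end

variable {ι E : Type*} [Fintype ι] [NormedAddCommGroup E] {φ : ι → E → ℝ}

lemma abs_mul_dist_sq_le (hφ : IsPositivePartition φ) (i j : ι) (p : E × E) :
    |φ i p.1 * φ j p.2 * dist p.1 p.2 ^ 2| ≤ 2 * sqWeight p := by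
  rw [abs_mul, abs_of_nonneg (sq_nonneg (dist p.1 p.2))]
  exact (mul_le_of_le_one_left (sq_nonneg _) (hφ.abs_mul_le_one i j _ _)).trans
    (dist_sq_le_sqWeight p)

lemma continuous_mul_dist_sq (hφ : IsPositivePartition φ) (i j : ι) :
    Continuous fun p : E × E => φ i p.1 * φ j p.2 * dist p.1 p.2 ^ 2 := by
  have := hφ.continuous; fun_prop

variable [MeasurableSpace E] [BorelSpace E] {μ ν : Measure E} {γ : Measure (E × E)}

lemma integrable (hφ : IsPositivePartition φ) (μ : Measure E) [IsFiniteMeasure μ] (i : ι) :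
    Integrable (φ i) μ :=
  (integrable_const (1 : ℝ)).mono' (hφ.continuous i).aestronglyMeasurable
    (.of_forall (hφ.abs_le_one i))

lemma integrable_mul_right {X : Type*} [MeasurableSpace X] {γ : Measure X}
    (hφ : IsPositivePartition φ) {q : X → E} (hq : Measurable q) {g : X → ℝ}
    (hg : Integrable g γ) (i : ι) : Integrable (fun p => φ i (q p) * g p) γ :=
  hg.bdd_mul (c := 1) ((hφ.continuous i).measurable.comp hq).aestronglyMeasurable
    (.of_forall fun p => hφ.abs_le_one i (q p))

lemma sum_integral_mul {X : Type*} [MeasurableSpace X] {γ : Measure X}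
    (hφ : IsPositivePartition φ) {q : X → E} (hq : Measurable q) {g : X → ℝ}
    (hg : Integrable g γ) : ∑ i, ∫ p, φ i (q p) * g p ∂γ = ∫ p, g p ∂γ := by
  rw [← integral_finsetSum _ fun i _ => hφ.integrable_mul_right hq hg i]
  simp_rw [← Finset.sum_mul, hφ.sum_eq_one, one_mul]

lemma integral_pos (hφ : IsPositivePartition φ) (μ : Measure E) [IsProbabilityMeasure μ] (i : ι) :
    0 < ∫ x, φ i x ∂μ := by
  rw [integral_pos_iff_support_of_nonneg (fun x => (hφ.pos i x).le) (hφ.integrable μ i)]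
  simp [Function.support_eq_univ fun x => (hφ.pos i x).ne']

variable [SecondCountableTopology E]

lemma integrable_mul (hφ : IsPositivePartition φ) (γ : Measure (E × E)) [IsFiniteMeasure γ]
    (i j : ι) : Integrable (fun p : E × E => φ i p.1 * φ j p.2) γ :=
  (integrable_const (1 : ℝ)).mono' (by
      have := hφ.continuous; exact (by fun_prop : Continuous _).aestronglyMeasurable)
    (.of_forall fun p => hφ.abs_mul_le_one i j p.1 p.2)

lemma integral_mul_pos (hφ : IsPositivePartition φ) (γ : Measure (E × E)) [IsProbabilityMeasure γ]
    (i j : ι) : 0 < ∫ p, φ i p.1 * φ j p.2 ∂γ := by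
  rw [integral_pos_iff_support_of_nonneg (f := fun p : E × E => φ i p.1 * φ j p.2)
    (fun p => (hφ.apply_mul_apply_pos i j p.1 p.2).le)
    (hφ.integrable_mul γ i j)]
  simp [Function.support_eq_univ fun p : E × E => (hφ.apply_mul_apply_pos i j p.1 p.2).ne']

lemma sum_integral_mul_right (hφ : IsPositivePartition φ) (hγ : IsCoupling μ ν γ) (i : ι) :
    ∑ j, ∫ p, φ i p.1 * φ j p.2 ∂γ = ∫ x, φ i x ∂μ := by
  have := hγ.1
  rw [← integral_finsetSum _ fun j _ => hφ.integrable_mul γ i j]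
  simp_rw [← Finset.mul_sum, hφ.sum_eq_one, mul_one]
  exact hγ.integral_fst (hφ.continuous i)

lemma sum_integral_mul_left (hφ : IsPositivePartition φ) (hγ : IsCoupling μ ν γ) (j : ι) :
    ∑ i, ∫ p, φ i p.1 * φ j p.2 ∂γ = ∫ x, φ j x ∂ν := by
  have := hγ.1
  rw [← integral_finsetSum _ fun i _ => hφ.integrable_mul γ i j]
  simp_rw [← Finset.sum_mul, hφ.sum_eq_one, one_mul]
  exact hγ.integral_snd (hφ.continuous j)

end IsPositivePartition

lemma map_fst_withDensity_prod {E F : Type*} [MeasurableSpace E] [MeasurableSpace F]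
    {μ : Measure E} {ν : Measure F} [SFinite μ] [SFinite ν] {f : E × F → ℝ≥0∞} (hf : Measurable f)
    (h : ∀ x, ∫⁻ y, f (x, y) ∂ν = 1) : ((μ.prod ν).withDensity f).map Prod.fst = μ := by
  ext s hs
  rw [Measure.map_apply measurable_fst hs, withDensity_apply _ (measurable_fst hs),
    ← lintegral_indicator (measurable_fst hs),
    lintegral_prod _ (hf.indicator (measurable_fst hs)).aemeasurable]
  have : ∀ x, ∫⁻ y, (Prod.fst ⁻¹' s).indicator f (x, y) ∂ν = s.indicator 1 x := by
    intro x
    by_cases hx : x ∈ s <;> simp [indicator, hx, h]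
  simp [this, hs]

lemma map_snd_withDensity_prod {E F : Type*} [MeasurableSpace E] [MeasurableSpace F]
    {μ : Measure E} {ν : Measure F} [SFinite μ] [SFinite ν] {f : E × F → ℝ≥0∞} (hf : Measurable f)
    (h : ∀ y, ∫⁻ x, f (x, y) ∂μ = 1) : ((μ.prod ν).withDensity f).map Prod.snd = ν := by
  ext s hs
  rw [Measure.map_apply measurable_snd hs, withDensity_apply _ (measurable_snd hs),
    ← lintegral_indicator (measurable_snd hs),
    lintegral_prod_symm _ (hf.indicator (measurable_snd hs)).aemeasurable]
  have : ∀ y, ∫⁻ x, (Prod.snd ⁻¹' s).indicator f (x, y) ∂μ = s.indicator 1 y := by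
    intro y
    by_cases hy : y ∈ s <;> simp [indicator, hy, h]
  simp [this, hs]

section Discretization

variable {ι E : Type*} [Fintype ι] [NormedAddCommGroup E] [MeasurableSpace E] [BorelSpace E]
  [SecondCountableTopology E] {φ : ι → E → ℝ} {μ ν : Measure E}

/-- The mean squared distance between independent points drawn from the `i`-th piece of `μ` and
the `j`-th piece of `ν`. -/
def pieceCost (φ : ι → E → ℝ) (μ ν : Measure E) (i j : ι) : ℝ :=
  (∫ p, φ i p.1 * φ j p.2 * dist p.1 p.2 ^ 2 ∂(μ.prod ν)) / ((∫ x, φ i x ∂μ) * ∫ y, φ j y ∂ν)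

/-- Redistributing mass between the pieces of `μ` and `ν` according to a nonnegative matrix with the
right row and column sums produces a coupling, which bounds the Wasserstein distance. -/
lemma IsPositivePartition.sqWasserstein_le (hφ : IsPositivePartition φ)
    [IsProbabilityMeasure μ] [IsProbabilityMeasure ν]
    (hμ : Integrable (fun x => ‖x‖ ^ 2) μ) (hν : Integrable (fun x => ‖x‖ ^ 2) ν)
    {c : ι → ι → ℝ} (hc : ∀ i j, 0 ≤ c i j) (hrow : ∀ i, ∑ j, c i j = ∫ x, φ i x ∂μ)
    (hcol : ∀ j, ∑ i, c i j = ∫ y, φ j y ∂ν) :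
    sqWasserstein μ ν ≤ ENNReal.ofReal (∑ i, ∑ j, c i j * pieceCost φ μ ν i j) := by
  set a : ι → ℝ := fun i => ∫ x, φ i x ∂μ
  set b : ι → ℝ := fun j => ∫ y, φ j y ∂ν
  have ha : ∀ i, 0 < a i := hφ.integral_pos μ
  have hb : ∀ j, 0 < b j := hφ.integral_pos ν
  have hφc := hφ.continuous
  set f : E × E → ℝ := fun p => ∑ i, ∑ j, c i j / (a i * b j) * (φ i p.1 * φ j p.2) with hf_def
  have hf_cont : Continuous f := by fun_prop
  have hf_nonneg : ∀ p, 0 ≤ f p := fun p =>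
    Finset.sum_nonneg fun i _ => Finset.sum_nonneg fun j _ =>
      mul_nonneg (div_nonneg (hc i j) (mul_pos (ha i) (hb j)).le)
        (hφ.apply_mul_apply_pos i j _ _).le
  have hf_meas : Measurable fun p => ENNReal.ofReal (f p) := hf_cont.measurable.ennreal_ofReal
  have hfst : ∀ x, ∫⁻ y, ENNReal.ofReal (f (x, y)) ∂ν = 1 := by
    intro x
    have hint : ∀ i j, Integrable (fun y => c i j / (a i * b j) * (φ i x * φ j y)) ν :=
      fun i j => ((hφ.integrable ν j).const_mul _).const_mul _
    rw [← ofReal_integral_eq_lintegral_ofReal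
      (integrable_finsetSum _ fun i _ => integrable_finsetSum _ fun j _ => hint i j)
      (.of_forall fun y => hf_nonneg (x, y)), ← ENNReal.ofReal_one]
    congr 1
    rw [integral_finsetSum _ fun i _ => integrable_finsetSum _ fun j _ => hint i j]
    rw [Finset.sum_congr rfl fun i _ => integral_finsetSum _ fun j _ => hint i j]
    simp_rw [integral_const_mul]
    rw [← hφ.sum_eq_one x]
    refine Finset.sum_congr rfl fun i _ => ?_
    calc ∑ j, c i j / (a i * b j) * (φ i x * b j) = ∑ j, c i j * (φ i x / a i) :=
          Finset.sum_congr rfl fun j _ => by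
            have := (ha i).ne'; have := (hb j).ne'; field_simp
      _ = φ i x := by
          rw [← Finset.sum_mul, hrow i, mul_div_cancel₀ _ (ha i).ne']
  have hsnd : ∀ y, ∫⁻ x, ENNReal.ofReal (f (x, y)) ∂μ = 1 := by
    intro y
    have hint : ∀ i j, Integrable (fun x => c i j / (a i * b j) * (φ i x * φ j y)) μ :=
      fun i j => ((hφ.integrable μ i).mul_const _).const_mul _
    rw [← ofReal_integral_eq_lintegral_ofReal
      (integrable_finsetSum _ fun i _ => integrable_finsetSum _ fun j _ => hint i j)
      (.of_forall fun x => hf_nonneg (x, y)), ← ENNReal.ofReal_one]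
    congr 1
    rw [integral_finsetSum _ fun i _ => integrable_finsetSum _ fun j _ => hint i j]
    rw [Finset.sum_congr rfl fun i _ => integral_finsetSum _ fun j _ => hint i j]
    simp_rw [integral_const_mul, integral_mul_const]
    rw [← hφ.sum_eq_one y, Finset.sum_comm]
    refine Finset.sum_congr rfl fun j _ => ?_
    calc ∑ i, c i j / (a i * b j) * (a i * φ j y) = ∑ i, c i j * (φ j y / b j) :=
          Finset.sum_congr rfl fun i _ => by
            have := (ha i).ne'; have := (hb j).ne'; field_simp
      _ = φ j y := by
          rw [← Finset.sum_mul, hcol j, mul_div_cancel₀ _ (hb j).ne']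
  have hmap := map_fst_withDensity_prod (μ := μ) (ν := ν) hf_meas hfst
  refine sInf_le ⟨(μ.prod ν).withDensity fun p => ENNReal.ofReal (f p),
    ⟨?_, hmap, map_snd_withDensity_prod hf_meas hsnd⟩, ?_⟩
  · constructor
    rw [← preimage_univ (f := Prod.fst), ← Measure.map_apply measurable_fst .univ, hmap,
      measure_univ]
  · have hint : ∀ i j, Integrable
        (fun p : E × E => c i j / (a i * b j) * (φ i p.1 * φ j p.2 * dist p.1 p.2 ^ 2))
        (μ.prod ν) := fun i j =>
      ((IsCoupling.prod μ ν).integrable_of_abs_le hμ hν (hφ.continuous_mul_dist_sq i j)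
        (hφ.abs_mul_dist_sq_le i j)).const_mul _
    have hexp : ∀ p : E × E, f p * dist p.1 p.2 ^ 2 =
        ∑ i, ∑ j, c i j / (a i * b j) * (φ i p.1 * φ j p.2 * dist p.1 p.2 ^ 2) := fun p => by
      simp only [hf_def, Finset.sum_mul]
      exact Finset.sum_congr rfl fun i _ => Finset.sum_congr rfl fun j _ => by ring
    rw [lintegral_withDensity_eq_lintegral_mul _ hf_meas
      (by fun_prop : Measurable fun p : E × E => edist p.1 p.2 ^ 2)]
    have : ∀ p : E × E, ((fun p => ENNReal.ofReal (f p)) * fun p : E × E => edist p.1 p.2 ^ 2) p =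
        ENNReal.ofReal (∑ i, ∑ j, c i j / (a i * b j) * (φ i p.1 * φ j p.2 * dist p.1 p.2 ^ 2)) :=
      fun p => by
        rw [← hexp, ENNReal.ofReal_mul (hf_nonneg p), ENNReal.ofReal_pow dist_nonneg, ← edist_dist]
        rfl
    simp_rw [this]
    rw [← ofReal_integral_eq_lintegral_ofReal
      (integrable_finsetSum _ fun i _ => integrable_finsetSum _ fun j _ => hint i j)
      (.of_forall fun p => (mul_nonneg (hf_nonneg p) (sq_nonneg _)).trans_eq (hexp p)),
      integral_finsetSum _ fun i _ => integrable_finsetSum _ fun j _ => hint i j]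
    rw [Finset.sum_congr rfl fun i _ => integral_finsetSum _ fun j _ => hint i j]
    simp_rw [integral_const_mul]
    congr 1
    refine Finset.sum_congr rfl fun i _ => Finset.sum_congr rfl fun j _ => ?_
    simp only [pieceCost]
    ring

namespace IsPositivePartition

lemma pieceCost_le (hφ : IsPositivePartition φ) [IsProbabilityMeasure μ] [IsProbabilityMeasure ν]
    (hμ : Integrable (fun x => ‖x‖ ^ 2) μ) (hν : Integrable (fun x => ‖x‖ ^ 2) ν) (i j : ι)
    {C K : ℝ} {z w : E} (h : ∀ x y : E, dist x y ^ 2 ≤ C + K * (dist x z ^ 2 + dist y w ^ 2)) :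
    pieceCost φ μ ν i j ≤ C + K * ((∫ x, φ i x * dist x z ^ 2 ∂μ) / (∫ x, φ i x ∂μ) +
      (∫ y, φ j y * dist y w ^ 2 ∂ν) / ∫ y, φ j y ∂ν) := by
  have ha := hφ.integral_pos μ i
  have hb := hφ.integral_pos ν j
  have hV := hφ.integrable_mul_right measurable_id' (integrable_dist_sq hμ z) i
  have hW := hφ.integrable_mul_right measurable_id' (integrable_dist_sq hν w) j
  have h1 := (hφ.integrable_mul (μ.prod ν) i j).const_mul C
  have h2 := (hV.mul_prod (hφ.integrable ν j)).const_mul K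
  have h3 := ((hφ.integrable μ i).mul_prod hW).const_mul K
  have h12 := h1.fun_add h2
  rw [pieceCost, div_le_iff₀ (mul_pos ha hb)]
  calc ∫ p, φ i p.1 * φ j p.2 * dist p.1 p.2 ^ 2 ∂(μ.prod ν)
      ≤ ∫ p : E × E, (C * (φ i p.1 * φ j p.2) + K * (φ i p.1 * dist p.1 z ^ 2 * φ j p.2) +
          K * (φ i p.1 * (φ j p.2 * dist p.2 w ^ 2))) ∂(μ.prod ν) := by
        refine integral_mono ((IsCoupling.prod μ ν).integrable_of_abs_le hμ hν
          (hφ.continuous_mul_dist_sq i j) (hφ.abs_mul_dist_sq_le i j)) (h12.add h3)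
          fun p => ?_
        calc φ i p.1 * φ j p.2 * dist p.1 p.2 ^ 2
            ≤ φ i p.1 * φ j p.2 * (C + K * (dist p.1 z ^ 2 + dist p.2 w ^ 2)) :=
              mul_le_mul_of_nonneg_left (h _ _) (hφ.apply_mul_apply_pos i j _ _).le
          _ = _ := by ring
    _ = _ := by
        rw [integral_add h12 h3, integral_add h1 h2]
        simp_rw [integral_const_mul]
        rw [integral_prod_mul (φ i) (φ j), integral_prod_mul (fun x => φ i x * dist x z ^ 2) (φ j),
          integral_prod_mul (φ i) (fun y => φ j y * dist y w ^ 2)]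
        field_simp
        ring

/-- The discretized cost of a coupling exceeds its true cost by an amount controlled by the sizes
of the pieces. -/
lemma sum_mul_pieceCost_le (hφ : IsPositivePartition φ) [IsProbabilityMeasure μ]
    [IsProbabilityMeasure ν]
    (hμ : Integrable (fun x => ‖x‖ ^ 2) μ) (hν : Integrable (fun x => ‖x‖ ^ 2) ν)
    {γ : Measure (E × E)} (hγ : IsCoupling μ ν γ) (z : ι → E) {η : ℝ} (hη : 0 < η) :
    ∑ i, ∑ j, (∫ p, φ i p.1 * φ j p.2 ∂γ) * pieceCost φ μ ν i j ≤
      (1 + η) * ∫ p, dist p.1 p.2 ^ 2 ∂γ + 8 * (1 + η⁻¹) *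
        (∑ i, ∫ x, φ i x * dist x (z i) ^ 2 ∂μ + ∑ i, ∫ y, φ i y * dist y (z i) ^ 2 ∂ν) := by
  have := hγ.1
  set K := 4 * (1 + η⁻¹) with hK
  set V := fun i => ∫ x, φ i x * dist x (z i) ^ 2 ∂μ
  set W := fun j => ∫ y, φ j y * dist y (z j) ^ 2 ∂ν
  have ha := hφ.integral_pos μ
  have hb := hφ.integral_pos ν
  have hgeom : ∀ x y x' y' z w : E, dist x' y' ^ 2 ≤ (1 + η) * dist x y ^ 2 +
      K * (dist x z ^ 2 + dist y w ^ 2) + K * (dist x' z ^ 2 + dist y' w ^ 2) := by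
    intro x y x' y' z w
    have h1 : dist x' y' ≤ dist x y + (dist x' z + dist x z + dist y w + dist y' w) := by
      have e1 := dist_triangle4 x' z w y'
      have e2 := dist_triangle4 z x y w
      rw [dist_comm z x] at e2
      rw [dist_comm w y'] at e1
      linarith
    set d := dist x y
    set s := dist x' z + dist x z + dist y w + dist y' w with hs
    have h2 : dist x' y' ^ 2 ≤ (d + s) ^ 2 := by gcongr
    have h3 : 2 * d * s ≤ η * d ^ 2 + η⁻¹ * s ^ 2 := by
      have : η * d ^ 2 + η⁻¹ * s ^ 2 - 2 * d * s = η⁻¹ * (η * d - s) ^ 2 := by field_simp; ring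
      have : 0 ≤ η⁻¹ * (η * d - s) ^ 2 := by positivity
      linarith
    have h4 : s ^ 2 ≤ 4 * (dist x' z ^ 2 + dist x z ^ 2 + dist y w ^ 2 + dist y' w ^ 2) := by
      rw [hs]
      nlinarith [sq_nonneg (dist x' z - dist x z), sq_nonneg (dist x' z - dist y w),
        sq_nonneg (dist x' z - dist y' w), sq_nonneg (dist x z - dist y w),
        sq_nonneg (dist x z - dist y' w), sq_nonneg (dist y w - dist y' w)]
    have h5 : (1 + η⁻¹) * s ^ 2 ≤
        (1 + η⁻¹) * (4 * (dist x' z ^ 2 + dist x z ^ 2 + dist y w ^ 2 + dist y' w ^ 2)) := by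
      gcongr
    rw [hK]
    linarith
  have hd : Integrable (fun p : E × E => dist p.1 p.2 ^ 2) γ :=
    hγ.integrable_of_abs_le hμ hν (by fun_prop) fun p => by
      rw [abs_of_nonneg (by positivity)]; exact dist_sq_le_sqWeight p
  have hd1 : ∀ i, Integrable (fun p : E × E => φ i p.1 * dist p.1 (z i) ^ 2) γ := fun i =>
    hφ.integrable_mul_right measurable_fst (hγ.integrable_fst (integrable_dist_sq hμ (z i))) i
  have hd2 : ∀ j, Integrable (fun p : E × E => φ j p.2 * dist p.2 (z j) ^ 2) γ := fun j =>
    hφ.integrable_mul_right measurable_snd (hγ.integrable_snd (integrable_dist_sq hν (z j))) j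
  have hterm : ∀ i j, (∫ p, φ i p.1 * φ j p.2 ∂γ) * pieceCost φ μ ν i j ≤
      (1 + η) * (∫ p, φ i p.1 * (φ j p.2 * dist p.1 p.2 ^ 2) ∂γ) +
      K * (∫ p, φ j p.2 * (φ i p.1 * dist p.1 (z i) ^ 2) ∂γ) +
      K * (∫ p, φ i p.1 * (φ j p.2 * dist p.2 (z j) ^ 2) ∂γ) +
      K * ((∫ p, φ i p.1 * φ j p.2 ∂γ) * (V i / ∫ x, φ i x ∂μ)) +
      K * ((∫ p, φ i p.1 * φ j p.2 ∂γ) * (W j / ∫ y, φ j y ∂ν)) := by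
    intro i j
    have i1 := (hφ.integrable_mul_right measurable_fst
      (hφ.integrable_mul_right measurable_snd hd j) i).const_mul (1 + η)
    have i2 := (hφ.integrable_mul_right measurable_snd (hd1 i) j).const_mul K
    have i3 := (hφ.integrable_mul_right measurable_fst (hd2 j) i).const_mul K
    have i4 := (hφ.integrable_mul γ i j).mul_const
      (K * (V i / (∫ x, φ i x ∂μ) + W j / ∫ y, φ j y ∂ν))
    have i12 := i1.fun_add i2
    have i123 := i12.fun_add i3
    calc (∫ p, φ i p.1 * φ j p.2 ∂γ) * pieceCost φ μ ν i j
        = ∫ p, φ i p.1 * φ j p.2 * pieceCost φ μ ν i j ∂γ := (integral_mul_const _ _).symm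
      _ ≤ ∫ p : E × E, ((1 + η) * (φ i p.1 * (φ j p.2 * dist p.1 p.2 ^ 2)) +
            K * (φ j p.2 * (φ i p.1 * dist p.1 (z i) ^ 2)) +
            K * (φ i p.1 * (φ j p.2 * dist p.2 (z j) ^ 2)) +
            φ i p.1 * φ j p.2 * (K * (V i / (∫ x, φ i x ∂μ) + W j / ∫ y, φ j y ∂ν))) ∂γ := by
          refine integral_mono ((hφ.integrable_mul γ i j).mul_const _) (i123.add i4)
            fun p => ?_
          calc φ i p.1 * φ j p.2 * pieceCost φ μ ν i j
              ≤ φ i p.1 * φ j p.2 * ((1 + η) * dist p.1 p.2 ^ 2 +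
                K * (dist p.1 (z i) ^ 2 + dist p.2 (z j) ^ 2) +
                K * (V i / (∫ x, φ i x ∂μ) + W j / ∫ y, φ j y ∂ν)) :=
                mul_le_mul_of_nonneg_left (hφ.pieceCost_le hμ hν i j fun x y => hgeom _ _ _ _ _ _)
                  (hφ.apply_mul_apply_pos i j _ _).le
            _ = _ := by ring
      _ = _ := by
          rw [integral_add i123 i4, integral_add i12 i3,
            integral_add i1 i2]
          simp_rw [integral_const_mul, integral_mul_const]
          ring
  refine (Finset.sum_le_sum fun i _ => Finset.sum_le_sum fun j _ => hterm i j).trans_eq ?_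
  simp_rw [Finset.sum_add_distrib, ← Finset.mul_sum]
  have s1 : ∑ i, ∑ j, ∫ p, φ i p.1 * (φ j p.2 * dist p.1 p.2 ^ 2) ∂γ =
      ∫ p, dist p.1 p.2 ^ 2 ∂γ := by
    rw [Finset.sum_comm]
    simp_rw [fun j => hφ.sum_integral_mul measurable_fst
      (hφ.integrable_mul_right measurable_snd hd j)]
    exact hφ.sum_integral_mul measurable_snd hd
  have s2 : ∑ i, ∑ j, ∫ p, φ j p.2 * (φ i p.1 * dist p.1 (z i) ^ 2) ∂γ = ∑ i, V i := by
    refine Finset.sum_congr rfl fun i _ => ?_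
    rw [hφ.sum_integral_mul measurable_snd (hd1 i)]
    have := hφ.continuous i
    exact hγ.integral_fst (f := fun x => φ i x * dist x (z i) ^ 2) (by fun_prop)
  have s3 : ∑ i, ∑ j, ∫ p, φ i p.1 * (φ j p.2 * dist p.2 (z j) ^ 2) ∂γ = ∑ j, W j := by
    rw [Finset.sum_comm]
    refine Finset.sum_congr rfl fun j _ => ?_
    rw [hφ.sum_integral_mul measurable_fst (hd2 j)]
    have := hφ.continuous j
    exact hγ.integral_snd (f := fun y => φ j y * dist y (z j) ^ 2) (by fun_prop)
  have s4 : ∑ i, ∑ j, (∫ p, φ i p.1 * φ j p.2 ∂γ) * (V i / ∫ x, φ i x ∂μ) = ∑ i, V i := by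
    refine Finset.sum_congr rfl fun i _ => ?_
    rw [← Finset.sum_mul, hφ.sum_integral_mul_right hγ, mul_div_cancel₀ _ (ha i).ne']
  have s5 : ∑ i, ∑ j, (∫ p, φ i p.1 * φ j p.2 ∂γ) * (W j / ∫ y, φ j y ∂ν) = ∑ j, W j := by
    rw [Finset.sum_comm]
    refine Finset.sum_congr rfl fun j _ => ?_
    rw [← Finset.sum_mul, hφ.sum_integral_mul_left hγ, mul_div_cancel₀ _ (hb j).ne']
  rw [s1, s2, s3, s4, s5]
  ring

end IsPositivePartition

/-- Optimality passes to the limit up to discretization: the cost of a limit of optimal couplings is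
at most the discretized cost of any coupling of the limit marginals. -/
lemma IsPositivePartition.integral_dist_sq_le_of_tendsto (hφ : IsPositivePartition φ)
    {μs νs : ℕ → ProbabilityMeasure E} {μ ν : ProbabilityMeasure E}
    (hμs : ∀ n, Integrable (fun x => ‖x‖ ^ 2) (μs n : Measure E))
    (hνs : ∀ n, Integrable (fun x => ‖x‖ ^ 2) (νs n : Measure E))
    (hμ : Integrable (fun x => ‖x‖ ^ 2) (μ : Measure E))
    (hν : Integrable (fun x => ‖x‖ ^ 2) (ν : Measure E))
    (hμlim : Tendsto μs atTop (nhds μ)) (hνlim : Tendsto νs atTop (nhds ν))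
    (hμlim2 : Tendsto (fun n => ∫ x, ‖x‖ ^ 2 ∂(μs n : Measure E)) atTop
      (nhds (∫ x, ‖x‖ ^ 2 ∂(μ : Measure E))))
    (hνlim2 : Tendsto (fun n => ∫ x, ‖x‖ ^ 2 ∂(νs n : Measure E)) atTop
      (nhds (∫ x, ‖x‖ ^ 2 ∂(ν : Measure E))))
    {γs : ℕ → ProbabilityMeasure (E × E)} {γ₀ : ProbabilityMeasure (E × E)}
    (hγs : ∀ n, IsOptimalCoupling (μs n : Measure E) (νs n) (γs n))
    (hlim : Tendsto γs atTop (nhds γ₀)) (hγ₀ : IsCoupling (μ : Measure E) ν γ₀)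
    {γ : Measure (E × E)} (hγ : IsCoupling (μ : Measure E) ν γ) :
    ∫ p, dist p.1 p.2 ^ 2 ∂(γ₀ : Measure (E × E)) ≤
      ∑ i, ∑ j, (∫ p, φ i p.1 * φ j p.2 ∂γ) * pieceCost φ (μ : Measure E) ν i j := by
  have := hγ.1
  have hφc := hφ.continuous
  have hdist : Tendsto (fun n => ∫ p, dist p.1 p.2 ^ 2 ∂(γs n : Measure (E × E))) atTop
      (nhds (∫ p, dist p.1 p.2 ^ 2 ∂(γ₀ : Measure (E × E)))) :=
    IsCoupling.tendsto_integral hlim (fun n => (hγs n).1) hγ₀ hμs hνs hμ hν hμlim2 hνlim2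
      (f := fun p => dist p.1 p.2 ^ 2) (C := 2) (by fun_prop) fun p => by
        rw [abs_of_nonneg (by positivity)]; exact dist_sq_le_sqWeight p
  have hm : ∀ i j, Tendsto (fun n => ∫ p, φ i p.1 * φ j p.2 ∂(γs n : Measure (E × E))) atTop
      (nhds (∫ p, φ i p.1 * φ j p.2 ∂(γ₀ : Measure (E × E)))) := fun i j =>
    IsCoupling.tendsto_integral hlim (fun n => (hγs n).1) hγ₀ hμs hνs hμ hν hμlim2 hνlim2
      (f := fun p => φ i p.1 * φ j p.2) (C := 1) (by fun_prop) fun p =>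
        (hφ.abs_mul_le_one i j p.1 p.2).trans <| by
          rw [one_mul, sqWeight, add_assoc]; exact le_add_of_nonneg_right (by positivity)
  have ha : ∀ i, Tendsto (fun n => ∫ x, φ i x ∂(μs n : Measure E)) atTop
      (nhds (∫ x, φ i x ∂(μ : Measure E))) := fun i => by
    simp_rw [← fun n => hφ.sum_integral_mul_right (hγs n).1 i,
      ← hφ.sum_integral_mul_right hγ₀ i]
    exact tendsto_finsetSum _ fun j _ => hm i j
  have hb : ∀ j, Tendsto (fun n => ∫ x, φ j x ∂(νs n : Measure E)) atTop
      (nhds (∫ x, φ j x ∂(ν : Measure E))) := fun j => by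
    simp_rw [← fun n => hφ.sum_integral_mul_left (hγs n).1 j,
      ← hφ.sum_integral_mul_left hγ₀ j]
    exact tendsto_finsetSum _ fun i _ => hm i j
  have hprod : Tendsto (fun n => (μs n).prod (νs n)) atTop (nhds (μ.prod ν)) :=
    (ProbabilityMeasure.continuous_prod.tendsto (μ, ν)).comp (hμlim.prodMk_nhds hνlim)
  have hcost : ∀ i j, Tendsto (fun n => pieceCost φ (μs n : Measure E) (νs n) i j) atTop
      (nhds (pieceCost φ (μ : Measure E) ν i j)) := fun i j =>
    (IsCoupling.tendsto_integral hprod (fun n => IsCoupling.prod _ _) (IsCoupling.prod _ _)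
      hμs hνs hμ hν hμlim2 hνlim2 (hφ.continuous_mul_dist_sq i j)
      (hφ.abs_mul_dist_sq_le i j)).div ((ha i).mul (hb j))
      (mul_pos (hφ.integral_pos _ i) (hφ.integral_pos _ j)).ne'
  set c : ℕ → ι → ι → ℝ := fun n i j => ∫ p, φ i p.1 * φ j p.2 ∂γ +
    (∫ p, φ i p.1 * φ j p.2 ∂(γs n : Measure (E × E)) -
      ∫ p, φ i p.1 * φ j p.2 ∂(γ₀ : Measure (E × E))) with hc_def
  have hc : ∀ i j, Tendsto (fun n => c n i j) atTop (nhds (∫ p, φ i p.1 * φ j p.2 ∂γ)) :=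
    fun i j => by
      simpa using ((hm i j).sub_const (∫ p, φ i p.1 * φ j p.2 ∂(γ₀ : Measure (E × E)))).const_add
        (∫ p, φ i p.1 * φ j p.2 ∂γ)
  have hsum : Tendsto (fun n => ∑ i, ∑ j, c n i j * pieceCost φ (μs n : Measure E) (νs n) i j) atTop
      (nhds (∑ i, ∑ j, (∫ p, φ i p.1 * φ j p.2 ∂γ) * pieceCost φ (μ : Measure E) ν i j)) :=
    tendsto_finsetSum _ fun i _ => tendsto_finsetSum _ fun j _ => (hc i j).mul (hcost i j)
  have hpos : ∀ᶠ n in atTop, ∀ i j, 0 ≤ c n i j :=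
    eventually_all.2 fun i => eventually_all.2 fun j =>
      ((hc i j).eventually_const_lt (hφ.integral_mul_pos γ i j)).mono fun n => le_of_lt
  refine le_of_tendsto_of_tendsto hdist hsum ?_
  filter_upwards [hpos] with n hn
  have hpc : ∀ i j, 0 ≤ pieceCost φ (μs n : Measure E) (νs n) i j := fun i j =>
    div_nonneg (integral_nonneg fun p =>
      mul_nonneg (hφ.apply_mul_apply_pos i j _ _).le (sq_nonneg _))
      (mul_pos (hφ.integral_pos _ i) (hφ.integral_pos _ j)).le
  have key := hφ.sqWasserstein_le (hμs n) (hνs n) hn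
    (fun i => by
      simp only [hc_def, Finset.sum_add_distrib, Finset.sum_sub_distrib]
      rw [hφ.sum_integral_mul_right hγ, hφ.sum_integral_mul_right hγ₀,
        hφ.sum_integral_mul_right (hγs n).1]
      ring)
    (fun j => by
      simp only [hc_def, Finset.sum_add_distrib, Finset.sum_sub_distrib]
      rw [hφ.sum_integral_mul_left hγ, hφ.sum_integral_mul_left hγ₀,
        hφ.sum_integral_mul_left (hγs n).1]
      ring)
  rw [← (hγs n).2, (hγs n).1.lintegral_edist_sq (hμs n) (hνs n)] at key
  exact (ENNReal.ofReal_le_ofReal_iff (Finset.sum_nonneg fun i _ => Finset.sum_nonneg fun j _ =>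
    mul_nonneg (hn i j) (hpc i j))).1 key

end Discretization

section Softmax

variable {E : Type*} [NormedAddCommGroup E]

/-- The softmax weights of `-t ‖x - z i‖²`. -/
def softmaxWeight {ι : Type*} [Fintype ι] (t : ℝ) (z : ι → E) (i : ι) (x : E) : ℝ :=
  Real.exp (-(t * dist x (z i) ^ 2)) / ∑ j, Real.exp (-(t * dist x (z j) ^ 2))

lemma isPositivePartition_softmaxWeight {ι : Type*} [Fintype ι] [Nonempty ι] (t : ℝ) (z : ι → E) :
    IsPositivePartition (softmaxWeight t z) := by
  have hpos : ∀ x, 0 < ∑ j, Real.exp (-(t * dist x (z j) ^ 2)) := fun x =>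
    Finset.sum_pos (fun j _ => Real.exp_pos _) Finset.univ_nonempty
  refine ⟨fun i => ?_, fun i x => div_pos (Real.exp_pos _) (hpos x), fun x => ?_⟩
  · exact Continuous.div (by fun_prop) (by fun_prop) fun x => (hpos x).ne'
  · simp only [softmaxWeight]
    rw [← Finset.sum_div, div_self (hpos x).ne']

lemma sum_softmaxWeight_mul_le {ι : Type*} [Fintype ι] {t : ℝ} (ht : 0 < t) (z : ι → E) (k : ι)
    (x : E) : ∑ i, softmaxWeight t z i x * dist x (z i) ^ 2 ≤
      dist x (z k) ^ 2 + Fintype.card ι / t := by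
  have : Nonempty ι := ⟨k⟩
  have hφ := isPositivePartition_softmaxWeight t z
  have hterm : ∀ i, softmaxWeight t z i x * (dist x (z i) ^ 2 - dist x (z k) ^ 2) ≤ 1 / t := by
    intro i
    set u := t * (dist x (z i) ^ 2 - dist x (z k) ^ 2) with hu
    rcases le_or_gt u 0 with h | h
    · exact (mul_nonpos_of_nonneg_of_nonpos (hφ.pos i x).le
        (nonpos_of_mul_nonpos_right h ht)).trans (by positivity)
    have h1 : softmaxWeight t z i x ≤ Real.exp (-u) := by
      have : softmaxWeight t z i x = softmaxWeight t z k x * Real.exp (-u) := by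
        simp only [softmaxWeight]
        rw [div_mul_eq_mul_div, ← Real.exp_add]
        congr 2
        rw [hu]; ring
      rw [this]
      exact mul_le_of_le_one_left (Real.exp_pos _).le (hφ.le_one k x)
    have h2 : Real.exp (-u) * u ≤ 1 := by
      rw [Real.exp_neg, inv_mul_le_iff₀ (Real.exp_pos _)]
      linarith [Real.add_one_le_exp u]
    rw [le_div_iff₀ ht]
    calc _ = softmaxWeight t z i x * u := by rw [hu]; ring
      _ ≤ Real.exp (-u) * u := by gcongr
      _ ≤ 1 := h2
  have hsum := Finset.sum_le_sum fun i (_ : i ∈ Finset.univ) => hterm i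
  simp_rw [mul_sub] at hsum
  rw [Finset.sum_sub_distrib, ← Finset.sum_mul, hφ.sum_eq_one, Finset.sum_const, nsmul_eq_mul,
    Finset.card_univ] at hsum
  rw [div_eq_mul_one_div]
  linarith

/-- The softmax partition with `N + 1` centres and temperature `(N + 1)⁻²`. -/
def finePartition (z : ℕ → E) (N : ℕ) : Fin (N + 1) → E → ℝ :=
  softmaxWeight (((N : ℝ) + 1) ^ 2) fun i => z i

lemma isPositivePartition_finePartition (z : ℕ → E) (N : ℕ) :
    IsPositivePartition (finePartition z N) :=
  isPositivePartition_softmaxWeight _ _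

lemma sum_finePartition_mul_le (z : ℕ → E) {N k : ℕ} (hk : k ≤ N) (x : E) :
    ∑ i : Fin (N + 1), finePartition z N i x * dist x (z i) ^ 2 ≤
      dist x (z k) ^ 2 + 1 / ((N : ℝ) + 1) := by
  have := sum_softmaxWeight_mul_le (t := ((N : ℝ) + 1) ^ 2) (by positivity)
    (fun i : Fin (N + 1) => z i) ⟨k, Nat.lt_succ_of_le hk⟩ x
  refine this.trans_eq ?_
  rw [Fintype.card_fin]
  push_cast
  field_simp

lemma tendsto_sum_finePartition_mul {z : ℕ → E} (hz : DenseRange z) (x : E) :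
    Tendsto (fun N => ∑ i : Fin (N + 1), finePartition z N i x * dist x (z i) ^ 2) atTop
      (nhds 0) := by
  have hnonneg : ∀ N : ℕ, 0 ≤ ∑ i : Fin (N + 1), finePartition z N i x * dist x (z i) ^ 2 :=
    fun N => Finset.sum_nonneg fun i _ =>
      mul_nonneg ((isPositivePartition_finePartition z N).pos i x).le (sq_nonneg _)
  rw [tendsto_order]
  refine ⟨fun a ha => .of_forall fun N => ha.trans_le (hnonneg N), fun ε hε => ?_⟩
  obtain ⟨k, hk⟩ := hz.exists_dist_lt x (Real.sqrt_pos.2 (half_pos hε))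
  have hk2 : dist x (z k) ^ 2 < ε / 2 := (Real.lt_sqrt dist_nonneg).1 hk
  filter_upwards [eventually_ge_atTop k,
    (tendsto_one_div_add_atTop_nhds_zero_nat (𝕜 := ℝ)).eventually_lt_const (half_pos hε)]
    with N hN hN2
  linarith [sum_finePartition_mul_le z hN x]

variable [MeasurableSpace E] [BorelSpace E]

lemma tendsto_sum_integral_finePartition {z : ℕ → E} (hz : DenseRange z) {μ : Measure E}
    [IsFiniteMeasure μ] (hμ : Integrable (fun x => ‖x‖ ^ 2) μ) :
    Tendsto (fun N => ∑ i : Fin (N + 1), ∫ x, finePartition z N i x * dist x (z i) ^ 2 ∂μ) atTop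
      (nhds 0) := by
  have hint : ∀ N (i : Fin (N + 1)),
      Integrable (fun x => finePartition z N i x * dist x (z i) ^ 2) μ := fun N i =>
    (isPositivePartition_finePartition z N).integrable_mul_right measurable_id'
      (integrable_dist_sq hμ (z i)) i
  simp_rw [← fun N => integral_finsetSum _ fun i (_ : i ∈ Finset.univ) => hint N i]
  rw [← integral_zero E ℝ (μ := μ)]
  refine tendsto_integral_of_dominated_convergence (fun x => dist x (z 0) ^ 2 + 1)
    (fun N => (integrable_finsetSum _ fun i _ => hint N i).aestronglyMeasurable)
    ((integrable_dist_sq hμ _).add (integrable_const 1)) (fun N => .of_forall fun x => ?_)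
    (.of_forall fun x => tendsto_sum_finePartition_mul hz x)
  rw [Real.norm_of_nonneg (Finset.sum_nonneg fun i _ =>
    mul_nonneg ((isPositivePartition_finePartition z N).pos i x).le (sq_nonneg _))]
  refine (sum_finePartition_mul_le z N.zero_le x).trans (add_le_add_right ?_ _)
  rw [div_le_one (by positivity)]
  linarith [(N.cast_nonneg : (0 : ℝ) ≤ N)]

end Softmax

section Stability

variable {E : Type*} [NormedAddCommGroup E] [MeasurableSpace E] [BorelSpace E]
  [SecondCountableTopology E] {μs νs : ℕ → ProbabilityMeasure E} {μ ν : ProbabilityMeasure E}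

lemma isOptimalCoupling_of_tendsto
    (hμs : ∀ n, Integrable (fun x => ‖x‖ ^ 2) (μs n : Measure E))
    (hνs : ∀ n, Integrable (fun x => ‖x‖ ^ 2) (νs n : Measure E))
    (hμ : Integrable (fun x => ‖x‖ ^ 2) (μ : Measure E))
    (hν : Integrable (fun x => ‖x‖ ^ 2) (ν : Measure E))
    (hμlim : Tendsto μs atTop (nhds μ)) (hνlim : Tendsto νs atTop (nhds ν))
    (hμlim2 : Tendsto (fun n => ∫ x, ‖x‖ ^ 2 ∂(μs n : Measure E)) atTop
      (nhds (∫ x, ‖x‖ ^ 2 ∂(μ : Measure E))))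
    (hνlim2 : Tendsto (fun n => ∫ x, ‖x‖ ^ 2 ∂(νs n : Measure E)) atTop
      (nhds (∫ x, ‖x‖ ^ 2 ∂(ν : Measure E))))
    {γs : ℕ → ProbabilityMeasure (E × E)} {γ₀ : ProbabilityMeasure (E × E)}
    (hγs : ∀ n, IsOptimalCoupling (μs n : Measure E) (νs n) (γs n))
    (hlim : Tendsto γs atTop (nhds γ₀)) (hγ₀ : IsCoupling (μ : Measure E) ν γ₀) :
    IsOptimalCoupling (μ : Measure E) ν γ₀ := by
  refine ⟨hγ₀, le_antisymm (le_sInf ?_) (sInf_le ⟨_, hγ₀, rfl⟩)⟩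
  rintro _ ⟨γ, hγ, rfl⟩
  rw [hγ₀.lintegral_edist_sq hμ hν, hγ.lintegral_edist_sq hμ hν]
  refine ENNReal.ofReal_le_ofReal ?_
  have hz := TopologicalSpace.denseRange_denseSeq E
  set z := TopologicalSpace.denseSeq E
  have hη : ∀ η > 0, ∫ p, dist p.1 p.2 ^ 2 ∂(γ₀ : Measure (E × E)) ≤
      (1 + η) * ∫ p, dist p.1 p.2 ^ 2 ∂γ := by
    intro η hη
    have h := (((tendsto_sum_integral_finePartition hz hμ).add
      (tendsto_sum_integral_finePartition hz hν)).const_mul (8 * (1 + η⁻¹))).const_add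
      ((1 + η) * ∫ p, dist p.1 p.2 ^ 2 ∂γ)
    rw [add_zero, mul_zero, add_zero] at h
    refine ge_of_tendsto' h fun N => ?_
    have hφ := isPositivePartition_finePartition z N
    exact (hφ.integral_dist_sq_le_of_tendsto hμs hνs hμ hν hμlim hνlim hμlim2 hνlim2 hγs hlim hγ₀
      hγ).trans (hφ.sum_mul_pieceCost_le hμ hν hγ (fun i => z i) hη)
  have h : Tendsto (fun η : ℝ => (1 + η) * ∫ p, dist p.1 p.2 ^ 2 ∂γ) (nhdsWithin 0 (Ioi 0))
      (nhds ((1 + 0) * ∫ p, dist p.1 p.2 ^ 2 ∂γ)) :=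
    ((by fun_prop : Continuous fun η : ℝ => (1 + η) * ∫ p, dist p.1 p.2 ^ 2 ∂γ).tendsto
      0).mono_left nhdsWithin_le_nhds
  rw [add_zero, one_mul] at h
  exact ge_of_tendsto h (eventually_mem_nhdsWithin.mono fun η => hη η)

lemma isTightMeasureSet_range_of_tendsto [CompleteSpace E] (hμlim : Tendsto μs atTop (nhds μ)) :
    IsTightMeasureSet (range fun n => (μs n : Measure E)) := by
  have hcomp : IsCompact (closure (range μs)) :=
    hμlim.isCompact_insert_range.closure_of_subset (subset_insert _ _)
  refine (isTightMeasureSet_of_isCompact_closure hcomp).subset ?_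
  rintro _ ⟨n, rfl⟩
  exact ⟨μs n, mem_range_self n, rfl⟩

/-- A sequence of couplings with weakly convergent marginals subconverges weakly to a coupling of
the limits. -/
lemma exists_tendsto_isCoupling_of_tendsto [CompleteSpace E]
    (hμlim : Tendsto μs atTop (nhds μ)) (hνlim : Tendsto νs atTop (nhds ν))
    {γs : ℕ → ProbabilityMeasure (E × E)}
    (hγs : ∀ n, IsCoupling (μs n : Measure E) (νs n) (γs n)) :
    ∃ (γ₀ : ProbabilityMeasure (E × E)) (θ : ℕ → ℕ), StrictMono θ ∧
      Tendsto (γs ∘ θ) atTop (nhds γ₀) ∧ IsCoupling (μ : Measure E) ν γ₀ := by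
  have htight : IsTightMeasureSet {((γ : ProbabilityMeasure (E × E)) : Measure (E × E)) |
      γ ∈ range γs} := by
    refine IsTightMeasureSet.prodMk
      ((isTightMeasureSet_range_of_tendsto hμlim).subset ?_)
      ((isTightMeasureSet_range_of_tendsto hνlim).subset ?_)
    · rintro _ ⟨_, ⟨_, ⟨n, rfl⟩, rfl⟩, rfl⟩
      exact ⟨n, (hγs n).2.1.symm⟩
    · rintro _ ⟨_, ⟨_, ⟨n, rfl⟩, rfl⟩, rfl⟩
      exact ⟨n, (hγs n).2.2.symm⟩
  obtain ⟨γ₀, -, θ, hθ, hlim⟩ := (isCompact_closure_of_isTightMeasureSet htight).isSeqCompact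
    fun n => subset_closure (mem_range_self n)
  refine ⟨γ₀, θ, hθ, hlim, inferInstance, ?_, ?_⟩
  · have h1 := ProbabilityMeasure.tendsto_map_of_tendsto_of_continuous _ _ hlim continuous_fst
    have h2 : (fun n => ((γs ∘ θ) n).map continuous_fst.measurable.aemeasurable) = μs ∘ θ :=
      funext fun n => Subtype.ext (hγs (θ n)).2.1
    rw [h2] at h1
    exact congrArg ProbabilityMeasure.toMeasure
      (tendsto_nhds_unique h1 (hμlim.comp hθ.tendsto_atTop))
  · have h1 := ProbabilityMeasure.tendsto_map_of_tendsto_of_continuous _ _ hlim continuous_snd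
    have h2 : (fun n => ((γs ∘ θ) n).map continuous_snd.measurable.aemeasurable) = νs ∘ θ :=
      funext fun n => Subtype.ext (hγs (θ n)).2.2
    rw [h2] at h1
    exact congrArg ProbabilityMeasure.toMeasure
      (tendsto_nhds_unique h1 (hνlim.comp hθ.tendsto_atTop))

end Stability

section SecondMoment

variable {F : Type*} [NormedAddCommGroup F] [MeasurableSpace F]

lemma lintegral_nnnorm_sq_eq (μ : Measure F) :
    ∫⁻ x, (‖x‖₊ : ℝ≥0∞) ^ 2 ∂μ = ∫⁻ x, ENNReal.ofReal (‖x‖ ^ 2) ∂μ := by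
  simp_rw [ENNReal.ofReal_pow (norm_nonneg _), ofReal_norm]
  rfl

variable [OpensMeasurableSpace F]

lemma integral_norm_sq_eq_toReal (μ : Measure F) :
    ∫ x, ‖x‖ ^ 2 ∂μ = (∫⁻ x, (‖x‖₊ : ℝ≥0∞) ^ 2 ∂μ).toReal := by
  rw [lintegral_nnnorm_sq_eq, integral_eq_lintegral_of_nonneg_ae (.of_forall fun x => sq_nonneg _)
    (by fun_prop : Measurable fun x : F => ‖x‖ ^ 2).aestronglyMeasurable]

lemma integrable_norm_sq_of_lintegral_lt_top {μ : Measure F}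
    (h : ∫⁻ x, (‖x‖₊ : ℝ≥0∞) ^ 2 ∂μ < ∞) : Integrable (fun x => ‖x‖ ^ 2) μ := by
  refine ⟨(by fun_prop : Measurable fun x : F => ‖x‖ ^ 2).aestronglyMeasurable, ?_⟩
  rwa [hasFiniteIntegral_iff_ofReal (.of_forall fun x => sq_nonneg _), ← lintegral_nnnorm_sq_eq]

lemma T2Tendsto.tendsto_integral_norm_sq {μs : ℕ → Measure F} {μ : Measure F}
    (h : T2Tendsto μs μ) (hμ : ∫⁻ x, (‖x‖₊ : ℝ≥0∞) ^ 2 ∂μ < ∞) :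
    Tendsto (fun n => ∫ x, ‖x‖ ^ 2 ∂(μs n)) atTop (nhds (∫ x, ‖x‖ ^ 2 ∂μ)) := by
  simp_rw [integral_norm_sq_eq_toReal]
  exact (ENNReal.tendsto_toReal hμ.ne).comp h.2

lemma T2Tendsto.of_tendsto {γs : ℕ → ProbabilityMeasure F} {γ : ProbabilityMeasure F}
    (hlim : Tendsto γs atTop (nhds γ))
    (hγs : ∀ n, Integrable (fun x => ‖x‖ ^ 2) (γs n : Measure F))
    (hγ : Integrable (fun x => ‖x‖ ^ 2) (γ : Measure F))
    (hlim2 : Tendsto (fun n => ∫ x, ‖x‖ ^ 2 ∂(γs n : Measure F)) atTop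
      (nhds (∫ x, ‖x‖ ^ 2 ∂(γ : Measure F)))) :
    T2Tendsto (fun n => (γs n : Measure F)) (γ : Measure F) := by
  refine ⟨ProbabilityMeasure.tendsto_iff_forall_integral_tendsto.1 hlim, ?_⟩
  simp_rw [lintegral_nnnorm_sq_eq]
  rw [← ofReal_integral_eq_lintegral_ofReal hγ (.of_forall fun x => sq_nonneg _)]
  simp_rw [← fun n => ofReal_integral_eq_lintegral_ofReal (hγs n) (.of_forall fun x => sq_nonneg _)]
  exact ENNReal.tendsto_ofReal hlim2

end SecondMoment

/-- If `μₙ → μ` and `νₙ → ν` in the topology `T₂` and `γₙ ∈ K(μₙ,νₙ)` for each `n`, then a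
subsequence of `(γₙ)` converges in `T₂` to some `γ₀ ∈ K(μ,ν)`; in particular the graph
`{(μ,ν,γ) : γ ∈ K(μ,ν)}` is sequentially closed for the product of the `T₂` topologies. -/
theorem optimalCoupling_graph_sequentially_closed {m : ℕ}
    (μs νs : ℕ → Measure (EuclideanSpace ℝ (Fin m)))
    (μ ν : Measure (EuclideanSpace ℝ (Fin m)))
    (hμsP : ∀ n, IsProbabilityMeasure (μs n)) (hνsP : ∀ n, IsProbabilityMeasure (νs n))
    (hμP : IsProbabilityMeasure μ) (hνP : IsProbabilityMeasure ν)
    (hμs2 : ∀ n, (∫⁻ x, (‖x‖₊ : ℝ≥0∞) ^ 2 ∂(μs n)) < ∞)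
    (hνs2 : ∀ n, (∫⁻ x, (‖x‖₊ : ℝ≥0∞) ^ 2 ∂(νs n)) < ∞)
    (hμ2 : (∫⁻ x, (‖x‖₊ : ℝ≥0∞) ^ 2 ∂μ) < ∞)
    (hν2 : (∫⁻ x, (‖x‖₊ : ℝ≥0∞) ^ 2 ∂ν) < ∞)
    (hμconv : T2Tendsto μs μ) (hνconv : T2Tendsto νs ν)
    (γs : ℕ → Measure (EuclideanSpace ℝ (Fin m) × EuclideanSpace ℝ (Fin m)))
    (hγs : ∀ n, IsOptimalCoupling (μs n) (νs n) (γs n)) :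
    ∃ (γ₀ : Measure (EuclideanSpace ℝ (Fin m) × EuclideanSpace ℝ (Fin m))) (φ : ℕ → ℕ),
      StrictMono φ ∧ IsOptimalCoupling μ ν γ₀ ∧ T2Tendsto (fun k => γs (φ k)) γ₀ := by
  have hμi := integrable_norm_sq_of_lintegral_lt_top hμ2
  have hνi := integrable_norm_sq_of_lintegral_lt_top hν2
  have hμsi := fun n => integrable_norm_sq_of_lintegral_lt_top (hμs2 n)
  have hνsi := fun n => integrable_norm_sq_of_lintegral_lt_top (hνs2 n)
  have hμlim2 := hμconv.tendsto_integral_norm_sq hμ2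
  have hνlim2 := hνconv.tendsto_integral_norm_sq hν2
  let P : ProbabilityMeasure (EuclideanSpace ℝ (Fin m)) := ⟨μ, hμP⟩
  let Q : ProbabilityMeasure (EuclideanSpace ℝ (Fin m)) := ⟨ν, hνP⟩
  let Ps : ℕ → ProbabilityMeasure (EuclideanSpace ℝ (Fin m)) := fun n => ⟨μs n, hμsP n⟩
  let Qs : ℕ → ProbabilityMeasure (EuclideanSpace ℝ (Fin m)) := fun n => ⟨νs n, hνsP n⟩
  let Gs : ℕ → ProbabilityMeasure (EuclideanSpace ℝ (Fin m) × EuclideanSpace ℝ (Fin m)) :=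
    fun n => ⟨γs n, (hγs n).1.1⟩
  have hPlim : Tendsto Ps atTop (nhds P) :=
    ProbabilityMeasure.tendsto_iff_forall_integral_tendsto.2 hμconv.1
  have hQlim : Tendsto Qs atTop (nhds Q) :=
    ProbabilityMeasure.tendsto_iff_forall_integral_tendsto.2 hνconv.1
  obtain ⟨γ₀, θ, hθ, hlim, hγ₀⟩ := exists_tendsto_isCoupling_of_tendsto hPlim hQlim
    (γs := Gs) fun n => (hγs n).1
  have hθ' := hθ.tendsto_atTop
  have hnorm : ∀ p : EuclideanSpace ℝ (Fin m) × EuclideanSpace ℝ (Fin m),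
      |‖p‖ ^ 2| ≤ 1 * sqWeight p := fun p => by
    rw [abs_of_nonneg (sq_nonneg _)]; exact norm_sq_le_sqWeight p
  refine ⟨γ₀, θ, hθ, ?_, ?_⟩
  · exact isOptimalCoupling_of_tendsto (μs := Ps ∘ θ) (νs := Qs ∘ θ) (μ := P) (ν := Q)
      (γs := Gs ∘ θ)
      (fun n => hμsi (θ n)) (fun n => hνsi (θ n)) hμi hνi
      (hPlim.comp hθ') (hQlim.comp hθ') (hμlim2.comp hθ') (hνlim2.comp hθ')
      (fun n => hγs (θ n)) hlim hγ₀
  · exact T2Tendsto.of_tendsto hlim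
      (fun n => (hγs (θ n)).1.integrable_of_abs_le (hμsi _) (hνsi _) (by fun_prop) hnorm)
      (hγ₀.integrable_of_abs_le hμi hνi (by fun_prop) hnorm)
      (IsCoupling.tendsto_integral hlim (fun n => (hγs (θ n)).1) hγ₀ (fun n => hμsi (θ n))
        (fun n => hνsi (θ n)) hμi hνi (hμlim2.comp hθ') (hνlim2.comp hθ') (by fun_prop) hnorm)
end
end

section
/- The Wasserstein distance W is continuous on M₂(m) × M₂(m) for the product of the T₂ topologies: if μ_n → μ and ν_n → ν weakly with ∫|x|² dμ_n → ∫|x|² dμ and ∫|x|² dν_n → ∫|x|² dν, then W(μ_n, ν_n) → W(μ, ν). -/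
open MeasureTheory ProbabilityTheory Filter Set
open scoped ENNReal

noncomputable section

section Wasserstein

open scoped NNReal Topology

lemma edist_sq_le {F : Type*} [SeminormedAddCommGroup F] (x y : F) :
    edist x y ^ 2 ≤ 2 * (‖x‖₊ : ℝ≥0∞) ^ 2 + 2 * (‖y‖₊ : ℝ≥0∞) ^ 2 := by
  have h1 : nndist x y ≤ ‖x‖₊ + ‖y‖₊ := by
    rw [nndist_eq_nnnorm]; exact nnnorm_sub_le x y
  have h2 : nndist x y ^ 2 ≤ 2 * ‖x‖₊ ^ 2 + 2 * ‖y‖₊ ^ 2 := by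
    rw [← mul_add]
    exact (pow_le_pow_left₀ zero_le h1 2).trans add_sq_le
  rw [edist_nndist]
  exact_mod_cast h2

variable {E : Type*} [MeasurableSpace E]

lemma sum_restrict_le {μ : Measure E} {A : ℕ → Set E} (hA : ∀ i, MeasurableSet (A i))
    (hd : Pairwise (Function.onFun Disjoint A)) (s : Finset ℕ) :
    ∑ i ∈ s, μ.restrict (A i) ≤ μ := by
  have h := Measure.restrict_biUnion_finset (μ := μ) (T := s) (fun i _ j _ h => hd h) hA
  rw [Measure.sum_fintype, Finset.sum_coe_sort s (fun i => μ.restrict (A i))] at h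
  exact h ▸ Measure.restrict_le_self

lemma inv_max_mul_mul (p q : ℝ≥0∞) (hp : p ≠ ∞) (hq : q ≠ ∞) :
    (max p q)⁻¹ * (p * q) = min p q := by
  rcases eq_or_ne (max p q) 0 with h | h
  · have hp0 : p = 0 := le_antisymm (h ▸ le_max_left p q) zero_le
    simp [hp0]
  · rw [← max_mul_min p q, ← mul_assoc, ENNReal.inv_mul_cancel h (by simp [hp, hq]), one_mul]

lemma inv_max_smul_le {p q : ℝ≥0∞} (hqp : q ≤ p) (μ : Measure E) :
    p⁻¹ • q • μ ≤ μ := by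
  rw [smul_smul]
  refine Measure.le_iff.2 fun s _ => ?_
  rw [Measure.smul_apply, smul_eq_mul]
  refine mul_le_of_le_one_left zero_le ?_
  calc p⁻¹ * q ≤ p⁻¹ * p := by gcongr
    _ ≤ 1 := ENNReal.inv_mul_le_one p

/-- The part of `μ` and `ν` that can be coupled inside the cells of a partition. -/
def cellCoupling (μ ν : Measure E) (A : ℕ → Set E) (s : Finset ℕ) : Measure (E × E) :=
  ∑ i ∈ s, (max (μ (A i)) (ν (A i)))⁻¹ • (μ.restrict (A i)).prod (ν.restrict (A i))

variable {μ ν : Measure E} [IsProbabilityMeasure ν]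

lemma map_fst_cellCoupling_le {A : ℕ → Set E} (hA : ∀ i, MeasurableSet (A i))
    (hd : Pairwise (Function.onFun Disjoint A)) (s : Finset ℕ) :
    (cellCoupling μ ν A s).map Prod.fst ≤ μ := by
  rw [cellCoupling, Measure.map_finset_sum measurable_fst.aemeasurable]
  refine (Finset.sum_le_sum fun i _ => ?_).trans (sum_restrict_le hA hd s)
  rw [Measure.map_smul, Measure.map_fst_prod, Measure.restrict_apply_univ]
  exact inv_max_smul_le (le_max_right _ _) _

lemma map_snd_cellCoupling_le {A : ℕ → Set E} (hA : ∀ i, MeasurableSet (A i))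
    (hd : Pairwise (Function.onFun Disjoint A)) (s : Finset ℕ) :
    (cellCoupling μ ν A s).map Prod.snd ≤ ν := by
  rw [cellCoupling, Measure.map_finset_sum measurable_snd.aemeasurable]
  refine (Finset.sum_le_sum fun i _ => ?_).trans (sum_restrict_le hA hd s)
  rw [Measure.map_smul, Measure.map_snd_prod, Measure.restrict_apply_univ]
  exact inv_max_smul_le (le_max_left _ _) _

variable [IsProbabilityMeasure μ]

lemma cellCoupling_univ (A : ℕ → Set E) (s : Finset ℕ) :
    cellCoupling μ ν A s univ = ∑ i ∈ s, min (μ (A i)) (ν (A i)) := by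
  simp only [cellCoupling, Measure.finsetSum_apply, Measure.smul_apply, smul_eq_mul]
  refine Finset.sum_congr rfl fun i _ => ?_
  rw [← univ_prod_univ, Measure.prod_prod, Measure.restrict_apply_univ,
    Measure.restrict_apply_univ, inv_max_mul_mul _ _ (measure_ne_top _ _) (measure_ne_top _ _)]

lemma lintegral_cellCoupling_le {A : ℕ → Set E} (hA : ∀ i, MeasurableSet (A i))
    {c : E × E → ℝ≥0∞} {b : ℝ≥0∞} (hc : ∀ i, ∀ x ∈ A i, ∀ y ∈ A i, c (x, y) ≤ b)
    (s : Finset ℕ) :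
    ∫⁻ p, c p ∂(cellCoupling μ ν A s) ≤ b * cellCoupling μ ν A s univ := by
  simp only [cellCoupling, lintegral_finsetSum_measure, Measure.finsetSum_apply,
    Finset.mul_sum]
  refine Finset.sum_le_sum fun i _ => ?_
  rw [lintegral_smul_measure, Measure.smul_apply, smul_eq_mul, smul_eq_mul, mul_left_comm]
  gcongr
  rw [← lintegral_const]
  refine lintegral_mono_ae ?_
  rw [Measure.prod_restrict]
  filter_upwards [ae_restrict_mem ((hA i).prod (hA i))] with p hp
  exact hc i p.1 hp.1 p.2 hp.2

lemma inv_smul_measure_univ_smul {r : Measure E} {t : ℝ≥0∞} (hr : r univ = t) (ht : t ≠ ∞) :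
    t⁻¹ • t • r = r := by
  rcases eq_or_ne t 0 with h | h
  · rw [h, Measure.measure_univ_eq_zero] at hr
    simp [hr]
  · rw [smul_smul, ENNReal.inv_mul_cancel h ht, one_smul]

lemma IsCoupling.swap {μ ν : Measure E} {γ : Measure (E × E)} (h : IsCoupling μ ν γ) :
    IsCoupling ν μ (γ.map Prod.swap) := by
  obtain ⟨hp, h1, h2⟩ := h
  refine ⟨Measure.isProbabilityMeasure_map measurable_swap.aemeasurable, ?_, ?_⟩
  · rw [Measure.map_map measurable_fst measurable_swap]; exact h2
  · rw [Measure.map_map measurable_snd measurable_swap]; exact h1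

variable [NormedAddCommGroup E]

lemma lintegral_sub_le_tail {τ : Measure E} [IsFiniteMeasure τ] (h : τ ≤ μ) (k : ℕ) :
    ∫⁻ x, (‖x‖₊ : ℝ≥0∞) ^ 2 ∂(μ - τ) ≤
      k * (1 - τ univ) + ∫⁻ x, ((‖x‖₊ : ℝ≥0∞) ^ 2 - k) ∂μ := by
  calc ∫⁻ x, (‖x‖₊ : ℝ≥0∞) ^ 2 ∂(μ - τ)
      ≤ ∫⁻ x, (k + ((‖x‖₊ : ℝ≥0∞) ^ 2 - k)) ∂(μ - τ) :=
        lintegral_mono fun x => le_add_tsub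
    _ = k * (1 - τ univ) + ∫⁻ x, ((‖x‖₊ : ℝ≥0∞) ^ 2 - k) ∂(μ - τ) := by
        rw [lintegral_add_left measurable_const, lintegral_const, Measure.sub_apply .univ h,
          measure_univ]
    _ ≤ _ := by gcongr; exact Measure.sub_le

lemma sqWasserstein_le_of_isCoupling {μ ν : Measure E} {γ : Measure (E × E)}
    (h : IsCoupling μ ν γ) : sqWasserstein μ ν ≤ ∫⁻ p, edist p.1 p.2 ^ 2 ∂γ :=
  sInf_le ⟨γ, h, rfl⟩

lemma rpow_sqWasserstein_eq_iInf (μ ν : Measure E) :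
    sqWasserstein μ ν ^ (1 / 2 : ℝ) =
      ⨅ γ : {γ : Measure (E × E) // IsCoupling μ ν γ},
        (∫⁻ p, edist p.1 p.2 ^ 2 ∂γ.1) ^ (1 / 2 : ℝ) := by
  have h : sqWasserstein μ ν = ⨅ γ : {γ : Measure (E × E) // IsCoupling μ ν γ},
      ∫⁻ p, edist p.1 p.2 ^ 2 ∂γ.1 := by
    rw [sqWasserstein, iInf]
    congr 1
    ext c
    simp [eq_comm]
  rw [h]
  exact (ENNReal.orderIsoRpow (1 / 2) (by norm_num)).map_iInf _

variable [BorelSpace E]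

lemma lintegral_tail_eq (μ : Measure E) [IsProbabilityMeasure μ] (k : ℕ) :
    ∫⁻ x, ((‖x‖₊ : ℝ≥0∞) ^ 2 - k) ∂μ =
      ∫⁻ x, (‖x‖₊ : ℝ≥0∞) ^ 2 ∂μ - ∫⁻ x, min ((‖x‖₊ : ℝ≥0∞) ^ 2) k ∂μ := by
  rw [← lintegral_sub (by fun_prop) _ (ae_of_all _ fun x => min_le_left _ _)]
  · refine lintegral_congr fun x => ?_
    rcases le_total ((‖x‖₊ : ℝ≥0∞) ^ 2) k with h | h
    · rw [min_eq_left h, tsub_self, tsub_eq_zero_of_le h]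
    · rw [min_eq_right h]
  · refine ne_top_of_le_ne_top (ENNReal.natCast_ne_top k) ?_
    calc ∫⁻ x, min ((‖x‖₊ : ℝ≥0∞) ^ 2) k ∂μ ≤ ∫⁻ _, k ∂μ :=
          lintegral_mono fun x => min_le_right _ _
      _ = k := by simp

lemma tendsto_lintegral_tail (hμ2 : ∫⁻ x, (‖x‖₊ : ℝ≥0∞) ^ 2 ∂μ < ∞) :
    Tendsto (fun k : ℕ => ∫⁻ x, ((‖x‖₊ : ℝ≥0∞) ^ 2 - k) ∂μ) atTop (𝓝 0) := by
  have := tendsto_lintegral_of_dominated_convergence (μ := μ)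
    (F := fun (k : ℕ) x => (‖x‖₊ : ℝ≥0∞) ^ 2 - k) (f := fun _ => 0)
    (fun x => (‖x‖₊ : ℝ≥0∞) ^ 2) (fun k => by fun_prop)
    (fun k => ae_of_all _ fun x => tsub_le_self) hμ2.ne
    (ae_of_all _ fun x => by
      obtain ⟨K, hK⟩ := exists_nat_ge (‖x‖₊ ^ 2)
      refine tendsto_const_nhds.congr' ?_
      filter_upwards [eventually_ge_atTop K] with k hk
      refine (tsub_eq_zero_of_le ?_).symm
      exact_mod_cast hK.trans (by exact_mod_cast hk))
  simpa using this

lemma T2Tendsto.tendsto_probabilityMeasure {μs : ℕ → Measure E}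
    (hμs : ∀ n, IsProbabilityMeasure (μs n)) (h : T2Tendsto μs μ) :
    Tendsto (β := ProbabilityMeasure E) (fun n => ⟨μs n, hμs n⟩) atTop
      (𝓝 ⟨μ, inferInstance⟩) :=
  ProbabilityMeasure.tendsto_iff_forall_integral_tendsto.2 h.1

/-- The function `x ↦ min (‖x‖ ^ 2) k` as a bounded continuous function. -/
def truncSq (E : Type*) [NormedAddCommGroup E] (k : ℕ) : BoundedContinuousFunction E ℝ≥0 :=
  BoundedContinuousFunction.mkOfBound ⟨fun x => min (‖x‖₊ ^ 2) k, by fun_prop⟩ k fun x y => by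
    have hx : ((min (‖x‖₊ ^ 2) (k : ℝ≥0) : ℝ≥0) : ℝ) ≤ k := by
      exact_mod_cast min_le_right (‖x‖₊ ^ (2 : ℕ)) (k : ℝ≥0)
    have hy : ((min (‖y‖₊ ^ 2) (k : ℝ≥0) : ℝ≥0) : ℝ) ≤ k := by
      exact_mod_cast min_le_right (‖y‖₊ ^ (2 : ℕ)) (k : ℝ≥0)
    have hx0 := (min (‖x‖₊ ^ 2) (k : ℝ≥0)).coe_nonneg
    have hy0 := (min (‖y‖₊ ^ 2) (k : ℝ≥0)).coe_nonneg
    rw [NNReal.dist_eq, abs_le]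
    dsimp only [ContinuousMap.coe_mk]
    constructor <;> linarith

lemma T2Tendsto.tendsto_tail {μs : ℕ → Measure E}
    (hμs : ∀ n, IsProbabilityMeasure (μs n)) (h : T2Tendsto μs μ)
    (hμ2 : ∫⁻ x, (‖x‖₊ : ℝ≥0∞) ^ 2 ∂μ < ∞) (k : ℕ) :
    Tendsto (fun n => ∫⁻ x, ((‖x‖₊ : ℝ≥0∞) ^ 2 - k) ∂(μs n)) atTop
      (𝓝 (∫⁻ x, ((‖x‖₊ : ℝ≥0∞) ^ 2 - k) ∂μ)) := by
  have htr := ProbabilityMeasure.tendsto_iff_forall_lintegral_tendsto.1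
    (h.tendsto_probabilityMeasure hμs) (truncSq E k)
  have hco : ∀ x : E, ((truncSq E k x : ℝ≥0) : ℝ≥0∞) = min ((‖x‖₊ : ℝ≥0∞) ^ 2) k := by
    intro x
    change ((min (‖x‖₊ ^ 2) (k : ℝ≥0) : ℝ≥0) : ℝ≥0∞) = _
    push_cast
    rfl
  simp only [hco, ProbabilityMeasure.coe_mk] at htr
  simp only [lintegral_tail_eq]
  exact ENNReal.Tendsto.sub h.2 htr (Or.inl hμ2.ne)

variable [SecondCountableTopology E]

lemma sqWasserstein_le_of_subcoupling {σ : Measure (E × E)} (h1 : σ.map Prod.fst ≤ μ)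
    (h2 : σ.map Prod.snd ≤ ν) :
    sqWasserstein μ ν ≤ ∫⁻ p, edist p.1 p.2 ^ 2 ∂σ
      + 2 * ∫⁻ x, (‖x‖₊ : ℝ≥0∞) ^ 2 ∂(μ - σ.map Prod.fst)
      + 2 * ∫⁻ x, (‖x‖₊ : ℝ≥0∞) ^ 2 ∂(ν - σ.map Prod.snd) := by
  have hσ1 : IsFiniteMeasure (σ.map Prod.fst) := isFiniteMeasure_of_le μ h1
  have hσ2 : IsFiniteMeasure (σ.map Prod.snd) := isFiniteMeasure_of_le ν h2
  have hu1 : σ.map Prod.fst univ = σ univ := by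
    rw [Measure.map_apply measurable_fst .univ, preimage_univ]
  have hu2 : σ.map Prod.snd univ = σ univ := by
    rw [Measure.map_apply measurable_snd .univ, preimage_univ]
  set r := μ - σ.map Prod.fst with hr
  set r' := ν - σ.map Prod.snd with hr'
  set t := 1 - σ univ with ht
  have htop : t ≠ ∞ := by simp [ht]
  have hrt : r univ = t := by rw [hr, Measure.sub_apply .univ h1, hu1, measure_univ]
  have hrt' : r' univ = t := by rw [hr', Measure.sub_apply .univ h2, hu2, measure_univ]
  have : IsFiniteMeasure r := ⟨by rw [hrt]; exact htop.lt_top⟩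
  have : IsFiniteMeasure r' := ⟨by rw [hrt']; exact htop.lt_top⟩
  set ρ := t⁻¹ • r.prod r' with hρ
  have hρ1 : ρ.map Prod.fst = r := by
    rw [hρ, Measure.map_smul, Measure.map_fst_prod, hrt', inv_smul_measure_univ_smul hrt htop]
  have hρ2 : ρ.map Prod.snd = r' := by
    rw [hρ, Measure.map_smul, Measure.map_snd_prod, hrt, inv_smul_measure_univ_smul hrt' htop]
  have hm1 : (ρ + σ).map Prod.fst = μ := by
    rw [Measure.map_add _ _ measurable_fst, hρ1, hr, Measure.sub_add_cancel_of_le h1]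
  have hm2 : (ρ + σ).map Prod.snd = ν := by
    rw [Measure.map_add _ _ measurable_snd, hρ2, hr', Measure.sub_add_cancel_of_le h2]
  have hc : IsCoupling μ ν (ρ + σ) := by
    refine ⟨⟨?_⟩, hm1, hm2⟩
    rw [← preimage_univ (f := Prod.fst), ← Measure.map_apply measurable_fst .univ, hm1,
      measure_univ]
  refine (sqWasserstein_le_of_isCoupling hc).trans ?_
  rw [lintegral_add_measure, add_comm, add_assoc]
  refine add_le_add_right ?_ _
  have hm : Measurable fun x : E => (‖x‖₊ : ℝ≥0∞) ^ 2 := by fun_prop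
  calc ∫⁻ p, edist p.1 p.2 ^ 2 ∂ρ
      ≤ ∫⁻ p, (2 * (‖p.1‖₊ : ℝ≥0∞) ^ 2 + 2 * (‖p.2‖₊ : ℝ≥0∞) ^ 2) ∂ρ :=
        lintegral_mono fun p => edist_sq_le p.1 p.2
    _ = _ := by
        rw [lintegral_add_left (by fun_prop), lintegral_const_mul _ (by fun_prop),
          lintegral_const_mul _ (by fun_prop), ← hρ1, ← hρ2,
          lintegral_map hm measurable_fst, lintegral_map hm measurable_snd]

lemma exists_nullFrontier_partition (μ : Measure E) [IsProbabilityMeasure μ] {δ : ℝ}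
    (hδ : 0 < δ) :
    ∃ A : ℕ → Set E, (∀ i, MeasurableSet (A i)) ∧ Pairwise (Function.onFun Disjoint A) ∧
      (∀ i, μ (frontier (A i)) = 0) ∧ (⋃ i, A i) = univ ∧
      ∀ i, ∀ x ∈ A i, ∀ y ∈ A i, edist x y ≤ ENNReal.ofReal (2 * δ) := by
  choose r hr hr0 using fun i =>
    exists_null_frontier_thickening μ {TopologicalSpace.denseSeq E i} (half_lt_self hδ)
  set B : ℕ → Set E := fun i => Metric.thickening (r i) {TopologicalSpace.denseSeq E i} with hB
  refine ⟨disjointed B, ?_, disjoint_disjointed B, ?_, ?_, ?_⟩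
  · exact fun i => MeasurableSet.disjointed (fun j => Metric.isOpen_thickening.measurableSet) i
  · intro i
    refine disjointedRec (p := fun s => μ (frontier s) = 0) (fun s j hs => ?_) (hr0 i)
    refine measure_mono_null (t := frontier s ∪ frontier (B j)) ?_ (measure_union_null hs (hr0 j))
    rw [sdiff_eq]
    refine (frontier_inter_subset _ _).trans ?_
    rw [frontier_compl]
    exact union_subset_union inter_subset_left inter_subset_right
  · rw [iUnion_disjointed, eq_univ_iff_forall]
    intro x
    obtain ⟨i, hi⟩ := (TopologicalSpace.denseRange_denseSeq E).exists_dist_lt x (half_pos hδ)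
    refine mem_iUnion.2 ⟨i, ?_⟩
    simp only [hB, Metric.thickening_singleton, Metric.mem_ball]
    exact hi.trans (hr i).1
  · intro i x hx y hy
    have hx' := disjointed_subset B i hx
    have hy' := disjointed_subset B i hy
    simp only [hB, Metric.thickening_singleton, Metric.mem_ball] at hx' hy'
    rw [edist_dist]
    refine ENNReal.ofReal_le_ofReal ?_
    have := dist_triangle_right x y (TopologicalSpace.denseSeq E i)
    have := (hr i).2
    linarith

lemma T2Tendsto.eventually_exists_subcoupling {μs : ℕ → Measure E}
    (hμs : ∀ n, IsProbabilityMeasure (μs n)) (h : T2Tendsto μs μ) {δ : ℝ} (hδ : 0 < δ)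
    {η : ℝ≥0∞} (hη : 0 < η) :
    ∀ᶠ n in atTop, ∃ σ : Measure (E × E), σ.map Prod.fst ≤ μs n ∧ σ.map Prod.snd ≤ μ ∧
      1 - σ univ ≤ η ∧ ∫⁻ p, edist p.1 p.2 ^ 2 ∂σ ≤ ENNReal.ofReal (2 * δ) ^ 2 := by
  obtain ⟨A, hA, hd, hfr, hU, hdist⟩ := exists_nullFrontier_partition μ hδ
  have hsum : ∑' i, μ (A i) = 1 := by rw [← measure_iUnion hd hA, hU, measure_univ]
  have hN : ∀ᶠ N in atTop, 1 - η < ∑ i ∈ Finset.range N, μ (A i) := by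
    refine (ENNReal.tendsto_nat_tsum fun i => μ (A i)).eventually_const_lt ?_
    rw [hsum]
    exact ENNReal.sub_lt_self ENNReal.one_ne_top one_ne_zero hη.ne'
  obtain ⟨N, hN⟩ := hN.exists
  have hlim : Tendsto (fun n => ∑ i ∈ Finset.range N, min (μs n (A i)) (μ (A i))) atTop
      (𝓝 (∑ i ∈ Finset.range N, μ (A i))) := by
    refine tendsto_finsetSum _ fun i _ => ?_
    have := ProbabilityMeasure.tendsto_measure_of_null_frontier_of_tendsto'
      (h.tendsto_probabilityMeasure hμs) (hfr i)
    simpa using this.min (tendsto_const_nhds (x := μ (A i)))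
  filter_upwards [hlim.eventually_const_lt hN] with n hn
  have := hμs n
  have hfst := map_fst_cellCoupling_le (μ := μs n) (ν := μ) hA hd (Finset.range N)
  refine ⟨cellCoupling (μs n) μ A (Finset.range N), hfst,
    map_snd_cellCoupling_le hA hd _, ?_, ?_⟩
  · rw [cellCoupling_univ, tsub_le_iff_right, ← tsub_le_iff_left]
    exact hn.le
  · have hle : cellCoupling (μs n) μ A (Finset.range N) univ ≤ 1 := by
      rw [← preimage_univ (f := Prod.fst), ← Measure.map_apply measurable_fst .univ]
      exact (hfst univ).trans prob_le_one
    refine (lintegral_cellCoupling_le hA (b := ENNReal.ofReal (2 * δ) ^ 2)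
      (fun i x hx y hy => pow_le_pow_left₀ zero_le (hdist i x hx y hy) 2) _).trans ?_
    exact mul_le_of_le_one_right zero_le hle

lemma T2Tendsto.tendsto_sqWasserstein_zero {μs : ℕ → Measure E}
    (hμs : ∀ n, IsProbabilityMeasure (μs n)) (h : T2Tendsto μs μ)
    (hμ2 : ∫⁻ x, (‖x‖₊ : ℝ≥0∞) ^ 2 ∂μ < ∞) :
    Tendsto (fun n => sqWasserstein (μs n) μ) atTop (𝓝 0) := by
  refine ENNReal.tendsto_nhds_zero.2 fun ε hε => ?_
  set e := ε / 9 with he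
  have he0 : 0 < e := ENNReal.div_pos hε.ne' (by norm_num)
  obtain ⟨k, hk⟩ := ((tendsto_lintegral_tail hμ2).eventually_lt_const he0).exists
  have hδ : Tendsto (fun δ : ℝ => ENNReal.ofReal (2 * δ) ^ 2) (𝓝[>] 0) (𝓝 0) := by
    have : Continuous fun δ : ℝ => ENNReal.ofReal (2 * δ) ^ 2 :=
      (ENNReal.continuous_pow 2).comp (ENNReal.continuous_ofReal.comp (by fun_prop))
    simpa using (this.tendsto 0).mono_left nhdsWithin_le_nhds
  obtain ⟨δ, hδe, hδ0⟩ := ((hδ.eventually_lt_const he0).and self_mem_nhdsWithin).exists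
  have hη : 0 < e / (k + 1) := ENNReal.div_pos he0.ne' (by finiteness)
  filter_upwards [h.eventually_exists_subcoupling hμs hδ0 hη,
    (h.tendsto_tail hμs hμ2 k).eventually_lt_const hk] with n ⟨σ, h1, h2, hσ, hcost⟩ hn
  have := hμs n
  have hσ1 : IsFiniteMeasure (σ.map Prod.fst) := isFiniteMeasure_of_le (μs n) h1
  have hσ2 : IsFiniteMeasure (σ.map Prod.snd) := isFiniteMeasure_of_le μ h2
  have hke : k * (1 - σ univ) ≤ e := calc
    (k : ℝ≥0∞) * (1 - σ univ) ≤ (k + 1) * (e / (k + 1)) := by gcongr; exact le_self_add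
    _ ≤ e := ENNReal.mul_div_le
  have hb1 := lintegral_sub_le_tail h1 k
  have hb2 := lintegral_sub_le_tail h2 k
  rw [Measure.map_apply measurable_fst .univ, preimage_univ] at hb1
  rw [Measure.map_apply measurable_snd .univ, preimage_univ] at hb2
  calc sqWasserstein (μs n) μ ≤ _ := sqWasserstein_le_of_subcoupling h1 h2
    _ ≤ e + 2 * (e + e) + 2 * (e + e) := by
        gcongr
        · exact hcost.trans hδe.le
        · exact hb1.trans (add_le_add hke hn.le)
        · exact hb2.trans (add_le_add hke hk.le)
    _ = 9 * (ε / 9) := by rw [← he]; ring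
    _ ≤ ε := ENNReal.mul_div_le

lemma sqWasserstein_le_swap (μ ν : Measure E) : sqWasserstein μ ν ≤ sqWasserstein ν μ := by
  refine le_sInf ?_
  rintro _ ⟨γ, hγ, rfl⟩
  refine (sqWasserstein_le_of_isCoupling hγ.swap).trans_eq ?_
  rw [lintegral_map (by fun_prop) measurable_swap]
  simp [edist_comm]

lemma sqWasserstein_comm (μ ν : Measure E) : sqWasserstein μ ν = sqWasserstein ν μ :=
  le_antisymm (sqWasserstein_le_swap μ ν) (sqWasserstein_le_swap ν μ)

/-- Two couplings with a common marginal can be glued along it. -/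
lemma exists_gluing [CompleteSpace E] {μ ν ρ : Measure E} [IsProbabilityMeasure ν]
    {γ₁ γ₂ : Measure (E × E)} (h₁ : IsCoupling μ ν γ₁) (h₂ : IsCoupling ν ρ γ₂) :
    ∃ Γ : Measure (E × E × E), Γ.map (fun p => (p.2.1, p.1)) = γ₁ ∧
      Γ.map (fun p => (p.1, p.2.2)) = γ₂ := by
  obtain ⟨hp₁, hf₁, hs₁⟩ := h₁.swap
  obtain ⟨hp₂, hf₂, hs₂⟩ := h₂
  set γ := γ₁.map Prod.swap with hγ
  refine ⟨ν ⊗ₘ (γ.condKernel ×ₖ γ₂.condKernel), ?_, ?_⟩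
  · have h : (ν ⊗ₘ (γ.condKernel ×ₖ γ₂.condKernel)).map (Prod.map id Prod.fst) = γ := by
      rw [← Measure.compProd_map measurable_fst, ← Kernel.fst_eq, Kernel.fst_prod, ← hf₁]
      exact γ.disintegrate γ.condKernel
    have h' : γ₁ = γ.map Prod.swap := by
      rw [hγ, Measure.map_map measurable_swap measurable_swap]; simp
    rw [h', ← congrArg (Measure.map Prod.swap) h, Measure.map_map measurable_swap (by fun_prop)]
    rfl
  · have h : (ν ⊗ₘ (γ.condKernel ×ₖ γ₂.condKernel)).map (Prod.map id Prod.snd) = γ₂ := by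
      rw [← Measure.compProd_map measurable_snd, ← Kernel.snd_eq, Kernel.snd_prod, ← hf₂]
      exact γ₂.disintegrate γ₂.condKernel
    exact h

lemma rpow_sqWasserstein_triangle [CompleteSpace E] (μ ν ρ : Measure E)
    [IsProbabilityMeasure ν] :
    sqWasserstein μ ρ ^ (1 / 2 : ℝ) ≤
      sqWasserstein μ ν ^ (1 / 2 : ℝ) + sqWasserstein ν ρ ^ (1 / 2 : ℝ) := by
  simp only [rpow_sqWasserstein_eq_iInf, ENNReal.iInf_add, ENNReal.add_iInf]
  refine le_iInf fun ⟨γ₂, h₂⟩ => le_iInf fun ⟨γ₁, h₁⟩ => ?_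
  obtain ⟨Γ, hΓ₁, hΓ₂⟩ := exists_gluing h₁ h₂
  have hm : Measurable fun p : E × E => edist p.1 p.2 ^ 2 := by fun_prop
  have hΓ : IsCoupling μ ρ (Γ.map Prod.snd) := by
    obtain ⟨hp₁, hf₁, -⟩ := h₁
    obtain ⟨-, -, hs₂⟩ := h₂
    have hf : (Γ.map Prod.snd).map Prod.fst = μ := by
      rw [← hf₁, ← hΓ₁, Measure.map_map (by fun_prop) (by fun_prop),
        Measure.map_map (by fun_prop) (by fun_prop)]
      rfl
    refine ⟨⟨?_⟩, hf, ?_⟩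
    · have : IsProbabilityMeasure μ :=
        hf₁ ▸ Measure.isProbabilityMeasure_map measurable_fst.aemeasurable
      rw [← preimage_univ (f := Prod.fst), ← Measure.map_apply measurable_fst .univ, hf,
        measure_univ]
    · rw [← hs₂, ← hΓ₂, Measure.map_map (by fun_prop) (by fun_prop),
        Measure.map_map (by fun_prop) (by fun_prop)]
      rfl
  refine (iInf_le _ ⟨_, hΓ⟩).trans ?_
  dsimp only
  rw [← hΓ₁, ← hΓ₂, lintegral_map hm (by fun_prop), lintegral_map hm (by fun_prop),
    lintegral_map hm (by fun_prop)]
  have hmink := ENNReal.lintegral_Lp_add_le (μ := Γ) (p := 2)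
    (f := fun p => edist p.2.1 p.1) (g := fun p => edist p.1 p.2.2)
    (by fun_prop) (by fun_prop) (by norm_num)
  simp only [ENNReal.rpow_two] at hmink
  refine le_trans ?_ hmink
  gcongr with p
  exact edist_triangle _ _ _

end Wasserstein

/-- The Wasserstein distance `W = (W²)^{1/2}` is continuous for the product of the `T₂`
topologies: if `μₙ → μ` and `νₙ → ν` weakly with convergence of second moments, then
`W(μₙ,νₙ) → W(μ,ν)`. -/
theorem wasserstein_continuous {m : ℕ}
    (μs νs : ℕ → Measure (EuclideanSpace ℝ (Fin m)))
    (μ ν : Measure (EuclideanSpace ℝ (Fin m)))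
    (hμsP : ∀ n, IsProbabilityMeasure (μs n)) (hνsP : ∀ n, IsProbabilityMeasure (νs n))
    (hμP : IsProbabilityMeasure μ) (hνP : IsProbabilityMeasure ν)
    (hμs2 : ∀ n, (∫⁻ x, (‖x‖₊ : ℝ≥0∞) ^ 2 ∂(μs n)) < ∞)
    (hνs2 : ∀ n, (∫⁻ x, (‖x‖₊ : ℝ≥0∞) ^ 2 ∂(νs n)) < ∞)
    (hμ2 : (∫⁻ x, (‖x‖₊ : ℝ≥0∞) ^ 2 ∂μ) < ∞)
    (hν2 : (∫⁻ x, (‖x‖₊ : ℝ≥0∞) ^ 2 ∂ν) < ∞)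
    (hμconv : T2Tendsto μs μ) (hνconv : T2Tendsto νs ν) :
    Filter.Tendsto (fun n => sqWasserstein (μs n) (νs n) ^ (1/2 : ℝ)) Filter.atTop
      (nhds (sqWasserstein μ ν ^ (1/2 : ℝ))) := by
  have hzero : ∀ {κs : ℕ → Measure (EuclideanSpace ℝ (Fin m))}
      {κ : Measure (EuclideanSpace ℝ (Fin m))}, (∀ n, IsProbabilityMeasure (κs n)) →
      IsProbabilityMeasure κ → (∫⁻ x, (‖x‖₊ : ℝ≥0∞) ^ 2 ∂κ) < ∞ → T2Tendsto κs κ →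
      Tendsto (fun n => sqWasserstein (κs n) κ ^ (1/2 : ℝ)) atTop (nhds 0) := by
    intro κs κ hκs hκ hκ2 hconv
    have h := (hconv.tendsto_sqWasserstein_zero hκs hκ2).ennrpow_const (1/2 : ℝ)
    rwa [ENNReal.zero_rpow_of_pos (by norm_num)] at h
  have herr := (hzero hμsP hμP hμ2 hμconv).add (hzero hνsP hνP hν2 hνconv)
  rw [add_zero] at herr
  set W := sqWasserstein μ ν ^ (1/2 : ℝ) with hW
  have hlow := ENNReal.Tendsto.sub (tendsto_const_nhds (x := W)) herr (Or.inr ENNReal.zero_ne_top)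
  have hup := (tendsto_const_nhds (x := W)).add herr
  rw [tsub_zero] at hlow
  rw [add_zero] at hup
  refine tendsto_of_tendsto_of_tendsto_of_le_of_le hlow hup (fun n => ?_) fun n => ?_
  · have := hμsP n
    have := hνsP n
    have h1 := rpow_sqWasserstein_triangle μ (μs n) ν
    have h2 := rpow_sqWasserstein_triangle (μs n) (νs n) ν
    rw [sqWasserstein_comm μ (μs n)] at h1
    refine tsub_le_iff_right.2 ((h1.trans (add_le_add_right h2 _)).trans_eq ?_)
    ring
  · have h1 := rpow_sqWasserstein_triangle (μs n) μ (νs n)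
    have h2 := rpow_sqWasserstein_triangle μ ν (νs n)
    rw [sqWasserstein_comm ν (νs n)] at h2
    refine (h1.trans (add_le_add_right h2 _)).trans_eq ?_
    ring
end
end

section
/- There exists a Borel measurable map κ : M₂(m) × M₂(m) → M₂(2m) such that for every pair μ, ν ∈ M₂(m), κ(μ,ν) ∈ K(μ,ν); that is, κ(μ,ν) is a probability measure on ℝ^m × ℝ^m with marginals μ and ν that minimizes ∫ |x−y|² dγ among all such couplings. (Here the spaces of probability measures are equipped with the Borel σ-algebra of the weak* topology, which coincides with the Borel σ-algebra of T₂.) -/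
open MeasureTheory ProbabilityTheory Filter Set
open scoped ENNReal

noncomputable section

open TopologicalSpace Topology
open scoped NNReal

section MeasurableSelection

variable {X Y : Type*} [TopologicalSpace X] [MeasurableSpace Y]

/-- A multifunction `K` with nonempty compact values is measurable if it hits every closed set
along a measurable set of parameters. -/
structure IsMeasurableCompactValued (K : Y → Set X) : Prop where
  nonempty : ∀ y, (K y).Nonempty
  isCompact : ∀ y, IsCompact (K y)
  measurableSet_inter_nonempty : ∀ C, IsClosed C → MeasurableSet {y | (K y ∩ C).Nonempty}

/-- The minimizers of a lower semicontinuous function over a measurable compact-valued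
multifunction form a measurable compact-valued multifunction. -/
theorem IsMeasurableCompactValued.argmin {K : Y → Set X} (hK : IsMeasurableCompactValued K)
    {f : X → ℝ≥0∞} (hf : LowerSemicontinuous f) :
    IsMeasurableCompactValued fun y ↦ {x ∈ K y | IsMinOn f (K y) x} := by
  have hmin (y : Y) : ∃ a ∈ K y, IsMinOn f (K y) a :=
    (hf.lowerSemicontinuousOn _).exists_isMinOn (hK.nonempty y) (hK.isCompact y)
  refine ⟨hmin, fun y ↦ ?_, fun C hC ↦ ?_⟩
  · obtain ⟨a, ha, hamin⟩ := hmin y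
    convert! (hK.isCompact y).inter_right (hf.isClosed_preimage (f a)) using 1
    ext x
    exact and_congr_right fun _ ↦ ⟨fun h ↦ h ha, fun h ↦ isMinOn_iff.2 fun z hz ↦
      le_trans h (hamin hz)⟩
  · obtain ⟨D, hDc, hD⟩ := exists_countable_dense ℝ≥0∞
    have key : {y | ({x ∈ K y | IsMinOn f (K y) x} ∩ C).Nonempty} =
        ⋂ q ∈ insert ∞ D, {y | (K y ∩ f ⁻¹' Iic q).Nonempty}ᶜ ∪
          {y | (K y ∩ (C ∩ f ⁻¹' Iic q)).Nonempty} := by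
      ext y
      simp only [mem_iInter, mem_union, mem_compl_iff, mem_ofPred_eq]
      constructor
      · rintro ⟨x, ⟨hxK, hx⟩, hxC⟩ q -
        by_cases h : (K y ∩ f ⁻¹' Iic q).Nonempty
        · obtain ⟨z, hzK, hz⟩ := h
          exact .inr ⟨x, hxK, hxC, le_trans (isMinOn_iff.1 hx z hzK) hz⟩
        · exact .inl h
      · intro h
        have hC' : (K y ∩ C).Nonempty := by
          obtain ⟨a, ha, -⟩ := hmin y
          obtain h | ⟨x, hx, hxC, -⟩ := h ∞ (mem_insert _ _)
          · exact absurd ⟨a, ha, by simp⟩ h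
          · exact ⟨x, hx, hxC⟩
        obtain ⟨x, hx, hxmin⟩ := (hf.lowerSemicontinuousOn _).exists_isMinOn hC'
          ((hK.isCompact y).inter_right hC)
        refine ⟨x, ⟨hx.1, fun z hz ↦ ?_⟩, hx.2⟩
        by_contra! hlt
        obtain ⟨q, hqD, hzq, hqx⟩ := hD.exists_between (not_le.1 hlt)
        obtain h | ⟨w, hw, hwC, hwq⟩ := h q (mem_insert_of_mem _ hqD)
        · exact h ⟨z, hz, hzq.le⟩
        · exact (hqx.trans_le (hxmin ⟨hw, hwC⟩)).not_ge hwq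
    rw [key]
    refine MeasurableSet.biInter (hDc.insert _) fun q _ ↦ ?_
    exact (hK.measurableSet_inter_nonempty _ (hf.isClosed_preimage q)).compl.union
      (hK.measurableSet_inter_nonempty _ (hC.inter (hf.isClosed_preimage q)))

/-- A decreasing intersection of measurable compact-valued multifunctions is again one. -/
theorem IsMeasurableCompactValued.iInter [T2Space X] {K : ℕ → Y → Set X}
    (hK : ∀ n, IsMeasurableCompactValued (K n)) (hanti : ∀ n y, K (n + 1) y ⊆ K n y) :
    IsMeasurableCompactValued fun y ↦ ⋂ n, K n y := by
  have hinter (y : Y) (C : Set X) (hC : IsClosed C) (h : ∀ n, (K n y ∩ C).Nonempty) :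
      ((⋂ n, K n y) ∩ C).Nonempty := by
    rw [iInter_inter]
    exact IsCompact.nonempty_iInter_of_sequence_nonempty_isCompact_isClosed _
      (fun n ↦ inter_subset_inter_left _ (hanti n y)) h
      (((hK 0).isCompact y).inter_right hC)
      fun n ↦ ((hK n).isCompact y).isClosed.inter hC
  refine ⟨fun y ↦ ?_, fun y ↦ ?_, fun C hC ↦ ?_⟩
  · simpa using hinter y univ isClosed_univ (by simpa using fun n ↦ (hK n).nonempty y)
  · exact ((hK 0).isCompact y).of_isClosed_subset
      (isClosed_iInter fun n ↦ ((hK n).isCompact y).isClosed) (iInter_subset _ 0)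
  · have : {y | ((⋂ n, K n y) ∩ C).Nonempty} = ⋂ n, {y | (K n y ∩ C).Nonempty} := by
      ext y
      simp only [mem_iInter, mem_ofPred_eq]
      exact ⟨fun h n ↦ h.mono (inter_subset_inter_left _ (iInter_subset _ n)), hinter y C hC⟩
    rw [this]
    exact MeasurableSet.iInter fun n ↦ (hK n).measurableSet_inter_nonempty C hC

/-- A measurable compact-valued multifunction into a second countable Hausdorff space has a
Borel measurable selection. -/
theorem IsMeasurableCompactValued.exists_measurable_selection [T2Space X]
    [SecondCountableTopology X] [MeasurableSpace X] [BorelSpace X] {K : Y → Set X}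
    (hK : IsMeasurableCompactValued K) : ∃ κ : Y → X, Measurable κ ∧ ∀ y, κ y ∈ K y := by
  obtain ⟨b, hb⟩ := exists_seq_basis X
  let f (n : ℕ) : X → ℝ≥0∞ := (b n).indicator fun _ ↦ 1
  let L (n : ℕ) : Y → Set X :=
    n.rec K fun k M y ↦ {x ∈ M y | IsMinOn (f k) (M y) x}
  have hL (n : ℕ) : IsMeasurableCompactValued (L n) := by
    induction n with
    | zero => exact hK
    | succ n ih =>
      exact ih.argmin ((hb.isOpen (mem_range_self n)).lowerSemicontinuous_indicator zero_le_one)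
  have hI := IsMeasurableCompactValued.iInter hL fun n y x hx ↦ hx.1
  have hsub (y : Y) : (⋂ n, L n y).Subsingleton := by
    intro x hx z hz
    by_contra hne
    obtain ⟨_, ⟨n, rfl⟩, hxn, hn⟩ :=
      hb.exists_subset_of_mem_open (show x ∈ ({z} : Set X)ᶜ from hne) isOpen_compl_singleton
    have hzn : z ∉ b n := fun h ↦ hn h rfl
    have hle : f n x ≤ f n z := (mem_iInter.1 hx (n + 1)).2 (mem_iInter.1 hz n)
    simp [f, hxn, hzn] at hle
  choose κ hκ using hI.nonempty
  refine ⟨κ, measurable_of_isClosed fun C hC ↦ ?_, fun y ↦ mem_iInter.1 (hκ y) 0⟩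
  convert! hI.measurableSet_inter_nonempty C hC using 1
  ext y
  exact ⟨fun h ↦ ⟨κ y, hκ y, h⟩, fun ⟨x, hx, hxC⟩ ↦ show κ y ∈ C by rwa [← hsub y hx (hκ y)]⟩

/-- The fibers of a surjective proper map form a measurable compact-valued multifunction. -/
theorem IsProperMap.isMeasurableCompactValued_fiber [TopologicalSpace Y] [OpensMeasurableSpace Y]
    {π : X → Y} (hπ : IsProperMap π) (hsurj : π.Surjective) :
    IsMeasurableCompactValued fun y ↦ π ⁻¹' {y} := by
  refine ⟨hsurj, fun _ ↦ hπ.isCompact_preimage isCompact_singleton, fun C hC ↦ ?_⟩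
  convert! (hπ.isClosedMap C hC).measurableSet using 1
  ext y
  exact ⟨fun ⟨x, hx, hxC⟩ ↦ ⟨x, hxC, hx⟩, fun ⟨x, hxC, hx⟩ ↦ ⟨x, hx, hxC⟩⟩

end MeasurableSelection

section ProbabilityMeasure

namespace MeasureTheory.ProbabilityMeasure

variable {Ω : Type*} [MeasurableSpace Ω] [TopologicalSpace Ω]

/-- The mass of an open set depends lower semicontinuously on the probability measure. -/
theorem lowerSemicontinuous_apply_of_isOpen [OpensMeasurableSpace Ω] [HasOuterApproxClosed Ω]
    {G : Set Ω} (hG : IsOpen G) :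
    LowerSemicontinuous fun μ : ProbabilityMeasure Ω ↦ (μ : Measure Ω) G :=
  lowerSemicontinuous_iff_le_liminf.2 fun _ ↦ le_liminf_measure_open_of_tendsto tendsto_id hG

/-- The integral of a nonnegative continuous function depends lower semicontinuously on the
probability measure. -/
theorem lowerSemicontinuous_lintegral [OpensMeasurableSpace Ω] {f : Ω → ℝ≥0} (hf : Continuous f) :
    LowerSemicontinuous fun μ : ProbabilityMeasure Ω ↦ ∫⁻ x, f x ∂(μ : Measure Ω) := by
  let g (n : ℕ) : BoundedContinuousFunction Ω ℝ≥0 :=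
    BoundedContinuousFunction.mkOfBound ⟨fun x ↦ min (f x) n, by fun_prop⟩ n fun x y ↦ by
      rw [NNReal.dist_eq, abs_le]
      have h1 : ((min (f x) n : ℝ≥0) : ℝ) ≤ n := mod_cast min_le_right _ _
      have h2 : ((min (f y) n : ℝ≥0) : ℝ) ≤ n := mod_cast min_le_right _ _
      have h3 := (min (f x) n).coe_nonneg
      have h4 := (min (f y) n).coe_nonneg
      constructor <;> simp only [ContinuousMap.coe_mk] <;> linarith
  have hg (μ : ProbabilityMeasure Ω) :
      ∫⁻ x, f x ∂(μ : Measure Ω) = ⨆ n, ∫⁻ x, g n x ∂(μ : Measure Ω) := by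
    rw [← lintegral_iSup (fun n ↦ (g n).continuous.measurable.coe_nnreal_ennreal)]
    · refine lintegral_congr fun x ↦ le_antisymm ?_ (iSup_le fun n ↦ ?_)
      · obtain ⟨n, hn⟩ := exists_nat_ge (f x)
        exact le_iSup_of_le n (ENNReal.coe_le_coe.2 (le_min le_rfl hn))
      · exact ENNReal.coe_le_coe.2 (min_le_left _ _)
    · intro n m hnm x
      exact ENNReal.coe_le_coe.2 (min_le_min_left _ (by exact_mod_cast hnm))
  simp_rw [hg]
  exact lowerSemicontinuous_iSup fun n ↦
    (continuous_lintegral_boundedContinuousFunction (g n)).lowerSemicontinuous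

/-- On a second countable space, the weak topology on probability measures is generated by
countably many Giry-measurable sets. -/
theorem exists_countable_measurable_subbasis [OpensMeasurableSpace Ω] [HasOuterApproxClosed Ω]
    [SecondCountableTopology Ω] :
    ∃ s : Set (Set (ProbabilityMeasure Ω)), s.Countable ∧ (∀ t ∈ s, MeasurableSet t) ∧
      (inferInstance : TopologicalSpace (ProbabilityMeasure Ω)) = generateFrom s := by
  obtain ⟨B, hBc, -, hB⟩ := exists_countable_basis Ω
  have := hBc.to_subtype
  let S (p : Finset B × ℚ) : Set (ProbabilityMeasure Ω) :=
    {μ | ENNReal.ofReal p.2 < (μ : Measure Ω) (⋃ t ∈ p.1, (t : Set Ω))}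
  have hopen (T : Finset B) : IsOpen (⋃ t ∈ T, (t : Set Ω)) :=
    isOpen_biUnion fun t _ ↦ hB.isOpen t.2
  refine ⟨range S, countable_range S, ?_, le_antisymm (le_generateFrom ?_) ?_⟩
  · rintro _ ⟨p, rfl⟩
    exact measurableSet_lt measurable_const
      ((Measure.measurable_coe (hopen p.1).measurableSet).comp measurable_subtype_coe)
  · rintro _ ⟨p, rfl⟩
    exact (lowerSemicontinuous_apply_of_isOpen (hopen p.1)).isOpen_preimage _
  · have hcg (μ : ProbabilityMeasure Ω) :
        (@nhds _ (generateFrom (range S)) μ).IsCountablyGenerated := by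
      let := generateFrom (range S)
      have : SecondCountableTopology (ProbabilityMeasure Ω) := ⟨_, countable_range S, rfl⟩
      infer_instance
    rw [← continuous_id_iff_le, @continuous_iff_continuousAt _ _ (generateFrom (range S))]
    intro μ
    have := hcg μ
    refine tendsto_of_forall_isOpen_le_liminf' fun G hG ↦ ?_
    refine (le_liminf_iff (by isBoundedDefault) (by isBoundedDefault)).2 fun r hr ↦ ?_
    lift r to ℝ≥0 using hr.ne_top
    obtain ⟨T, hTB, hrT, hTG⟩ := exists_lt_measure_biUnion_of_isOpen μ
      (fun u hu x hx ↦ by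
        obtain ⟨v, hv, hxv, hvu⟩ := hB.exists_subset_of_mem_open hx hu
        exact ⟨v, hv, (hB.isOpen hv).mem_nhds hxv, hvu⟩) hG (r := r)
      (by rwa [← ennreal_coeFn_eq_coeFn_toMeasure, ENNReal.coe_lt_coe] at hr)
    lift T to Finset B using hTB
    rw [Finset.set_biUnion_finset_image] at hrT hTG
    rw [← ENNReal.coe_lt_coe, ennreal_coeFn_eq_coeFn_toMeasure] at hrT
    obtain ⟨q, -, hrq, hqT⟩ := ENNReal.lt_iff_exists_rat_btwn.1 hrT
    have hmem : S (T, q) ∈ @nhds _ (generateFrom (range S)) μ :=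
      (@IsOpen.mem_nhds_iff _ (generateFrom (range S)) _ _
        (isOpen_generateFrom_of_mem (mem_range_self (T, q)))).2 hqT
    filter_upwards [hmem] with ν hν
    exact hrq.trans (lt_of_lt_of_le hν (measure_mono hTG))

instance [OpensMeasurableSpace Ω] [HasOuterApproxClosed Ω] [SecondCountableTopology Ω] :
    SecondCountableTopology (ProbabilityMeasure Ω) := by
  obtain ⟨s, hs, -, h⟩ := exists_countable_measurable_subbasis (Ω := Ω)
  exact ⟨s, hs, h⟩

instance [BorelSpace Ω] [HasOuterApproxClosed Ω] [SecondCountableTopology Ω] :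
    BorelSpace (ProbabilityMeasure Ω) := by
  obtain ⟨s, hs, hsm, h⟩ := exists_countable_measurable_subbasis (Ω := Ω)
  refine ⟨le_antisymm ?_ ?_⟩
  · have : @Measurable _ _ (borel (ProbabilityMeasure Ω)) _
        (fun μ : ProbabilityMeasure Ω ↦ (μ : Measure Ω)) := by
      let := borel (ProbabilityMeasure Ω)
      have : BorelSpace (ProbabilityMeasure Ω) := ⟨rfl⟩
      exact Measurable.measure_of_isPiSystem_of_isProbabilityMeasure
        (BorelSpace.measurable_eq.trans rfl) isPiSystem_isOpen
        fun G hG ↦ (lowerSemicontinuous_apply_of_isOpen hG).measurable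
    exact this.comap_le
  · rw [borel_eq_generateFrom_of_subbasis h]
    exact MeasurableSpace.generateFrom_le hsm

section Marginals

variable {E : Type*} [MeasurableSpace E]

/-- The pair of marginals of a probability measure on a product. -/
def marginals (γ : ProbabilityMeasure (E × E)) : ProbabilityMeasure E × ProbabilityMeasure E :=
  (γ.map measurable_fst.aemeasurable, γ.map measurable_snd.aemeasurable)

/-- A probability measure has marginals `μ` and `ν` iff it is a coupling of them. -/
theorem marginals_eq_iff {γ : ProbabilityMeasure (E × E)} {μ ν : ProbabilityMeasure E} :
    γ.marginals = (μ, ν) ↔ IsCoupling (μ : Measure E) ν γ := by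
  rw [marginals, Prod.mk.injEq, ← toMeasure_injective.eq_iff, ← toMeasure_injective.eq_iff]
  simp [IsCoupling, show IsProbabilityMeasure (γ : Measure (E × E)) from inferInstance]

/-- Any two probability measures are the marginals of their product measure. -/
theorem marginals_surjective : (marginals (E := E)).Surjective := by
  rintro ⟨μ, ν⟩
  refine ⟨μ.prod ν, marginals_eq_iff.2 ?_⟩
  exact ⟨inferInstance, by simp [Measure.map_fst_prod], by simp [Measure.map_snd_prod]⟩

/-- By Prokhorov's theorem, on a Polish space, taking marginals is a proper map. -/
theorem isProperMap_marginals [TopologicalSpace E] [PolishSpace E] [BorelSpace E] :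
    IsProperMap (marginals (E := E)) := by
  let := upgradeIsCompletelyMetrizable E
  have hcont : Continuous (marginals (E := E)) :=
    (continuous_map continuous_fst).prodMk (continuous_map continuous_snd)
  refine isProperMap_iff_isCompact_preimage.2 ⟨hcont, fun K hK ↦ ?_⟩
  have htight (S : Set (ProbabilityMeasure E)) (hS : IsCompact S) :
      IsTightMeasureSet {((μ : ProbabilityMeasure E) : Measure E) | μ ∈ S} :=
    isTightMeasureSet_of_isCompact_closure (by rwa [hS.isClosed.closure_eq])
  have h : IsCompact (closure (marginals ⁻¹' K)) := by
    refine isCompact_closure_of_isTightMeasureSet (.prodMk ?_ ?_)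
    · refine (htight _ (hK.image continuous_fst)).subset ?_
      rintro _ ⟨_, ⟨γ, hγ, rfl⟩, rfl⟩
      exact ⟨_, mem_image_of_mem _ hγ, rfl⟩
    · refine (htight _ (hK.image continuous_snd)).subset ?_
      rintro _ ⟨_, ⟨γ, hγ, rfl⟩, rfl⟩
      exact ⟨_, mem_image_of_mem _ hγ, rfl⟩
  rwa [(hK.isClosed.preimage hcont).closure_eq] at h

end Marginals

end MeasureTheory.ProbabilityMeasure

end ProbabilityMeasure

/-- Optimal couplings of probability measures on a Polish normed group can be selected
measurably. -/
theorem exists_measurable_isOptimalCoupling {E : Type*} [NormedAddCommGroup E] [PolishSpace E]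
    [MeasurableSpace E] [BorelSpace E] :
    ∃ κ : ProbabilityMeasure E × ProbabilityMeasure E → ProbabilityMeasure (E × E),
      Measurable κ ∧ ∀ p, IsOptimalCoupling (p.1 : Measure E) p.2 (κ p) := by
  have hcost : LowerSemicontinuous fun γ : ProbabilityMeasure (E × E) ↦
      ∫⁻ p, edist p.1 p.2 ^ 2 ∂(γ : Measure (E × E)) := by
    simp_rw [edist_nndist, ← ENNReal.coe_pow]
    exact ProbabilityMeasure.lowerSemicontinuous_lintegral (by fun_prop)
  obtain ⟨κ, hκ, h⟩ := ((ProbabilityMeasure.isProperMap_marginals (E := E)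
    |>.isMeasurableCompactValued_fiber
      ProbabilityMeasure.marginals_surjective).argmin hcost).exists_measurable_selection
  refine ⟨κ, hκ, fun p ↦ ?_⟩
  have hp := ProbabilityMeasure.marginals_eq_iff.1 (h p).1
  refine ⟨hp, le_antisymm (le_sInf ?_) (sInf_le ⟨_, hp, rfl⟩)⟩
  rintro _ ⟨γ, hγ, rfl⟩
  exact isMinOn_iff.1 (h p).2 ⟨γ, hγ.1⟩ (ProbabilityMeasure.marginals_eq_iff.2 hγ)

/-- There is a Borel measurable selection of optimal couplings: a measurable map
`κ : M₂(m) × M₂(m) → M₂(2m)` with `κ(μ,ν) ∈ K(μ,ν)` for all probability measures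
`μ, ν` on `ℝ^m` with finite second moments. -/
theorem exists_measurable_optimalCoupling_selection {m : ℕ} :
    ∃ κ : Measure (EuclideanSpace ℝ (Fin m)) → Measure (EuclideanSpace ℝ (Fin m)) →
        Measure (EuclideanSpace ℝ (Fin m) × EuclideanSpace ℝ (Fin m)),
      Measurable (Function.uncurry κ) ∧
      ∀ μ ν : Measure (EuclideanSpace ℝ (Fin m)),
        IsProbabilityMeasure μ → IsProbabilityMeasure ν →
        (∫⁻ x, (‖x‖₊ : ℝ≥0∞) ^ 2 ∂μ) < ∞ → (∫⁻ x, (‖x‖₊ : ℝ≥0∞) ^ 2 ∂ν) < ∞ →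
        IsOptimalCoupling μ ν (κ μ ν) := by
  classical
  obtain ⟨κ, hκ, hopt⟩ :=
    exists_measurable_isOptimalCoupling (E := EuclideanSpace ℝ (Fin m))
  refine ⟨fun μ ν ↦ if h : IsProbabilityMeasure μ ∧ IsProbabilityMeasure ν then
    κ (⟨μ, h.1⟩, ⟨ν, h.2⟩) else 0, ?_, fun μ ν hμ hν _ _ ↦ ?_⟩
  · refine Measurable.dite (s := {p : Measure (EuclideanSpace ℝ (Fin m)) ×
      Measure (EuclideanSpace ℝ (Fin m)) | IsProbabilityMeasure p.1 ∧ IsProbabilityMeasure p.2})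
      (f := fun p ↦ (κ (⟨p.1.1, p.2.1⟩, ⟨p.1.2, p.2.2⟩)).toMeasure) (g := fun _ ↦ 0)
      ?_ measurable_const ?_
    · exact measurable_subtype_coe.comp <| hκ.comp <|
        (measurable_fst.comp measurable_subtype_coe).subtype_mk.prodMk
          (measurable_snd.comp measurable_subtype_coe).subtype_mk
    · exact (ProbabilityMeasure.measurableSet_isProbabilityMeasure.preimage measurable_fst).inter
        (ProbabilityMeasure.measurableSet_isProbabilityMeasure.preimage measurable_snd)
  · simpa [hμ, hν] using hopt (⟨μ, hμ⟩, ⟨ν, hν⟩)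
end
end

section
/- (Blackwell–Dubins) Let (E,𝓔) be a Polish space with its Borel σ-algebra and let M be the set of Borel probability measures on E equipped with the weak* topology. There exists a Borel measurable function h : M × [0,1] → E such that for each α ∈ M, the pushforward of Lebesgue measure on [0,1] under h(α, ·) equals α. Moreover, if α_n → α weak*, then h(α_n, t) → h(α, t) for Lebesgue-almost every t ∈ [0,1]. -/
open MeasureTheory ProbabilityTheory Filter Set
open scoped ENNReal

noncomputable section

open TopologicalSpace Topology

/-- The quantile function of a measure on the real line, set to `0` outside `(0, 1)`. -/
def quantile (μ : Measure ℝ) (u : ℝ) : ℝ :=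
  open Classical in if u ∈ Ioo (0 : ℝ) 1 then sInf {q | u ≤ cdf μ q} else 0

lemma quantile_le_iff (μ : Measure ℝ) {u : ℝ} (hu : u ∈ Ioo (0 : ℝ) 1) (q : ℝ) :
    quantile μ u ≤ q ↔ u ≤ cdf μ q := by
  rw [quantile, if_pos hu]
  have hbdd : BddBelow {q | u ≤ cdf μ q} := by
    obtain ⟨a, ha⟩ := ((tendsto_cdf_atBot μ).eventually_lt_const hu.1).exists
    exact ⟨a, fun q hq => le_of_not_gt fun h =>
      (hq.trans (monotone_cdf μ h.le)).not_gt ha⟩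
  have hne : {q | u ≤ cdf μ q}.Nonempty := by
    obtain ⟨b, hb⟩ := ((tendsto_cdf_atTop μ).eventually_const_lt hu.2).exists
    exact ⟨b, hb.le⟩
  refine ⟨fun h => ?_, fun h => csInf_le hbdd h⟩
  have hright : Tendsto (cdf μ) (𝓝[>] q) (𝓝 (cdf μ q)) :=
    continuousWithinAt_Ioi_iff_Ici.mpr ((cdf μ).right_continuous q)
  refine ge_of_tendsto hright ?_
  filter_upwards [self_mem_nhdsWithin] with y hy
  obtain ⟨z, hz, hzy⟩ := exists_lt_of_csInf_lt hne (h.trans_lt hy)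
  exact le_trans hz (monotone_cdf μ hzy.le)

lemma measurable_quantile {A : Type*} [MeasurableSpace A] {μ : A → Measure ℝ}
    [∀ a, IsProbabilityMeasure (μ a)] (hμ : Measurable μ) :
    Measurable fun p : A × ℝ => quantile (μ p.1) p.2 := by
  refine measurable_of_Iic fun q => ?_
  have hset : (fun p : A × ℝ => quantile (μ p.1) p.2) ⁻¹' Iic q =
      Prod.snd ⁻¹' Ioo 0 1 ∩ {p | p.2 ≤ (μ p.1).real (Iic q)} ∪
        Prod.snd ⁻¹' (Ioo 0 1)ᶜ ∩ {_p | 0 ≤ q} := by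
    ext ⟨a, u⟩
    by_cases hu : u ∈ Ioo (0 : ℝ) 1
    · simp only [mem_preimage, mem_Iic, quantile_le_iff _ hu, mem_union, mem_inter_iff, hu,
        mem_compl_iff, mem_ofPred_eq, cdf_eq_real]
      tauto
    · simp only [mem_preimage, mem_Iic, mem_union, mem_inter_iff, hu, mem_compl_iff, mem_ofPred_eq]
      simp [quantile, hu]
  rw [hset]
  have hcdf : Measurable fun a => (μ a).real (Iic q) :=
    ((Measure.measurable_coe measurableSet_Iic).comp hμ).ennreal_toReal
  exact ((measurable_snd measurableSet_Ioo).inter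
    (measurableSet_le measurable_snd (hcdf.comp measurable_fst))).union
    ((measurable_snd measurableSet_Ioo.compl).inter (.const _))

lemma measurable_quantile_right (μ : Measure ℝ) [IsProbabilityMeasure μ] :
    Measurable (quantile μ) :=
  (measurable_quantile (A := Unit) (μ := fun _ => μ) measurable_const).comp
    (measurable_const (a := ()).prodMk measurable_id)

lemma ae_mem_Ioo_zero_one : ∀ᵐ u ∂(volume.restrict (Icc (0 : ℝ) 1)), u ∈ Ioo (0 : ℝ) 1 := by
  rw [← Measure.restrict_congr_set Ioo_ae_eq_Icc]
  exact ae_restrict_mem measurableSet_Ioo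

instance isProbabilityMeasure_restrict_Icc_zero_one :
    IsProbabilityMeasure (volume.restrict (Icc (0 : ℝ) 1)) :=
  ⟨by simp⟩

lemma map_quantile (μ : Measure ℝ) [IsProbabilityMeasure μ] :
    (volume.restrict (Icc (0 : ℝ) 1)).map (quantile μ) = μ := by
  have := Measure.isProbabilityMeasure_map (μ := volume.restrict (Icc (0 : ℝ) 1))
    (measurable_quantile_right μ).aemeasurable
  refine Measure.ext_of_Iic _ _ fun q => ?_
  rw [Measure.map_apply (measurable_quantile_right μ) measurableSet_Iic, ← ofReal_cdf]
  have hcongr : quantile μ ⁻¹' Iic q =ᵐ[volume.restrict (Icc (0 : ℝ) 1)] Iic (cdf μ q) := by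
    filter_upwards [ae_mem_Ioo_zero_one] with u hu
    exact propext (quantile_le_iff μ hu q)
  rw [measure_congr hcongr, Measure.restrict_apply measurableSet_Iic]
  have hIcc : Iic (cdf μ q) ∩ Icc 0 1 = Icc 0 (cdf μ q) := by
    ext u
    have := cdf_le_one μ q
    simp only [mem_inter_iff, mem_Iic, mem_Icc]
    constructor
    · rintro ⟨h, h0, -⟩
      exact ⟨h0, h⟩
    · rintro ⟨h0, h⟩
      exact ⟨h, h0, h.trans this⟩
  rw [hIcc, Real.volume_Icc, sub_zero]

/-- Convergence of distribution functions at continuity points gives almost sure convergence of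
the quantile functions. -/
lemma ae_tendsto_quantile {μs : ℕ → Measure ℝ} {μ : Measure ℝ} [IsProbabilityMeasure μ]
    (h : ∀ q, μ {q} = 0 → Tendsto (fun n => cdf (μs n) q) atTop (𝓝 (cdf μ q))) :
    ∀ᵐ u ∂(volume.restrict (Icc (0 : ℝ) 1)),
      Tendsto (fun n => quantile (μs n) u) atTop (𝓝 (quantile μ u)) := by
  have hdense : Dense {q | μ {q} = 0} := by
    have hc : {q : ℝ | 0 < μ {q}}.Countable := by
      simpa using! Measure.countable_meas_level_set_pos (μ := μ) (measurable_id (α := ℝ))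
    convert hc.dense_compl ℝ using 1
    ext q
    simp
  have hflat : ∀ᵐ u ∂(volume.restrict (Icc (0 : ℝ) 1)), u ∉ range fun q : ℚ => cdf μ q :=
    ae_restrict_of_ae ((countable_range _).ae_notMem _)
  filter_upwards [ae_mem_Ioo_zero_one, hflat] with u hu hflat
  refine tendsto_order.2 ⟨fun a ha => ?_, fun b hb => ?_⟩
  · obtain ⟨q, hq, haq, hqu⟩ := hdense.exists_between ha
    rw [← not_le, quantile_le_iff _ hu, not_le] at hqu
    filter_upwards [(h q hq).eventually_lt_const hqu] with n hn
    refine haq.trans ?_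
    rwa [← not_le, quantile_le_iff _ hu, not_le]
  · obtain ⟨q, hq, huq, hqb⟩ := hdense.exists_between hb
    obtain ⟨p, hup, hpq⟩ := exists_rat_btwn huq
    have hlt : u < cdf μ q := by
      refine lt_of_lt_of_le (lt_of_le_of_ne ?_ fun he => hflat ⟨p, he.symm⟩)
        (monotone_cdf μ hpq.le)
      exact (quantile_le_iff _ hu _).1 hup.le
    filter_upwards [(h q hq).eventually_const_lt hlt] with n hn
    exact ((quantile_le_iff _ hu _).2 hn.le).trans_lt hqb

/-- The Borel σ-algebra of the weak topology makes evaluation of measures measurable. -/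
lemma measurable_toMeasure_borel {E : Type*} [TopologicalSpace E] [PseudoMetrizableSpace E]
    [MeasurableSpace E] [BorelSpace E] :
    Measurable[borel (ProbabilityMeasure E)]
      (fun α : ProbabilityMeasure E => (α : Measure E)) := by
  let : MeasurableSpace (ProbabilityMeasure E) := borel (ProbabilityMeasure E)
  have : BorelSpace (ProbabilityMeasure E) := ⟨rfl⟩
  refine Measurable.measure_of_isPiSystem_of_isProbabilityMeasure
    (BorelSpace.measurable_eq.trans borel_eq_generateFrom_isClosed) isPiSystem_isClosed
    fun F hF => ?_
  refine measurable_of_tendsto_metrizable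
    (f := fun n (α : ProbabilityMeasure E) => ∫⁻ x, hF.apprSeq n x ∂(α : Measure E))
    (fun n => ?_) (tendsto_pi_nhds.2 fun α => ?_)
  · exact (ProbabilityMeasure.continuous_lintegral_boundedContinuousFunction _).measurable
  · exact HasOuterApproxClosed.tendsto_lintegral_apprSeq hF (α : Measure E)

section RealCode

variable {E : Type*} [MetricSpace E] [SeparableSpace E] [Nonempty E]

/-- The centre and radius shift of the `j`-th ball used to code points of `E`. -/
def ballIndex : ℕ ≃ ℕ × ℚ := (Denumerable.eqv (ℕ × ℚ)).symm

/-- The sequence of bits telling which balls around a dense sequence, with radii in `r + ℚ`,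
contain `x`. -/
def ballCode (r : ℝ) (x : E) (j : ℕ) : Bool :=
  open Classical in decide (dist x (denseSeq E (ballIndex j).1) < r + (ballIndex j).2)

lemma ballCode_eq_true_iff (r : ℝ) (x : E) (j : ℕ) :
    ballCode r x j = true ↔ dist x (denseSeq E (ballIndex j).1) < r + (ballIndex j).2 := by
  simp [ballCode]

/-- The Cantor space as a subset of the real line. -/
def cantorToReal (b : ℕ → Bool) : ℝ := (cantorSetHomeomorphNatToBool.symm b : cantorSet)

lemma isEmbedding_cantorToReal : IsEmbedding cantorToReal :=
  IsEmbedding.subtypeVal.comp cantorSetHomeomorphNatToBool.symm.isEmbedding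

attribute [irreducible] cantorToReal

/-- The bit sequence `ballCode r x` read as a real number. -/
def realCode (r : ℝ) (x : E) : ℝ := cantorToReal (ballCode r x)

lemma tendsto_of_tendsto_realCode {ι : Type*} {l : Filter ι} {r : ℝ} {y : ι → E} {x : E}
    (h : Tendsto (fun i => realCode r (y i)) l (𝓝 (realCode r x))) : Tendsto y l (𝓝 x) := by
  have hcode : Tendsto (fun i => ballCode r (y i)) l (𝓝 (ballCode r x)) :=
    isEmbedding_cantorToReal.tendsto_nhds_iff.2 h
  refine Metric.tendsto_nhds.2 fun ε hε => ?_
  obtain ⟨q, hq, hqε⟩ := exists_rat_btwn (show -r < -r + ε / 2 by linarith)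
  obtain ⟨k, hk⟩ := (denseRange_denseSeq E).exists_dist_lt x (show 0 < r + q by linarith)
  obtain ⟨j, hj⟩ := ballIndex.surjective (k, q)
  have hx : ballCode r x j = true := by
    rw [ballCode_eq_true_iff, hj]
    exact hk
  have hev := tendsto_pi_nhds.1 hcode j
  rw [hx, nhds_discrete, tendsto_pure] at hev
  filter_upwards [hev] with i hi
  rw [ballCode_eq_true_iff, hj] at hi
  have := dist_triangle_right (y i) x (denseSeq E k)
  simp only at hi
  linarith

lemma injective_realCode (r : ℝ) : Function.Injective (realCode r : E → ℝ) := fun x y h =>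
  tendsto_const_nhds_iff.1 (tendsto_of_tendsto_realCode (l := (pure () : Filter Unit)) (r := r)
    (by rw [h]; exact tendsto_const_nhds))

lemma measurable_realCode [MeasurableSpace E] [BorelSpace E] :
    Measurable fun p : ℝ × E => realCode p.1 p.2 := by
  refine isEmbedding_cantorToReal.continuous.measurable.comp (measurable_pi_iff.2 fun j => ?_)
  refine measurable_to_bool ?_
  have hset : (fun p : ℝ × E => ballCode p.1 p.2 j) ⁻¹' {true} =
      {p | dist p.2 (denseSeq E (ballIndex j).1) < p.1 + (ballIndex j).2} := by
    ext p
    exact ballCode_eq_true_iff _ _ _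
  rw [hset]
  exact (isOpen_lt (by fun_prop) (by fun_prop)).measurableSet

lemma measurable_realCode_right [MeasurableSpace E] [BorelSpace E] (r : ℝ) :
    Measurable (realCode r : E → ℝ) := by
  have h : Measurable fun x : E => (r, x) := measurable_prodMk_left
  exact measurable_realCode.comp h

lemma continuousAt_realCode {r : ℝ} {x : E}
    (hx : ∀ (k : ℕ) (q : ℚ), dist x (denseSeq E k) ≠ r + q) : ContinuousAt (realCode r) x := by
  refine isEmbedding_cantorToReal.continuous.continuousAt.comp (continuousAt_pi.2 fun j => ?_)
  refine tendsto_nhds_of_eventually_eq ?_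
  rcases (hx (ballIndex j).1 (ballIndex j).2).lt_or_gt with h | h
  · have hnear := ContinuousAt.eventually_lt (x₀ := x)
      (f := fun y => dist y (denseSeq E (ballIndex j).1)) (by fun_prop) continuousAt_const h
    filter_upwards [hnear] with y hy
    rw [(ballCode_eq_true_iff r x j).2 h]
    exact (ballCode_eq_true_iff r y j).2 hy
  · have hnear := ContinuousAt.eventually_lt (x₀ := x)
      (g := fun y => dist y (denseSeq E (ballIndex j).1)) continuousAt_const (by fun_prop) h
    filter_upwards [hnear] with y hy
    rw [Bool.eq_iff_iff, ballCode_eq_true_iff, ballCode_eq_true_iff]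
    exact iff_of_false hy.not_gt h.not_gt

variable [MeasurableSpace E] [BorelSpace E]

lemma ae_ae_continuousAt_realCode (μ : Measure E) [SFinite μ] :
    ∀ᵐ r : ℝ, ∀ᵐ x ∂μ, ContinuousAt (realCode r) x := by
  have hsphere : ∀ᵐ r : ℝ, ∀ (k : ℕ) (q : ℚ), μ {x | dist x (denseSeq E k) = r + q} = 0 := by
    refine ae_all_iff.2 fun k => ae_all_iff.2 fun q => ?_
    have hc := Measure.countable_meas_level_set_pos (μ := μ)
      (g := fun x => dist x (denseSeq E k)) (by fun_prop)
    have hc' := hc.preimage (add_left_injective (q : ℝ))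
    filter_upwards [hc'.ae_notMem volume] with r hr
    simpa using hr
  filter_upwards [hsphere] with r hr
  have : ∀ᵐ x ∂μ, ∀ (k : ℕ) (q : ℚ), dist x (denseSeq E k) ≠ r + q :=
    ae_all_iff.2 fun k => ae_all_iff.2 fun q => by simpa [ae_iff] using hr k q
  filter_upwards [this] with x hx using continuousAt_realCode hx

/-- Weak convergence is preserved, at the level of distribution functions, by maps that are
continuous almost everywhere. -/
lemma tendsto_cdf_map {X : Type*} [TopologicalSpace X] [MeasurableSpace X]
    [HasOuterApproxClosed X] [OpensMeasurableSpace X] {ι : Type*} {l : Filter ι}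
    {αs : ι → ProbabilityMeasure X} {α : ProbabilityMeasure X} (hα : Tendsto αs l (𝓝 α))
    {f : X → ℝ} (hf : Measurable f) (hcont : ∀ᵐ x ∂(α : Measure X), ContinuousAt f x) {q : ℝ}
    (hq : (α : Measure X).map f {q} = 0) :
    Tendsto (fun n => cdf ((αs n : Measure X).map f) q) l (𝓝 (cdf ((α : Measure X).map f) q)) := by
  have hprob (β : ProbabilityMeasure X) : IsProbabilityMeasure ((β : Measure X).map f) :=
    Measure.isProbabilityMeasure_map hf.aemeasurable
  have hcdf (β : ProbabilityMeasure X) :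
      cdf ((β : Measure X).map f) q = ((β : Measure X) (f ⁻¹' Iic q)).toReal := by
    rw [cdf_eq_real, Measure.real, Measure.map_apply hf measurableSet_Iic]
  simp only [hcdf]
  refine (ENNReal.tendsto_toReal (measure_ne_top _ _)).comp
    (ProbabilityMeasure.tendsto_measure_of_null_frontier_of_tendsto' hα ?_)
  rw [Measure.map_apply hf (measurableSet_singleton q)] at hq
  refine measure_mono_null_ae ?_ hq
  filter_upwards [hcont] with x hx hfr
  change f x = q
  by_contra hne
  rcases lt_or_gt_of_ne hne with h | h
  · refine hfr.2 (mem_interior_iff_mem_nhds.2 ?_)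
    filter_upwards [hx.eventually_lt_const h] with y hy using hy.le
  · obtain ⟨y, hy, hyq⟩ := (mem_closure_iff_frequently.1 hfr.1).and_eventually
      (hx.eventually_const_lt h) |>.exists
    exact hyq.not_ge hy

end RealCode

section Representation

variable {E : Type*} [MetricSpace E] [PolishSpace E] [Nonempty E] [MeasurableSpace E] [BorelSpace E]

lemma exists_measurable_leftInverse_realCode :
    ∃ G : ℝ × ℝ → E, Measurable G ∧ ∀ r x, G (r, realCode r x) = x := by
  have hmeas : Measurable fun p : ℝ × E => (p.1, realCode p.1 p.2) :=
    measurable_fst.prodMk measurable_realCode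
  have hinj : Function.Injective fun p : ℝ × E => (p.1, realCode p.1 p.2) := by
    rintro ⟨r, x⟩ ⟨s, y⟩ h
    simp only [Prod.mk.injEq] at h
    obtain ⟨rfl, h⟩ := h
    rw [injective_realCode r h]
  obtain ⟨G, hG, hGH⟩ := (hmeas.measurableEmbedding hinj).exists_measurable_extend
    measurable_snd fun _ => inferInstance
  exact ⟨G, hG, fun r x => congrFun hGH (r, x)⟩

lemma measurable_map_realCode {A : Type*} [MeasurableSpace A] {ν : A → Measure E}
    [∀ a, IsProbabilityMeasure (ν a)] (hν : Measurable ν) :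
    Measurable fun p : A × ℝ => (ν p.1).map (realCode p.2) := by
  refine Measure.measurable_of_measurable_coe _ fun s hs => ?_
  let κ : Kernel (A × ℝ) E := ⟨fun p => ν p.1, hν.comp measurable_fst⟩
  have : IsMarkovKernel κ := ⟨fun p => inferInstanceAs (IsProbabilityMeasure (ν p.1))⟩
  have hpre : MeasurableSet {p : (A × ℝ) × E | realCode p.1.2 p.2 ∈ s} :=
    (measurable_realCode.comp (measurable_fst.snd.prodMk measurable_snd)) hs
  convert Kernel.measurable_kernel_prodMk_left (κ := κ) hpre using 2 with p
  exact Measure.map_apply (measurable_realCode_right p.2) hs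

variable {G : ℝ × ℝ → E}

lemma map_quantile_map_realCode (hG : Measurable G) (hGr : ∀ r x, G (r, realCode r x) = x)
    (μ : Measure E) [IsProbabilityMeasure μ] (r : ℝ) :
    (volume.restrict (Icc (0 : ℝ) 1)).map (fun u => G (r, quantile (μ.map (realCode r)) u)) = μ := by
  have := Measure.isProbabilityMeasure_map (μ := μ) (measurable_realCode_right r).aemeasurable
  have hGm : Measurable fun y => G (r, y) := hG.comp measurable_prodMk_left
  change Measure.map ((fun y => G (r, y)) ∘ quantile (μ.map (realCode r))) _ = μ
  rw [← Measure.map_map hGm (measurable_quantile_right _), map_quantile,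
    Measure.map_map hGm (measurable_realCode_right r)]
  convert Measure.map_id
  ext x
  exact hGr r x

lemma ae_realCode_quantile (hG : Measurable G) (hGr : ∀ r x, G (r, realCode r x) = x)
    (μ : Measure E) [IsProbabilityMeasure μ] (r : ℝ) :
    ∀ᵐ u ∂(volume.restrict (Icc (0 : ℝ) 1)),
      realCode r (G (r, quantile (μ.map (realCode r)) u)) = quantile (μ.map (realCode r)) u := by
  have := Measure.isProbabilityMeasure_map (μ := μ) (measurable_realCode_right r).aemeasurable
  have hae : ∀ᵐ y ∂(μ.map (realCode r)), realCode r (G (r, y)) = y := by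
    rw [ae_map_iff (measurable_realCode_right r).aemeasurable]
    · simp [hGr]
    · exact measurableSet_eq_fun
        ((measurable_realCode_right r).comp (hG.comp measurable_prodMk_left)) measurable_id
  nth_rw 1 [← map_quantile (μ.map (realCode r))] at hae
  exact ae_of_ae_map (measurable_quantile_right _).aemeasurable hae

lemma ae_ae_tendsto_quantile_realCode (hG : Measurable G)
    (hGr : ∀ r x, G (r, realCode r x) = x) {αs : ℕ → ProbabilityMeasure E}
    {α : ProbabilityMeasure E} (hα : Tendsto αs atTop (𝓝 α)) :
    ∀ᵐ r : ℝ, ∀ᵐ u ∂(volume.restrict (Icc (0 : ℝ) 1)),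
      Tendsto (fun n => G (r, quantile ((αs n : Measure E).map (realCode r)) u)) atTop
        (𝓝 (G (r, quantile ((α : Measure E).map (realCode r)) u))) := by
  filter_upwards [ae_ae_continuousAt_realCode (α : Measure E)] with r hr
  have := Measure.isProbabilityMeasure_map (μ := (α : Measure E))
    (measurable_realCode_right r).aemeasurable
  filter_upwards [ae_tendsto_quantile
      fun q hq => tendsto_cdf_map hα (measurable_realCode_right r) hr hq,
    ae_realCode_quantile hG hGr (α : Measure E) r,
    ae_all_iff.2 fun n => ae_realCode_quantile hG hGr (αs n : Measure E) r] with u hu hu0 hun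
  refine tendsto_of_tendsto_realCode (r := r) ?_
  rw [hu0]
  simpa only [hun] using hu

end Representation

lemma exists_measurable_map_Icc_eq {Y : Type*} [MeasurableSpace Y] [StandardBorelSpace Y]
    (μ : Measure Y) [IsProbabilityMeasure μ] :
    ∃ g : ℝ → Y, Measurable g ∧ (volume.restrict (Icc (0 : ℝ) 1)).map g = μ := by
  have : Nonempty Y := nonempty_of_isProbabilityMeasure μ
  obtain ⟨f, hf, hfμ⟩ := μ.exists_measurable_map_eq
  have hproj : Measurable (projIcc (0 : ℝ) 1 zero_le_one) := continuous_projIcc.measurable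
  refine ⟨f ∘ projIcc 0 1 zero_le_one, hf.comp hproj, ?_⟩
  rw [← unitInterval.measurePreserving_coe.map_eq,
    Measure.map_map (hf.comp hproj) measurable_subtype_coe, ← hfμ]
  congr 1
  ext x
  simp

/-- Blackwell–Dubins: for a Polish space `E` there is a Borel measurable function
`h : M × [0,1] → E` (where `M` is the space of Borel probability measures on `E`, with the
Borel σ-algebra of the weak* topology) such that `h(α,·)` pushes Lebesgue measure on `[0,1]`
forward to `α`, and `α_n → α` weak* implies `h(α_n,t) → h(α,t)` for Lebesgue-almost every
`t ∈ [0,1]`. -/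
theorem blackwell_dubins
    {E : Type*} [TopologicalSpace E] [PolishSpace E] [MeasurableSpace E] [BorelSpace E] :
    letI : MeasurableSpace (ProbabilityMeasure E) := borel (ProbabilityMeasure E)
    ∃ h : ProbabilityMeasure E → ℝ → E,
      Measurable (Function.uncurry h) ∧
      (∀ α : ProbabilityMeasure E,
        (volume.restrict (Set.Icc (0:ℝ) 1)).map (h α) = (α : Measure E)) ∧
      (∀ (αs : ℕ → ProbabilityMeasure E) (α : ProbabilityMeasure E),
        Tendsto αs atTop (nhds α) →
        ∀ᵐ t ∂(volume.restrict (Set.Icc (0:ℝ) 1)),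
          Tendsto (fun n => h (αs n) t) atTop (nhds (h α t))) := by
  let : MeasurableSpace (ProbabilityMeasure E) := borel (ProbabilityMeasure E)
  cases isEmpty_or_nonempty E
  · have : IsEmpty (ProbabilityMeasure E) := ⟨fun α => isEmptyElim α.nonempty.some⟩
    exact ⟨isEmptyElim, measurable_of_empty _, isEmptyElim, fun _ α => isEmptyElim α⟩
  let : MetricSpace E := metrizableSpaceMetric E
  obtain ⟨G, hG, hGr⟩ := exists_measurable_leftInverse_realCode (E := E)
  obtain ⟨g, hg, hgmap⟩ := exists_measurable_map_Icc_eq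
    ((volume.restrict (Icc (0 : ℝ) 1)).prod (volume.restrict (Icc (0 : ℝ) 1)))
  have hprob (p : ProbabilityMeasure E × ℝ) :
      IsProbabilityMeasure ((p.1 : Measure E).map (realCode p.2)) :=
    Measure.isProbabilityMeasure_map (measurable_realCode_right p.2).aemeasurable
  let H (α : ProbabilityMeasure E) (p : ℝ × ℝ) : E :=
    G (p.1, quantile ((α : Measure E).map (realCode p.1)) p.2)
  have hH : Measurable (Function.uncurry H) := by
    have hq := (measurable_quantile (measurable_map_realCode
      (measurable_toMeasure_borel (E := E)))).comp
      ((measurable_fst.prodMk measurable_snd.fst).prodMk measurable_snd.snd :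
        Measurable fun p : ProbabilityMeasure E × ℝ × ℝ => ((p.1, p.2.1), p.2.2))
    exact hG.comp (measurable_snd.fst.prodMk hq)
  have hHα (α : ProbabilityMeasure E) : Measurable (H α) := hH.comp measurable_prodMk_left
  refine ⟨fun α t => H α (g t), hH.comp (measurable_fst.prodMk (hg.comp measurable_snd)),
    fun α => ?_, fun αs α hα => ?_⟩
  · change Measure.map (H α ∘ g) _ = _
    rw [← Measure.map_map (hHα α) hg, hgmap]
    ext s hs
    rw [Measure.map_apply (hHα α) hs, Measure.prod_apply (hHα α hs)]
    have hfib (r : ℝ) : volume.restrict (Icc (0 : ℝ) 1) (Prod.mk r ⁻¹' (H α ⁻¹' s)) =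
        (α : Measure E) s := by
      conv_rhs => rw [← map_quantile_map_realCode hG hGr (α : Measure E) r]
      exact (Measure.map_apply ((hHα α).comp measurable_prodMk_left) hs).symm
    simp [hfib]
  · have hae : ∀ᵐ p ∂((volume.restrict (Icc (0 : ℝ) 1)).prod (volume.restrict (Icc (0 : ℝ) 1))),
        Tendsto (fun n => H (αs n) p) atTop (𝓝 (H α p)) :=
      (Measure.ae_prod_iff_ae_ae (measurableSet_tendsto_fun (fun n => hHα _) (hHα α))).2
        (ae_restrict_of_ae (ae_ae_tendsto_quantile_realCode hG hGr hα))
    rw [← hgmap] at hae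
    exact ae_of_ae_map hg.aemeasurable hae
end
end

section
/- Let (Ω,F,P) be a probability space and A ⊆ F a sub-σ-algebra. There exists a random variable U : Ω → [0,1], uniformly distributed on [0,1] and independent of A, if and only if F is atomless conditionally to A. -/
open MeasureTheory ProbabilityTheory Filter Set
open scoped ENNReal

noncomputable section

section CondProb

variable {Ω : Type*} {m m0 : MeasurableSpace Ω} {P : Measure Ω}

/-- The conditional probability of `B` integrates over `D` to the probability of `B ∩ D`. -/
lemma setIntegral_condExp_indicator_one [IsFiniteMeasure P] (hm : m ≤ m0) {B D : Set Ω}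
    (hB : MeasurableSet B) (hD : MeasurableSet[m] D) :
    ∫ ω in D, (P[B.indicator (fun _ => (1 : ℝ)) | m]) ω ∂P = P.real (B ∩ D) := by
  rw [setIntegral_condExp hm ((integrable_const _).indicator hB) hD, integral_indicator hB,
    setIntegral_const]
  simp [Measure.real, Measure.restrict_apply hB]

/-- A family of sets that is stable under increasing countable unions has an element
that is maximal for the measure. -/
lemma exists_maximal_measure_of_iUnion_mem [IsFiniteMeasure P] (F : Set (Set Ω))
    (hne : F.Nonempty)
    (hU : ∀ B : ℕ → Set Ω, (∀ n, B n ∈ F) → Monotone B → (⋃ n, B n) ∈ F) :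
    ∃ B ∈ F, ∀ B' ∈ F, B ⊆ B' → P.real B' ≤ P.real B := by
  have step : ∀ B : F, ∃ B' : F, (B : Set Ω) ⊆ B' ∧ ∀ E ∈ F, (B : Set Ω) ⊆ E →
      P.real E - P.real B ≤ 2 * (P.real (B' : Set Ω) - P.real B) := by
    rintro ⟨B, hB⟩
    set S : Set ℝ := {x | ∃ E ∈ F, B ⊆ E ∧ x = P.real E} with hS
    have hbdd : BddAbove S := by
      refine ⟨P.real univ, ?_⟩
      rintro x ⟨E, -, -, rfl⟩
      exact measureReal_mono (subset_univ _)
    have hBS : P.real B ∈ S := ⟨B, hB, subset_rfl, rfl⟩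
    rcases (le_csSup hbdd hBS).eq_or_lt with h | h
    · refine ⟨⟨B, hB⟩, subset_rfl, fun E hE hBE => ?_⟩
      have := le_csSup hbdd (show P.real E ∈ S from ⟨E, hE, hBE, rfl⟩)
      simp only at *
      linarith
    · obtain ⟨x, ⟨B', hB', hBB', rfl⟩, hx⟩ := exists_lt_of_lt_csSup ⟨_, hBS⟩
        (show (P.real B + sSup S) / 2 < sSup S by linarith)
      refine ⟨⟨B', hB'⟩, hBB', fun E hE hBE => ?_⟩
      have := le_csSup hbdd (show P.real E ∈ S from ⟨E, hE, hBE, rfl⟩)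
      simp only at *
      linarith
  choose next hsub hnext using step
  obtain ⟨B₀, hB₀⟩ := hne
  let B : ℕ → F := fun n => next^[n] ⟨B₀, hB₀⟩
  have hB : ∀ n, B (n + 1) = next (B n) := fun n => Function.iterate_succ_apply' _ _ _
  have hmono : Monotone fun n => (B n : Set Ω) :=
    monotone_nat_of_le_succ fun n => by rw [hB]; exact hsub _
  refine ⟨⋃ n, (B n : Set Ω), hU _ (fun n => (B n).2) hmono, fun E hE hsubE => ?_⟩
  by_contra! hlt
  set δ := P.real E - P.real (⋃ n, (B n : Set Ω)) with hδ
  have hδ0 : 0 < δ := by linarith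
  have hgrow : ∀ n : ℕ, n * (δ / 2) ≤ P.real (B n : Set Ω) := by
    intro n
    induction n with
    | zero => simp
    | succ n ih =>
      have h1 := hnext (B n) E hE ((subset_iUnion (fun n => (B n : Set Ω)) n).trans hsubE)
      have h2 : P.real (B n : Set Ω) ≤ P.real (⋃ n, (B n : Set Ω)) :=
        measureReal_mono (subset_iUnion (fun n => (B n : Set Ω)) n)
      rw [hB]
      push_cast
      linarith
  obtain ⟨n, hn⟩ := exists_nat_gt (P.real univ / (δ / 2))
  rw [div_lt_iff₀ (by positivity)] at hn
  have := measureReal_mono (μ := P) (subset_univ (B n : Set Ω))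
  linarith [hgrow n]

/-- `F` is atomless conditionally to the sub-σ-algebra `m`. -/
def CondAtomless (m : MeasurableSpace Ω) [MeasurableSpace Ω] (P : Measure Ω) : Prop :=
  ∀ A : Set Ω, MeasurableSet A → 0 < P A →
    ∃ B : Set Ω, B ⊆ A ∧ MeasurableSet B ∧
      0 < P {ω | 0 < (P[B.indicator (fun _ => (1 : ℝ)) | m]) ω ∧
                 (P[B.indicator (fun _ => (1 : ℝ)) | m]) ω <
                   (P[A.indicator (fun _ => (1 : ℝ)) | m]) ω}

lemma setIntegral_pos_of_forall_pos {D : Set Ω} {f : Ω → ℝ} (hD : MeasurableSet D)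
    (hf : Integrable f P) (hpos : ∀ ω ∈ D, 0 < f ω) (hPD : 0 < P D) :
    0 < ∫ ω in D, f ω ∂P := by
  rw [setIntegral_pos_iff_support_of_nonneg_ae
    ((ae_restrict_iff' hD).2 (ae_of_all _ fun ω h => (hpos ω h).le)) hf.integrableOn]
  refine hPD.trans_le (measure_mono fun ω h => ⟨(hpos ω h).ne', h⟩)

lemma measureReal_pos_of_measure_pos [IsFiniteMeasure P] {s : Set Ω} (h : 0 < P s) :
    0 < P.real s :=
  ENNReal.toReal_pos h.ne' (measure_ne_top _ _)

lemma measure_pos_of_measureReal_pos {s : Set Ω} (h : 0 < P.real s) : 0 < P s :=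
  (ENNReal.toReal_pos_iff.1 h).1

lemma CondAtomless.exists_subset_le_half [IsProbabilityMeasure P] (hm : m ≤ m0)
    (h : CondAtomless m P) {A : Set Ω} (hA : MeasurableSet A) (hPA : 0 < P A) :
    ∃ B ⊆ A, MeasurableSet B ∧ 0 < P B ∧
      ∀ D, MeasurableSet[m] D → P.real (B ∩ D) ≤ 1 / 2 * P.real (A ∩ D) := by
  obtain ⟨B, hBA, hB, hpos⟩ := h A hA hPA
  set f := P[B.indicator (fun _ => (1 : ℝ)) | m] with hf
  set g := P[A.indicator (fun _ => (1 : ℝ)) | m] with hg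
  have hfm : Measurable[m] f := stronglyMeasurable_condExp.measurable
  have hgm : Measurable[m] g := stronglyMeasurable_condExp.measurable
  have hfi : Integrable f P := integrable_condExp
  have hgi : Integrable g P := integrable_condExp
  have hD₀ : MeasurableSet[m] {ω | 0 < f ω ∧ f ω < g ω} :=
    (measurableSet_lt measurable_const hfm).inter (measurableSet_lt hfm hgm)
  have hhalf : MeasurableSet[m] {ω | f ω ≤ 1 / 2 * g ω} :=
    measurableSet_le hfm (hgm.const_mul _)
  set D₁ := {ω | 0 < f ω ∧ f ω < g ω} ∩ {ω | f ω ≤ 1 / 2 * g ω} with hD₁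
  set D₂ := {ω | 0 < f ω ∧ f ω < g ω} \ {ω | f ω ≤ 1 / 2 * g ω} with hD₂
  have hD₁m : MeasurableSet[m] D₁ := hD₀.inter hhalf
  have hD₂m : MeasurableSet[m] D₂ := hD₀.diff hhalf
  have hfint : ∀ D, MeasurableSet[m] D → ∫ ω in D, f ω ∂P = P.real (B ∩ D) :=
    fun D hD => setIntegral_condExp_indicator_one hm hB hD
  have hgint : ∀ D, MeasurableSet[m] D → ∫ ω in D, g ω ∂P = P.real (A ∩ D) :=
    fun D hD => setIntegral_condExp_indicator_one hm hA hD
  have hdiff : ∀ D, MeasurableSet[m] D →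
      P.real ((A \ B) ∩ D) = ∫ ω in D, (g ω - f ω) ∂P := by
    intro D hD
    rw [integral_sub hgi.integrableOn hfi.integrableOn, hfint D hD, hgint D hD,
      ← measureReal_sdiff (inter_subset_inter_left _ hBA) (hB.inter (hm _ hD))]
    congr 1
    ext ω
    simp only [mem_inter_iff, Set.mem_sdiff]
    tauto
  by_cases h1 : 0 < P D₁
  · refine ⟨B ∩ D₁, inter_subset_left.trans hBA, hB.inter (hm _ hD₁m), ?_, fun D hD => ?_⟩
    · have : 0 < P.real (B ∩ D₁) := by
        rw [← hfint _ hD₁m]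
        exact setIntegral_pos_of_forall_pos (hm _ hD₁m) hfi (fun ω h => h.1.1) h1
      exact measure_pos_of_measureReal_pos this
    · calc P.real (B ∩ D₁ ∩ D) = ∫ ω in D₁ ∩ D, f ω ∂P := by
            rw [hfint _ (hD₁m.inter hD), inter_assoc]
        _ ≤ ∫ ω in D₁ ∩ D, 1 / 2 * g ω ∂P :=
            setIntegral_mono_on hfi.integrableOn (hgi.const_mul _).integrableOn
              (hm _ (hD₁m.inter hD)) fun ω h => h.1.2
        _ = 1 / 2 * P.real (A ∩ (D₁ ∩ D)) := by
            rw [integral_const_mul, hgint _ (hD₁m.inter hD)]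
        _ ≤ 1 / 2 * P.real (A ∩ D) := by
            gcongr
            · exact measure_ne_top _ _
            · exact inter_subset_right
  · have h2 : 0 < P D₂ := by
      have h1' : P D₁ = 0 := by simpa using h1
      have := measure_inter_add_sdiff (μ := P) {ω | 0 < f ω ∧ f ω < g ω} (hm _ hhalf)
      rw [← hD₁, ← hD₂, h1', zero_add] at this
      rwa [this]
    refine ⟨(A \ B) ∩ D₂, inter_subset_left.trans sdiff_subset,
      (hA.diff hB).inter (hm _ hD₂m), ?_, fun D hD => ?_⟩
    · have : 0 < P.real ((A \ B) ∩ D₂) := by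
        rw [hdiff _ hD₂m]
        exact setIntegral_pos_of_forall_pos (hm _ hD₂m) (hgi.sub hfi)
          (fun ω h => sub_pos.2 h.1.2) h2
      exact measure_pos_of_measureReal_pos this
    · calc P.real ((A \ B) ∩ D₂ ∩ D) = ∫ ω in D₂ ∩ D, (g ω - f ω) ∂P := by
            rw [inter_assoc, hdiff _ (hD₂m.inter hD)]
        _ ≤ ∫ ω in D₂ ∩ D, 1 / 2 * g ω ∂P :=
            setIntegral_mono_on (hgi.sub hfi).integrableOn (hgi.const_mul _).integrableOn
              (hm _ (hD₂m.inter hD)) fun ω h => by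
                have := h.1.2
                simp only [mem_ofPred_eq, not_le] at this
                linarith
        _ = 1 / 2 * P.real (A ∩ (D₂ ∩ D)) := by
            rw [integral_const_mul, hgint _ (hD₂m.inter hD)]
        _ ≤ 1 / 2 * P.real (A ∩ D) := by
            gcongr
            · exact measure_ne_top _ _
            · exact inter_subset_right

lemma CondAtomless.exists_subset_le_mul [IsProbabilityMeasure P] (hm : m ≤ m0)
    (h : CondAtomless m P) {A : Set Ω} (hA : MeasurableSet A) (hPA : 0 < P A)
    {ε : ℝ} (hε : 0 < ε) :
    ∃ B ⊆ A, MeasurableSet B ∧ 0 < P B ∧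
      ∀ D, MeasurableSet[m] D → P.real (B ∩ D) ≤ ε * P.real D := by
  have key : ∀ n : ℕ, ∃ B ⊆ A, MeasurableSet B ∧ 0 < P B ∧
      ∀ D, MeasurableSet[m] D → P.real (B ∩ D) ≤ (1 / 2) ^ n * P.real D := by
    intro n
    induction n with
    | zero =>
      refine ⟨A, subset_rfl, hA, hPA, fun D _ => ?_⟩
      rw [pow_zero, one_mul]
      exact measureReal_mono inter_subset_right
    | succ n ih =>
      obtain ⟨B, hBA, hB, hPB, hBD⟩ := ih
      obtain ⟨B', hB'B, hB', hPB', hBD'⟩ := h.exists_subset_le_half hm hB hPB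
      refine ⟨B', hB'B.trans hBA, hB', hPB', fun D hD => ?_⟩
      have := hBD D hD
      have := hBD' D hD
      rw [pow_succ]
      linarith
  obtain ⟨n, hn⟩ := exists_pow_lt_of_lt_one hε (show (1 / 2 : ℝ) < 1 by norm_num)
  obtain ⟨B, hBA, hB, hPB, hBD⟩ := key n
  exact ⟨B, hBA, hB, hPB, fun D hD =>
    (hBD D hD).trans (mul_le_mul_of_nonneg_right hn.le measureReal_nonneg)⟩

lemma CondAtomless.exists_subset_eq_half [IsProbabilityMeasure P] (hm : m ≤ m0)
    (h : CondAtomless m P) {C : Set Ω} (hC : MeasurableSet C) :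
    ∃ B ⊆ C, MeasurableSet B ∧
      ∀ D, MeasurableSet[m] D → P.real (B ∩ D) = 1 / 2 * P.real (C ∩ D) := by
  obtain ⟨B, ⟨hBC, hB, hle⟩, hmax⟩ := exists_maximal_measure_of_iUnion_mem (P := P)
    {B | B ⊆ C ∧ MeasurableSet B ∧
      ∀ D, MeasurableSet[m] D → P.real (B ∩ D) ≤ 1 / 2 * P.real (C ∩ D)}
    ⟨∅, empty_subset _, MeasurableSet.empty, fun D _ => by
      rw [empty_inter, measureReal_empty]; positivity⟩
    (by
      intro B hB hmono
      refine ⟨iUnion_subset fun n => (hB n).1, MeasurableSet.iUnion fun n => (hB n).2.1,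
        fun D hD => ?_⟩
      rw [iUnion_inter]
      have ht : Tendsto (fun n => P.real (B n ∩ D)) atTop (nhds (P.real (⋃ n, B n ∩ D))) :=
        (ENNReal.tendsto_toReal (measure_ne_top _ _)).comp
          (tendsto_measure_iUnion_atTop fun i j hij => inter_subset_inter_left _ (hmono hij))
      exact le_of_tendsto' ht fun n => (hB n).2.2 D hD)
  refine ⟨B, hBC, hB, fun D₀ hD₀ => (hle D₀ hD₀).antisymm ?_⟩
  by_contra! hlt
  set f := P[B.indicator (fun _ => (1 : ℝ)) | m] with hf
  set g := P[C.indicator (fun _ => (1 : ℝ)) | m] with hg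
  have hfm : Measurable[m] f := stronglyMeasurable_condExp.measurable
  have hgm : Measurable[m] g := stronglyMeasurable_condExp.measurable
  have hfi : Integrable f P := integrable_condExp
  have hgi : Integrable g P := integrable_condExp
  have hfint : ∀ D, MeasurableSet[m] D → ∫ ω in D, f ω ∂P = P.real (B ∩ D) :=
    fun D hD => setIntegral_condExp_indicator_one hm hB hD
  have hgint : ∀ D, MeasurableSet[m] D → ∫ ω in D, g ω ∂P = P.real (C ∩ D) :=
    fun D hD => setIntegral_condExp_indicator_one hm hC hD
  obtain ⟨ε, hε, hεlt⟩ : ∃ ε > 0, P.real (B ∩ D₀) + ε < 1 / 2 * P.real (C ∩ D₀) :=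
    ⟨(1 / 2 * P.real (C ∩ D₀) - P.real (B ∩ D₀)) / 2, by linarith, by linarith⟩
  set G := {ω | f ω + ε ≤ 1 / 2 * g ω} with hG
  have hGm : MeasurableSet[m] G := measurableSet_le (hfm.add_const _) (hgm.const_mul _)
  have hfε : Integrable (fun ω => f ω + ε) P := hfi.add (integrable_const _)
  have hg2 : Integrable (fun ω => 1 / 2 * g ω) P := hgi.const_mul _
  have hfεint : ∀ D, MeasurableSet[m] D →
      ∫ ω in D, (f ω + ε) ∂P = P.real (B ∩ D) + ε * P.real D := by
    intro D hD
    rw [integral_add hfi.integrableOn (integrable_const _), hfint D hD, setIntegral_const,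
      smul_eq_mul, mul_comm]
  have hg2int : ∀ D, MeasurableSet[m] D →
      ∫ ω in D, 1 / 2 * g ω ∂P = 1 / 2 * P.real (C ∩ D) := by
    intro D hD
    rw [integral_const_mul, hgint D hD]
  have hGle : ∀ D, MeasurableSet[m] D → D ⊆ G →
      P.real (B ∩ D) + ε * P.real D ≤ 1 / 2 * P.real (C ∩ D) := by
    intro D hD hDG
    rw [← hfεint D hD, ← hg2int D hD]
    exact setIntegral_mono_on hfε.integrableOn hg2.integrableOn (hm _ hD) fun ω hω => hDG hω
  have hPG : 0 < P G := by
    rw [pos_iff_ne_zero]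
    intro h0
    have : 1 / 2 * P.real (C ∩ D₀) ≤ P.real (B ∩ D₀) + ε * P.real D₀ := by
      rw [← hfεint D₀ hD₀, ← hg2int D₀ hD₀]
      refine setIntegral_mono_ae hg2.integrableOn hfε.integrableOn ?_
      filter_upwards [measure_eq_zero_iff_ae_notMem.1 h0] with ω hω
      exact (not_le.1 hω).le
    have h1 : P.real D₀ ≤ 1 := measureReal_le_one
    nlinarith
  have hPA : 0 < P ((C \ B) ∩ G) := by
    have h1 := hGle G hGm subset_rfl
    have h2 : 0 < P.real G := measureReal_pos_of_measure_pos hPG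
    have h3 : P.real (B ∩ G) + P.real ((C \ B) ∩ G) = P.real (C ∩ G) := by
      rw [← measureReal_union _ ((hC.diff hB).inter (hm _ hGm)), ← union_inter_distrib_right,
        union_sdiff_cancel hBC]
      exact disjoint_sdiff_right.mono inter_subset_left inter_subset_left
    have h4 : 0 ≤ P.real (B ∩ G) := measureReal_nonneg
    have : 0 < P.real ((C \ B) ∩ G) := by nlinarith
    exact measure_pos_of_measureReal_pos this
  obtain ⟨E, hEA, hE, hPE, hED⟩ :=
    h.exists_subset_le_mul hm ((hC.diff hB).inter (hm _ hGm)) hPA hε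
  have hdisj : Disjoint B E := disjoint_sdiff_right.mono_right (hEA.trans inter_subset_left)
  have hbig := hmax (B ∪ E) ⟨union_subset hBC (hEA.trans (inter_subset_left.trans sdiff_subset)),
    hB.union hE, fun D hD => by
      have hDm := hm _ hD
      have hGm' := hm _ hGm
      have e1 : P.real ((B ∪ E) ∩ D) = P.real (B ∩ D) + P.real (E ∩ D) := by
        rw [union_inter_distrib_right, measureReal_union
          (hdisj.mono inter_subset_left inter_subset_left) (hE.inter hDm)]
      have e2 : P.real (B ∩ D) = P.real (B ∩ (D ∩ G)) + P.real (B ∩ (D \ G)) := by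
        rw [← measureReal_inter_add_sdiff (s := B ∩ D) hGm', inter_assoc, inter_sdiff_assoc]
      have e3 : P.real (C ∩ D) = P.real (C ∩ (D ∩ G)) + P.real (C ∩ (D \ G)) := by
        rw [← measureReal_inter_add_sdiff (s := C ∩ D) hGm', inter_assoc, inter_sdiff_assoc]
      have e4 : E ∩ D = E ∩ (D ∩ G) := by
        ext ω
        exact ⟨fun h => ⟨h.1, h.2, (hEA h.1).2⟩, fun h => ⟨h.1, h.2.1⟩⟩
      have i1 := hle (D \ G) (hD.diff hGm)
      have i2 := hGle (D ∩ G) (hD.inter hGm) inter_subset_right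
      have i3 := hED (D ∩ G) (hD.inter hGm)
      rw [e1, e2, e3, e4]
      linarith⟩ subset_union_left
  rw [measureReal_union hdisj hE] at hbig
  have : 0 < P.real E := measureReal_pos_of_measure_pos hPE
  linarith

/-- An increasing family of sets indexed by the dyadic numbers `k / 2 ^ n` of `[0, 1]`, whose
conditional probabilities are these numbers. -/
lemma CondAtomless.exists_dyadic_family [IsProbabilityMeasure P] (hm : m ≤ m0)
    (h : CondAtomless m P) :
    ∃ C : ℕ → ℕ → Set Ω, C 0 1 = univ ∧ (∀ n k, MeasurableSet (C n k)) ∧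
      (∀ n, Monotone (C n)) ∧ (∀ n k, C (n + 1) (2 * k) = C n k) ∧
      ∀ n, ∀ k ≤ 2 ^ n, ∀ D, MeasurableSet[m] D →
        P.real (C n k ∩ D) = k / 2 ^ n * P.real D := by
  have hhalf : ∀ C : Set Ω, ∃ B, MeasurableSet C → (B ⊆ C ∧ MeasurableSet B ∧
      ∀ D, MeasurableSet[m] D → P.real (B ∩ D) = 1 / 2 * P.real (C ∩ D)) := by
    intro C
    by_cases hC : MeasurableSet C
    · obtain ⟨B, hB⟩ := h.exists_subset_eq_half hm hC
      exact ⟨B, fun _ => hB⟩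
    · exact ⟨∅, fun h => absurd h hC⟩
  choose H hH using hhalf
  let next : (ℕ → Set Ω) → ℕ → Set Ω := fun c k =>
    if k % 2 = 0 then c (k / 2) else c (k / 2) ∪ H (c (k / 2 + 1) \ c (k / 2))
  let C : ℕ → ℕ → Set Ω := fun n => next^[n] fun k => if k = 0 then ∅ else univ
  have hCs : ∀ n, C (n + 1) = next (C n) := fun n => Function.iterate_succ_apply' _ _ _
  have heven : ∀ n k, C (n + 1) (2 * k) = C n k := by
    intro n k
    rw [hCs]
    simp [next]
  have hodd : ∀ n k, C (n + 1) (2 * k + 1) = C n k ∪ H (C n (k + 1) \ C n k) := by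
    intro n k
    have h1 : (2 * k + 1) % 2 ≠ 0 := by omega
    have h2 : (2 * k + 1) / 2 = k := by omega
    rw [hCs]
    simp only [next, h1, h2, if_false]
  have hmeas : ∀ n k, MeasurableSet (C n k) := by
    intro n
    induction n with
    | zero =>
      intro k
      by_cases hk : k = 0 <;> simp [C, hk]
    | succ n ih =>
      intro k
      obtain ⟨j, rfl | rfl⟩ := Nat.even_or_odd' k
      · rw [heven]; exact ih j
      · rw [hodd]; exact (ih j).union (hH _ ((ih _).diff (ih _))).2.1
  have hmono : ∀ n, Monotone (C n) := by
    intro n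
    induction n with
    | zero =>
      refine monotone_nat_of_le_succ fun k => ?_
      simp [C]
    | succ n ih =>
      refine monotone_nat_of_le_succ fun k => ?_
      obtain ⟨j, rfl | rfl⟩ := Nat.even_or_odd' k
      · rw [heven, hodd]; exact subset_union_left
      · rw [hodd, show 2 * j + 1 + 1 = 2 * (j + 1) by ring, heven]
        exact union_subset (ih (Nat.le_succ j))
          ((hH _ ((hmeas _ _).diff (hmeas _ _))).1.trans sdiff_subset)
  refine ⟨C, by simp [C], hmeas, hmono, heven, fun n => ?_⟩
  induction n with
  | zero =>
    intro k hk D hD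
    have : k = 0 ∨ k = 1 := by simp at hk; omega
    rcases this with rfl | rfl <;> simp [C]
  | succ n ih =>
    intro k hk D hD
    rw [pow_succ] at hk
    obtain ⟨j, rfl | rfl⟩ := Nat.even_or_odd' k
    · rw [heven, ih j (by omega) D hD]
      push_cast
      rw [pow_succ]
      field_simp
    · have hDm := hm _ hD
      obtain ⟨hsub, hHm, hHD⟩ := hH _ ((hmeas n (j + 1)).diff (hmeas n j))
      have hdiff : P.real ((C n (j + 1) \ C n j) ∩ D)
          = P.real (C n (j + 1) ∩ D) - P.real (C n j ∩ D) := by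
        rw [← measureReal_sdiff (inter_subset_inter_left _ (hmono n (Nat.le_succ j)))
          ((hmeas n j).inter hDm)]
        congr 1
        ext ω
        simp only [mem_inter_iff, Set.mem_sdiff]
        tauto
      rw [hodd, union_inter_distrib_right, measureReal_union _ (hHm.inter hDm), hHD D hD, hdiff,
        ih j (by omega) D hD, ih (j + 1) (by omega) D hD]
      · push_cast
        rw [pow_succ]
        field_simp
        ring
      · exact (disjoint_sdiff_right.mono_right hsub).mono inter_subset_left inter_subset_left

lemma CondAtomless.exists_uniform_indep [IsProbabilityMeasure P] (hm : m ≤ m0)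
    (h : CondAtomless m P) :
    ∃ U : Ω → ℝ, Measurable U ∧ P.map U = volume.restrict (Icc (0 : ℝ) 1) ∧
      Indep (MeasurableSpace.comap U inferInstance) m P := by
  obtain ⟨C, hC01, hCm, hCmono, hCs, hCP⟩ := h.exists_dyadic_family hm
  have hCpow : ∀ i n k, C (n + i) (2 ^ i * k) = C n k := by
    intro i n k
    induction i with
    | zero => simp
    | succ i ih => rw [← ih, ← hCs (n + i), ← mul_assoc, pow_succ', add_assoc]
  have hCsub : ∀ n k n' k' : ℕ, (k : ℝ) / 2 ^ n ≤ k' / 2 ^ n' → C n k ⊆ C n' k' := by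
    intro n k n' k' hle
    rw [div_le_div_iff₀ (by positivity) (by positivity)] at hle
    have hle' : k * 2 ^ n' ≤ k' * 2 ^ n := by exact_mod_cast hle
    rw [← hCpow n' n k, ← hCpow n n' k', add_comm n' n]
    exact hCmono _ (by linarith)
  let S : Ω → Set ℝ := fun ω => {x | ∃ n k : ℕ, x = k / 2 ^ n ∧ ω ∈ C n k}
  let U : Ω → ℝ := fun ω => sInf (S ω)
  have h1S : ∀ ω, (1 : ℝ) ∈ S ω := fun ω => ⟨0, 1, by simp, by simp [hC01]⟩
  have hbdd : ∀ ω, BddBelow (S ω) := fun ω => ⟨0, by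
    rintro x ⟨n, k, rfl, -⟩
    positivity⟩
  have hU0 : ∀ ω, 0 ≤ U ω := fun ω => le_csInf ⟨1, h1S ω⟩ (by
    rintro x ⟨n, k, rfl, -⟩
    positivity)
  have hU1 : ∀ ω, U ω ≤ 1 := fun ω => csInf_le (hbdd ω) (h1S ω)
  have hUle : ∀ n k, ∀ ω ∈ C n k, U ω ≤ k / 2 ^ n :=
    fun n k ω hω => csInf_le (hbdd ω) ⟨n, k, rfl, hω⟩
  have hUlt : ∀ (ω : Ω) (x : ℝ), U ω < x ↔ ∃ n k : ℕ, (k : ℝ) / 2 ^ n < x ∧ ω ∈ C n k := by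
    intro ω x
    rw [csInf_lt_iff (hbdd ω) ⟨1, h1S ω⟩]
    constructor
    · rintro ⟨_, ⟨n, k, rfl, hω⟩, hx⟩
      exact ⟨n, k, hx, hω⟩
    · rintro ⟨n, k, hx, hω⟩
      exact ⟨_, ⟨n, k, rfl, hω⟩, hx⟩
  have hUm : Measurable U := by
    refine measurable_of_Iio fun x => ?_
    have : U ⁻¹' Iio x = ⋃ (n : ℕ) (k : ℕ) (_ : (k : ℝ) / 2 ^ n < x), C n k := by
      ext ω
      simp only [mem_preimage, mem_Iio, hUlt, mem_iUnion, exists_prop]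
    rw [this]
    exact MeasurableSet.iUnion fun n => MeasurableSet.iUnion fun k =>
      MeasurableSet.iUnion fun _ => hCm n k
  have hcdf : ∀ D, MeasurableSet[m] D → ∀ t, 0 ≤ t → t < 1 →
      P.real (U ⁻¹' Iic t ∩ D) = t * P.real D := by
    intro D hD t ht0 ht1
    have hbound : ∀ n : ℕ, |P.real (U ⁻¹' Iic t ∩ D) - t * P.real D| ≤ (1 / 2) ^ n := by
      intro n
      have h2 : (0 : ℝ) < 2 ^ n := by positivity
      set k := ⌊t * 2 ^ n⌋₊ with hk
      have hk1 : (k : ℝ) ≤ t * 2 ^ n := Nat.floor_le (by positivity)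
      have hk2 : t * 2 ^ n < k + 1 := Nat.lt_floor_add_one _
      have hk3 : k < 2 ^ n := by
        have : (k : ℝ) < 2 ^ n := by nlinarith
        exact_mod_cast this
      have hlow : C n k ⊆ U ⁻¹' Iic t := fun ω hω =>
        (hUle n k ω hω).trans ((div_le_iff₀ h2).2 hk1)
      have hup : U ⁻¹' Iic t ⊆ C n (k + 1) := by
        intro ω hω
        have : U ω < ((k + 1 : ℕ) : ℝ) / 2 ^ n := by
          refine lt_of_le_of_lt hω ((lt_div_iff₀ h2).2 ?_)
          push_cast
          exact hk2
        obtain ⟨n', k', hlt, hmem⟩ := (hUlt _ _).1 this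
        exact hCsub _ _ _ _ hlt.le hmem
      have i1 : P.real (C n k ∩ D) ≤ P.real (U ⁻¹' Iic t ∩ D) :=
        measureReal_mono (inter_subset_inter_left _ hlow)
      have i2 : P.real (U ⁻¹' Iic t ∩ D) ≤ P.real (C n (k + 1) ∩ D) :=
        measureReal_mono (inter_subset_inter_left _ hup)
      rw [hCP n k hk3.le D hD] at i1
      rw [hCP n (k + 1) hk3 D hD] at i2
      have hD0 : 0 ≤ P.real D := measureReal_nonneg
      have hD1 : P.real D ≤ 1 := measureReal_le_one
      have j1 : (k : ℝ) / 2 ^ n ≤ t := (div_le_iff₀ h2).2 hk1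
      have j2 : t ≤ k / 2 ^ n + (1 / 2) ^ n := by
        rw [one_div, inv_pow, ← one_div, ← add_div]
        exact (le_div_iff₀ h2).2 hk2.le
      have j3 : ((k + 1 : ℕ) : ℝ) / 2 ^ n = k / 2 ^ n + (1 / 2) ^ n := by
        rw [one_div, inv_pow, ← one_div, ← add_div]
        push_cast
        rfl
      rw [j3] at i2
      have hp : (0 : ℝ) ≤ (1 / 2) ^ n := by positivity
      rw [abs_le]
      constructor <;> nlinarith
    have hlim : Tendsto (fun n : ℕ => (1 / 2 : ℝ) ^ n) atTop (nhds 0) :=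
      tendsto_pow_atTop_nhds_zero_of_lt_one (by norm_num) (by norm_num)
    have := ge_of_tendsto' hlim hbound
    exact sub_eq_zero.1 (abs_nonpos_iff.1 this)
  have hmap : ∀ D, MeasurableSet[m] D →
      (P.restrict D).map U = P D • volume.restrict (Icc (0 : ℝ) 1) := by
    intro D hD
    have : IsFiniteMeasure ((P.restrict D).map U) := Measure.isFiniteMeasure_map _ _
    refine Measure.ext_of_Iic _ _ fun t => ?_
    rw [Measure.map_apply hUm measurableSet_Iic,
      Measure.restrict_apply (hUm measurableSet_Iic), Measure.smul_apply,
      Measure.restrict_apply measurableSet_Iic, smul_eq_mul]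
    rcases lt_or_ge t 0 with ht0 | ht0
    · have e1 : U ⁻¹' Iic t = ∅ := by
        ext ω
        simpa using ht0.trans_le (hU0 ω)
      have e2 : Iic t ∩ Icc (0 : ℝ) 1 = ∅ := by
        ext x
        simp only [mem_inter_iff, mem_Iic, mem_Icc, mem_empty_iff_false, iff_false]
        rintro ⟨h1, h2, -⟩
        linarith
      simp [e1, e2]
    · rcases lt_or_ge t 1 with ht1 | ht1
      · have e2 : Iic t ∩ Icc (0 : ℝ) 1 = Icc 0 t := by
          ext x
          simp only [mem_inter_iff, mem_Iic, mem_Icc]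
          constructor
          · rintro ⟨h1, h2, -⟩
            exact ⟨h2, h1⟩
          · rintro ⟨h1, h2⟩
            exact ⟨h2, h1, by linarith⟩
        rw [e2, Real.volume_Icc, sub_zero, ← ofReal_measureReal (s := U ⁻¹' Iic t ∩ D),
          hcdf D hD t ht0 ht1, ENNReal.ofReal_mul ht0, ofReal_measureReal, mul_comm]
      · have e1 : U ⁻¹' Iic t = univ := by
          ext ω
          simpa using (hU1 ω).trans ht1
        have e2 : Iic t ∩ Icc (0 : ℝ) 1 = Icc 0 1 :=
          inter_eq_right.2 fun x hx => hx.2.trans ht1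
        simp [e1, e2]
  refine ⟨U, hUm, ?_, ?_⟩
  · simpa using hmap univ MeasurableSet.univ
  · rw [Indep_iff]
    rintro _ D ⟨T, hT, rfl⟩ hD
    have key : ∀ D, MeasurableSet[m] D →
        P (U ⁻¹' T ∩ D) = P D * volume.restrict (Icc (0 : ℝ) 1) T := by
      intro D hD
      rw [← Measure.restrict_apply (hUm hT), ← Measure.map_apply hUm hT, hmap D hD,
        Measure.smul_apply, smul_eq_mul]
    have hu := key univ MeasurableSet.univ
    rw [inter_univ, measure_univ, one_mul] at hu
    rw [key D hD, hu, mul_comm]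

lemma condAtomless_of_uniform_indep [IsProbabilityMeasure P] (hm : m ≤ m0) {U : Ω → ℝ}
    (hU : Measurable U) (hunif : P.map U = volume.restrict (Icc (0 : ℝ) 1))
    (hindep : Indep (MeasurableSpace.comap U inferInstance) m P) : CondAtomless m P := by
  intro A hA hPA
  by_contra! hcon
  set g := P[A.indicator (fun _ => (1 : ℝ)) | m] with hg
  have hgm : Measurable[m] g := stronglyMeasurable_condExp.measurable
  have hgi : Integrable g P := integrable_condExp
  have hgint : ∀ D, MeasurableSet[m] D → ∫ ω in D, g ω ∂P = P.real (A ∩ D) :=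
    fun D hD => setIntegral_condExp_indicator_one hm hA hD
  obtain ⟨n, hn⟩ : ∃ n : ℕ, 0 < P {ω | 1 / ((n : ℝ) + 1) < g ω} := by
    by_contra! h0
    have hle : g ≤ᵐ[P] 0 := by
      have : ∀ᵐ ω ∂P, ∀ n : ℕ, ω ∉ {ω | 1 / ((n : ℝ) + 1) < g ω} :=
        ae_all_iff.2 fun n => measure_eq_zero_iff_ae_notMem.1 (nonpos_iff_eq_zero.1 (h0 n))
      filter_upwards [this] with ω hω
      exact ge_of_tendsto' tendsto_one_div_add_atTop_nhds_zero_nat fun n => not_lt.1 (hω n)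
    have h1 : ∫ ω in univ, g ω ∂P ≤ 0 := by
      rw [setIntegral_univ]
      exact integral_nonpos_of_ae hle
    rw [hgint _ MeasurableSet.univ, inter_univ] at h1
    have : 0 < P.real A := measureReal_pos_of_measure_pos hPA
    linarith
  set ε : ℝ := 1 / ((n : ℝ) + 1) with hε
  have hε0 : 0 < ε := by positivity
  set D := {ω | ε < g ω} with hD
  have hDm : MeasurableSet[m] D := measurableSet_lt measurable_const hgm
  let I : ℤ → Set ℝ := fun k => Ico (k * ε) ((k + 1) * ε)
  have hnull : ∀ k, P (A ∩ U ⁻¹' I k ∩ D) = 0 := by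
    intro k
    have hV : MeasurableSet (U ⁻¹' I k) := hU measurableSet_Ico
    have hB : MeasurableSet (A ∩ U ⁻¹' I k) := hA.inter hV
    have hle : P[(A ∩ U ⁻¹' I k).indicator (fun _ => (1 : ℝ)) | m]
        ≤ᵐ[P] P[(U ⁻¹' I k).indicator (fun _ => (1 : ℝ)) | m] :=
      condExp_mono ((integrable_const _).indicator hB) ((integrable_const _).indicator hV)
        (ae_of_all _ fun ω =>
          indicator_le_indicator_of_subset inter_subset_right (fun _ => zero_le_one) ω)
    have heq : P[(U ⁻¹' I k).indicator (fun _ => (1 : ℝ)) | m] =ᵐ[P]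
        fun _ => ∫ ω, (U ⁻¹' I k).indicator (fun _ => (1 : ℝ)) ω ∂P :=
      condExp_indep_eq hU.comap_le hm
        (stronglyMeasurable_const.indicator ⟨I k, measurableSet_Ico, rfl⟩) hindep
    have hval : ∫ ω, (U ⁻¹' I k).indicator (fun _ => (1 : ℝ)) ω ∂P ≤ ε := by
      rw [integral_indicator hV, setIntegral_const, smul_eq_mul, mul_one]
      refine ENNReal.toReal_le_of_le_ofReal hε0.le ?_
      rw [← Measure.map_apply hU measurableSet_Ico, hunif]
      refine (Measure.restrict_apply_le _ _).trans ?_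
      rw [Real.volume_Ico]
      exact ENNReal.ofReal_le_ofReal (by linarith)
    have hc := measure_eq_zero_iff_ae_notMem.1
      (nonpos_iff_eq_zero.1 (hcon _ inter_subset_left hB))
    have hint := setIntegral_condExp_indicator_one (P := P) hm hB hDm
    have hzero : ∫ ω in D, (P[(A ∩ U ⁻¹' I k).indicator (fun _ => (1 : ℝ)) | m]) ω ∂P ≤ 0 := by
      refine setIntegral_nonpos_ae (hm _ hDm) ?_
      filter_upwards [hle, heq, hc] with ω h1 h2 h3 hω
      by_contra! h4
      refine h3 ⟨h4, ?_⟩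
      rw [h2] at h1
      exact (h1.trans hval).trans_lt hω
    rw [hint] at hzero
    exact (measureReal_eq_zero_iff).1 (hzero.antisymm measureReal_nonneg)
  have hAD : P (A ∩ D) = 0 := by
    refine measure_mono_null ?_ (measure_iUnion_null hnull)
    intro ω hω
    refine mem_iUnion.2 ⟨⌊U ω / ε⌋, ⟨hω.1, ?_, ?_⟩, hω.2⟩
    · exact (le_div_iff₀ hε0).1 (Int.floor_le _)
    · exact (div_lt_iff₀ hε0).1 (Int.lt_floor_add_one _)
  have hpos : 0 < ∫ ω in D, g ω ∂P :=
    setIntegral_pos_of_forall_pos (hm _ hDm) hgi (fun ω h => hε0.trans h) hn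
  rw [hgint D hDm, Measure.real, hAD] at hpos
  simp at hpos

end CondProb

/-- There exists a random variable `U`, uniformly distributed on `[0,1]` and independent of
the sub-σ-algebra `𝒜`, if and only if `F` is atomless conditionally to `𝒜`: for every
`A ∈ F` with `P[A] > 0` there is a measurable `B ⊆ A` with
`P[0 < E[1_B|𝒜] < E[1_A|𝒜]] > 0`. -/
theorem exists_uniform_indep_iff_condAtomless
    {Ω : Type*} (𝒜 : MeasurableSpace Ω) [MeasurableSpace Ω]
    {P : Measure Ω} [IsProbabilityMeasure P]
    (h𝒜 : 𝒜 ≤ ‹MeasurableSpace Ω›) :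
    (∃ U : Ω → ℝ, Measurable U ∧ P.map U = volume.restrict (Set.Icc (0:ℝ) 1) ∧
        IndepOfSigma 𝒜 U P)
    ↔ ∀ A : Set Ω, MeasurableSet A → 0 < P A →
        ∃ B : Set Ω, B ⊆ A ∧ MeasurableSet B ∧
          0 < P {ω | 0 < (P[B.indicator (fun _ => (1:ℝ)) | 𝒜]) ω ∧
                     (P[B.indicator (fun _ => (1:ℝ)) | 𝒜]) ω <
                       (P[A.indicator (fun _ => (1:ℝ)) | 𝒜]) ω} := by
  exact ⟨fun ⟨_, hU, hunif, hindep⟩ => condAtomless_of_uniform_indep h𝒜 hU hunif hindep,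
    fun h => CondAtomless.exists_uniform_indep h𝒜 h⟩
end
end

section
/- Let (Ω,F,P) be a probability space, A₀ ⊆ F a sub-σ-algebra, and A ∈ F a set independent of A₀ with P[A] = 1/2. Let B, C ∈ A₀ and D = (A ∩ B) ∪ (Aᶜ ∩ C). If D is independent of A₀, then (up to null sets) either B = C = Ω (so P[D] = 1), or B = C = ∅ (so P[D] = 0), or C = Bᶜ (so P[D] = 1/2). -/
open MeasureTheory ProbabilityTheory Filter Set
open scoped ENNReal

noncomputable section

/-- The product formula for the real-valued measures of independent events. -/
theorem ProbabilityTheory.Indep.measureReal_inter {Ω : Type*} {m₁ m₂ m : MeasurableSpace Ω}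
    {P : @Measure Ω m} (h : Indep m₁ m₂ P) {S T : Set Ω}
    (hS : MeasurableSet[m₁] S) (hT : MeasurableSet[m₂] T) :
    P.real (S ∩ T) = P.real S * P.real T := by
  simp [Measure.real, Indep_iff m₁ m₂ P |>.1 h S T hS hT]

/-- Let `A` be independent of `𝒜₀` with `P[A] = 1/2`, let `B, C ∈ 𝒜₀` and
`D = (A ∩ B) ∪ (Aᶜ ∩ C)`. If `D` is independent of `𝒜₀`, then up to null sets either
`B = C = Ω` (and `P[D] = 1`), or `B = C = ∅` (and `P[D] = 0`), or `C = Bᶜ`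
(and `P[D] = 1/2`). -/
theorem indep_mix_classification_half
    {Ω : Type*} (𝒜₀ : MeasurableSpace Ω) [MeasurableSpace Ω]
    {P : Measure Ω} [IsProbabilityMeasure P]
    (h𝒜₀ : 𝒜₀ ≤ ‹MeasurableSpace Ω›)
    (A : Set Ω) (hA : MeasurableSet A)
    (hAindep : ProbabilityTheory.Indep (MeasurableSpace.generateFrom {A}) 𝒜₀ P)
    (hPA : P A = 1/2)
    (B C : Set Ω) (hB : MeasurableSet[𝒜₀] B) (hC : MeasurableSet[𝒜₀] C)
    (hD : ProbabilityTheory.Indep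
      (MeasurableSpace.generateFrom {(A ∩ B) ∪ (Aᶜ ∩ C)}) 𝒜₀ P) :
    (P Bᶜ = 0 ∧ P Cᶜ = 0 ∧ P ((A ∩ B) ∪ (Aᶜ ∩ C)) = 1)
    ∨ (P B = 0 ∧ P C = 0 ∧ P ((A ∩ B) ∪ (Aᶜ ∩ C)) = 0)
    ∨ (P (symmDiff C Bᶜ) = 0 ∧ P ((A ∩ B) ∪ (Aᶜ ∩ C)) = 1/2) := by
  set D := (A ∩ B) ∪ (Aᶜ ∩ C) with hDdef
  have hAgen : MeasurableSet[MeasurableSpace.generateFrom {A}] A :=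
    MeasurableSpace.measurableSet_generateFrom rfl
  have hDgen : MeasurableSet[MeasurableSpace.generateFrom {D}] D :=
    MeasurableSpace.measurableSet_generateFrom rfl
  have hB' := h𝒜₀ _ hB
  have hC' := h𝒜₀ _ hC
  have hA_half : P.real A = 1 / 2 := by simp [Measure.real, hPA]
  have hAc_half : P.real Aᶜ = 1 / 2 := by rw [probReal_compl_eq_one_sub hA, hA_half]; norm_num
  -- the product formula on the four atoms generated by `B` and `C`
  have hBC : P.real (B ∩ C) = P.real D * P.real (B ∩ C) := by
    rw [← hD.measureReal_inter hDgen (hB.inter hC)]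
    congr 1; ext x; simp only [hDdef, mem_inter_iff, mem_union, mem_compl_iff]; tauto
  have hBdC : 1 / 2 * P.real (B \ C) = P.real D * P.real (B \ C) := by
    rw [← hD.measureReal_inter hDgen (hB.diff hC), ← hA_half,
      ← hAindep.measureReal_inter hAgen (hB.diff hC)]
    congr 1; ext x; simp only [hDdef, mem_inter_iff, mem_union, mem_compl_iff, Set.mem_sdiff]; tauto
  have hCdB : 1 / 2 * P.real (C \ B) = P.real D * P.real (C \ B) := by
    rw [← hD.measureReal_inter hDgen (hC.diff hB), ← hAc_half,
      ← hAindep.measureReal_inter hAgen.compl (hC.diff hB)]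
    congr 1; ext x; simp only [hDdef, mem_inter_iff, mem_union, mem_compl_iff, Set.mem_sdiff]; tauto
  have hcompl : 0 = P.real D * P.real (Bᶜ \ C) := by
    rw [← hD.measureReal_inter hDgen (hB.compl.diff hC), ← measureReal_empty (μ := P)]
    congr 1; ext x
    simp only [hDdef, mem_inter_iff, mem_union, mem_compl_iff, Set.mem_sdiff, mem_empty_iff_false]
    tauto
  have hBsum : P.real (B ∩ C) + P.real (B \ C) = P.real B := measureReal_inter_add_sdiff hC'
  have hCsum : P.real (B ∩ C) + P.real (C \ B) = P.real C := by
    rw [inter_comm]; exact measureReal_inter_add_sdiff hB'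
  have hBcsum : P.real (C \ B) + P.real (Bᶜ \ C) = P.real Bᶜ := by
    rw [Set.sdiff_eq, inter_comm]; exact measureReal_inter_add_sdiff hC'
  have hBc : P.real Bᶜ = 1 - P.real B := probReal_compl_eq_one_sub hB'
  have hCc : P.real Cᶜ = 1 - P.real C := probReal_compl_eq_one_sub hC'
  have hsymm : P.real (symmDiff C Bᶜ) = P.real (B ∩ C) + P.real (Bᶜ \ C) := by
    rw [Set.symmDiff_def, measureReal_union disjoint_sdiff_sdiff (hB'.compl.diff hC'),
      Set.sdiff_compl, inter_comm]
  have hzero : ∀ S, P S = 0 ↔ P.real S = 0 := fun S ↦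
    (measureReal_eq_zero_iff (measure_ne_top P S)).symm
  have hone : P D = 1 ↔ P.real D = 1 := by
    rw [Measure.real, ← ENNReal.toReal_eq_toReal_iff' (measure_ne_top P D) ENNReal.one_ne_top,
      ENNReal.toReal_one]
  have hhalf : P D = 1 / 2 ↔ P.real D = 1 / 2 := by
    rw [Measure.real, ← ENNReal.toReal_eq_toReal_iff' (measure_ne_top P D) (by simp)]
    simp
  simp only [hzero, hone, hhalf]
  by_cases h_half : P.real D = 1 / 2
  · rw [h_half] at hBC hcompl
    exact .inr <| .inr ⟨by linarith, h_half⟩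
  have hb : P.real (B \ C) = 0 := by
    by_contra h
    exact h_half (mul_right_cancel₀ h hBdC).symm
  have hc : P.real (C \ B) = 0 := by
    by_contra h
    exact h_half (mul_right_cancel₀ h hCdB).symm
  by_cases h_one : P.real D = 1
  · rw [h_one] at hcompl
    exact .inl ⟨by linarith, by linarith, h_one⟩
  have ha : P.real (B ∩ C) = 0 := by
    by_contra h
    exact h_one (mul_right_cancel₀ h ((one_mul _).trans hBC)).symm
  have hd : P.real (Bᶜ \ C) = 1 := by linarith
  rw [hd, mul_one] at hcompl
  exact .inr <| .inl ⟨by linarith, by linarith, hcompl.symm⟩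
end
end

section
/- Let (Ω,F,P) be a probability space, A₀ ⊆ F a sub-σ-algebra, and A ∈ F a set independent of A₀ with P[A] ≠ 1/2 and 0 < P[A] < 1. Let B, C ∈ A₀ and D = (A ∩ B) ∪ (Aᶜ ∩ C). If D is independent of A₀, then (up to null sets) P[D] = 0, or P[D] = 1, or D = A, or D = Aᶜ. -/
open MeasureTheory ProbabilityTheory Filter Set
open scoped ENNReal

noncomputable section

/-- If `D` is independent of `m` and coincides with `X` on an `m`-measurable set `E` with which `X`
is uncorrelated, then `D` and `X` have the same probability unless `E` is null. -/
lemma measure_eq_zero_or_measure_eq_of_indep {Ω : Type*} {m : MeasurableSpace Ω}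
    [MeasurableSpace Ω] {P : Measure Ω} [IsProbabilityMeasure P] {D X E : Set Ω}
    (hD : ProbabilityTheory.Indep (MeasurableSpace.generateFrom {D}) m P)
    (hE : MeasurableSet[m] E) (hDX : D ∩ E = X ∩ E) (hX : P (X ∩ E) = P X * P E) :
    P E = 0 ∨ P D = P X := by
  have h := (ProbabilityTheory.Indep_iff _ _ _).1 hD D E
    (MeasurableSpace.measurableSet_generateFrom rfl) hE
  rw [hDX, hX] at h
  by_cases h0 : P E = 0
  · exact Or.inl h0
  · exact Or.inr ((ENNReal.mul_left_inj h0 (measure_ne_top P E)).1 h).symm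

/-- Let `A` be independent of `𝒜₀` with `P[A] ≠ 1/2`, `0 < P[A] < 1`, let `B, C ∈ 𝒜₀` and
`D = (A ∩ B) ∪ (Aᶜ ∩ C)`. If `D` is independent of `𝒜₀`, then up to null sets `P[D] = 0`,
or `P[D] = 1`, or `D = A`, or `D = Aᶜ`. -/
theorem indep_mix_classification_ne_half
    {Ω : Type*} (𝒜₀ : MeasurableSpace Ω) [MeasurableSpace Ω]
    {P : Measure Ω} [IsProbabilityMeasure P]
    (h𝒜₀ : 𝒜₀ ≤ ‹MeasurableSpace Ω›)
    (A : Set Ω) (hA : MeasurableSet A)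
    (hAindep : ProbabilityTheory.Indep (MeasurableSpace.generateFrom {A}) 𝒜₀ P)
    (hPA : P A ≠ 1/2) (hPA0 : 0 < P A) (hPA1 : P A < 1)
    (B C : Set Ω) (hB : MeasurableSet[𝒜₀] B) (hC : MeasurableSet[𝒜₀] C)
    (hD : ProbabilityTheory.Indep
      (MeasurableSpace.generateFrom {(A ∩ B) ∪ (Aᶜ ∩ C)}) 𝒜₀ P) :
    P ((A ∩ B) ∪ (Aᶜ ∩ C)) = 0
    ∨ P ((A ∩ B) ∪ (Aᶜ ∩ C)) = 1
    ∨ P (symmDiff ((A ∩ B) ∪ (Aᶜ ∩ C)) A) = 0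
    ∨ P (symmDiff ((A ∩ B) ∪ (Aᶜ ∩ C)) Aᶜ) = 0 := by
  set D := (A ∩ B) ∪ (Aᶜ ∩ C) with hDdef
  have hBc := hB.compl
  have hCc := hC.compl
  have hAE (E : Set Ω) (hE : MeasurableSet[𝒜₀] E) : P (A ∩ E) = P A * P E :=
    (ProbabilityTheory.Indep_iff _ _ _).1 hAindep A E
      (MeasurableSpace.measurableSet_generateFrom rfl) hE
  have hAcE (E : Set Ω) (hE : MeasurableSet[𝒜₀] E) : P (Aᶜ ∩ E) = P Aᶜ * P E :=
    (ProbabilityTheory.Indep_iff _ _ _).1 hAindep Aᶜ E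
      (MeasurableSpace.measurableSet_generateFrom (mem_singleton A)).compl hE
  have hBC := measure_eq_zero_or_measure_eq_of_indep (X := univ) hD (hB.inter hC)
    (by ext x; simp only [hDdef, mem_inter_iff, mem_union, mem_compl_iff, mem_univ]; tauto)
    (by simp)
  have hBcCc := measure_eq_zero_or_measure_eq_of_indep (X := ∅) hD (hBc.inter hCc)
    (by ext x; simp only [hDdef, mem_inter_iff, mem_union, mem_compl_iff, mem_empty_iff_false]
        tauto)
    (by simp)
  have hBCc := measure_eq_zero_or_measure_eq_of_indep (X := A) hD (hB.inter hCc)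
    (by ext x; simp only [hDdef, mem_inter_iff, mem_union, mem_compl_iff]; tauto)
    (hAE _ (hB.inter hCc))
  have hBcC := measure_eq_zero_or_measure_eq_of_indep (X := Aᶜ) hD (hBc.inter hC)
    (by ext x; simp only [hDdef, mem_inter_iff, mem_union, mem_compl_iff]; tauto)
    (hAcE _ (hBc.inter hC))
  rcases hBC with hBC | h
  swap
  · exact Or.inr (Or.inl (h.trans measure_univ))
  rcases hBcCc with hBcCc | h
  swap
  · exact Or.inl (h.trans measure_empty)
  have hnull := measure_union_null hBC hBcCc
  rcases hBCc with hBCc | hDA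
  · refine Or.inr (Or.inr (Or.inr (measure_mono_null ?_ (measure_union_null hnull hBCc))))
    intro x
    simp only [hDdef, mem_symmDiff, mem_inter_iff, mem_union, mem_compl_iff]
    tauto
  rcases hBcC with hBcC | hDAc
  · refine Or.inr (Or.inr (Or.inl (measure_mono_null ?_ (measure_union_null hnull hBcC))))
    intro x
    simp only [hDdef, mem_symmDiff, mem_inter_iff, mem_union, mem_compl_iff]
    tauto
  · refine absurd ?_ hPA
    have hsum := prob_add_prob_compl (μ := P) hA
    rw [← hDAc, hDA, ← two_mul, mul_comm] at hsum
    exact ENNReal.eq_div_iff (by simp) (by simp) |>.2 ((mul_comm _ _).trans hsum)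
end
end
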